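/- arXiv:2111.09291 — 2 statements merged into one kernel-verified Lean document; each statement's English description precedes it below -/
import Mathlib

section
/- There exists a universal constant C > 0 such that for all complex-valued Schwartz functions f, g, h ∈ 𝒮(ℝ), the function [f, g; h](α) := (1/(iπ)) ∫_ℝ ((f(α) − f(β))/(α − β))·((g(α) − g(β))/(α − β))·h(β) dβ satisfies ‖[f, g; h]‖_{L^∞(ℝ)} + ‖[f, g; h]‖_{Ḣ^{1/2}} ≤ C·‖f'‖_{L^∞(ℝ)}·‖g'‖_{L²(ℝ)}·‖h‖_{L²(ℝ)}. -/
open MeasureTheory Complex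
open scoped ENNReal NNReal

/-- The homogeneous `Ḣ^{1/2}` seminorm,
`‖u‖_{Ḣ^{1/2}}² = (1/(2π)) ∫∫ |u(α) − u(β)|²/(α − β)² dβ dα`, valued in `[0,∞]`. -/
noncomputable def Hhalf {E : Type*} [NormedAddCommGroup E] (u : ℝ → E) : ℝ≥0∞ :=
  (ENNReal.ofReal (1 / (2 * Real.pi)) *
    ∫⁻ α : ℝ, ∫⁻ β : ℝ, ENNReal.ofReal (‖u α - u β‖ ^ 2 / (α - β) ^ 2)) ^ (1/2 : ℝ)

namespace TB

/-- the weight `1/r^2` -/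
noncomputable def kap (r : ℝ) : ℝ≥0∞ := ENNReal.ofReal (1 / r ^ 2)

noncomputable def pm (ω s : ℝ) : ℂ := (Complex.exp ((ω * s : ℝ) * I) - 1) / (s : ℂ)

lemma exp_bd (t : ℝ) : ‖Complex.exp (t * I) - 1‖ ≤ |t| := by
  have := Real.norm_exp_I_mul_ofReal_sub_one_le (x := t)
  rw [mul_comm]; simpa using this

lemma exp_diff (t t' : ℝ) : ‖Complex.exp (t * I) - Complex.exp (t' * I)‖ ≤ |t - t'| := by
  have h : Complex.exp (t * I) - Complex.exp (t' * I)
      = Complex.exp (t' * I) * (Complex.exp ((t - t' : ℝ) * I) - 1) := by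
    rw [mul_sub, ← Complex.exp_add]; push_cast; ring_nf
  rw [h, norm_mul, Complex.norm_exp_ofReal_mul_I, one_mul]
  exact exp_bd _

lemma exp_two (t : ℝ) : ‖Complex.exp (t * I) - 1‖ ≤ 2 := by
  refine (norm_sub_le _ _).trans ?_
  rw [Complex.norm_exp_ofReal_mul_I]; norm_num

lemma m_int (s : ℝ) (hs : s ≠ 0) : pm 1 s = I * ∫ u in (0:ℝ)..1, Complex.exp ((u * s : ℝ) * I) := by
  have hc : (s : ℂ) * I ≠ 0 := by simp [hs]
  have := integral_exp_mul_complex (a := 0) (b := 1) hc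
  have h2 : ∫ u in (0:ℝ)..1, Complex.exp ((u * s : ℝ) * I) = (Complex.exp (s * I) - 1) / (s * I) := by
    have h3 : ∫ u in (0:ℝ)..1, Complex.exp ((u * s : ℝ) * I)
        = ∫ u in (0:ℝ)..1, Complex.exp ((s : ℂ) * I * u) := by
      congr 1; ext u; push_cast; ring_nf
    rw [h3, this]; simp
  rw [h2, pm]
  have : (s:ℂ) ≠ 0 := by exact_mod_cast hs
  field_simp
  try simp

lemma m_lip (s s' : ℝ) (hs : s ≠ 0) (hs' : s' ≠ 0) : ‖pm 1 s - pm 1 s'‖ ≤ |s - s'| := by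
  rw [m_int s hs, m_int s' hs', ← mul_sub, norm_mul, norm_I, one_mul,
    ← intervalIntegral.integral_sub (by apply Continuous.intervalIntegrable; fun_prop)
      (by apply Continuous.intervalIntegrable; fun_prop)]
  have := intervalIntegral.norm_integral_le_of_norm_le_const (a := (0:ℝ)) (b := 1)
    (f := fun u : ℝ => Complex.exp ((u * s : ℝ) * I) - Complex.exp ((u * s' : ℝ) * I))
    (C := |s - s'|) ?_
  · simpa using this
  · intro u hu
    rw [Set.uIoc_of_le zero_le_one] at hu
    refine (exp_diff _ _).trans ?_
    rw [← mul_sub, abs_mul, abs_of_pos hu.1]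
    nlinarith [hu.2, abs_nonneg (s - s')]

lemma m_far (s s' : ℝ) (hs : s ≠ 0) (hs' : s' ≠ 0) : ‖pm 1 s - pm 1 s'‖ * |s| ≤ 2 * |s - s'| := by
  have e : (pm 1 s - pm 1 s') * s = (Complex.exp (s * I) - Complex.exp (s' * I))
      + (Complex.exp (s' * I) - 1) / s' * ((s' - s : ℝ) : ℂ) := by
    have : (s:ℂ) ≠ 0 := by exact_mod_cast hs
    have : (s':ℂ) ≠ 0 := by exact_mod_cast hs'
    simp only [pm]; push_cast; field_simp; ring
  have e2 : ‖pm 1 s - pm 1 s'‖ * |s| = ‖(pm 1 s - pm 1 s') * s‖ := by simp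
  rw [e2, e]
  refine (norm_add_le _ _).trans ?_
  have h1 := exp_diff s s'
  have h2 : ‖(Complex.exp (s' * I) - 1) / s'‖ ≤ 1 := by
    rw [norm_div]
    have : 0 < |s'| := abs_pos.2 hs'
    simp only [norm_real, Real.norm_eq_abs]
    rw [div_le_one this]; exact exp_bd s'
  rw [norm_mul, norm_real, Real.norm_eq_abs, abs_sub_comm s' s]
  nlinarith [abs_nonneg (s - s')]

lemma m_sz (s : ℝ) (hs : s ≠ 0) : ‖pm 1 s‖ ^ 2 ≤ 5 / (1 + s ^ 2) := by
  have hp : 0 < |s| := abs_pos.2 hs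
  have e : ‖pm 1 s‖ * |s| = ‖Complex.exp (s * I) - 1‖ := by
    simp [pm]; field_simp
  have h1 : ‖pm 1 s‖ ≤ 1 := by
    have := exp_bd s
    rw [← e] at this
    nlinarith
  have h2 : ‖pm 1 s‖ * |s| ≤ 2 := by rw [e]; exact exp_two s
  rw [le_div_iff₀ (by positivity), ← sq_abs s]
  nlinarith [norm_nonneg (pm 1 s), mul_nonneg (norm_nonneg (pm 1 s)) hp.le]

lemma m_pt (s s' : ℝ) (hs : s ≠ 0) (hs' : s' ≠ 0) :
    ‖pm 1 s - pm 1 s'‖ ^ 2 * (1 / (s - s') ^ 2) ≤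
      20 * (1 / (1 + s ^ 2) + 1 / (1 + s' ^ 2)) * (1 / (1 + (s - s') ^ 2)) := by
  by_cases h0 : s - s' = 0
  · rw [h0]; simp; positivity
  have hr : 0 < (s - s') ^ 2 := by positivity
  have hw : (0:ℝ) < 1 / (1 + s ^ 2) := by positivity
  have hw' : (0:ℝ) < 1 / (1 + s' ^ 2) := by positivity
  rw [mul_one_div, mul_one_div, div_le_div_iff₀ hr (by positivity)]
  rcases le_total ((s - s')^2) 1 with h | h
  · have h1 := m_lip s s' hs hs'
    have h2 := m_far s s' hs hs'
    have h3 : ‖pm 1 s - pm 1 s'‖ ^ 2 ≤ 5 * (s - s') ^ 2 * (1 / (1 + s ^ 2)) := by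
      rw [mul_one_div, le_div_iff₀ (by positivity), ← sq_abs s, ← sq_abs (s - s')]
      have a1 := pow_le_pow_left₀ (norm_nonneg _) h1 2
      have a2 := pow_le_pow_left₀ (by positivity) h2 2
      nlinarith
    calc _ ≤ 5 * (s - s') ^ 2 * (1 / (1 + s ^ 2)) * 2 := by gcongr; linarith
      _ ≤ _ := by
        have : 0 ≤ (s - s') ^ 2 * (1 / (1 + s ^ 2)) := by positivity
        have : 0 ≤ (s - s') ^ 2 * (1 / (1 + s' ^ 2)) := by positivity
        nlinarith
  · have h1 := m_sz s hs
    have h2 := m_sz s' hs'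
    have h3 : ‖pm 1 s - pm 1 s'‖ ^ 2 ≤ 2 * (‖pm 1 s‖ ^ 2 + ‖pm 1 s'‖ ^ 2) := by
      have := norm_sub_le (pm 1 s) (pm 1 s')
      have := pow_le_pow_left₀ (norm_nonneg _) this 2
      nlinarith [sq_nonneg (‖pm 1 s‖ - ‖pm 1 s'‖)]
    have h4 : ‖pm 1 s - pm 1 s'‖ ^ 2 ≤ 10 * (1 / (1 + s ^ 2) + 1 / (1 + s' ^ 2)) := by
      have : 5 / (1 + s ^ 2) = 5 * (1 / (1 + s ^ 2)) := by ring
      have : 5 / (1 + s' ^ 2) = 5 * (1 / (1 + s' ^ 2)) := by ring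
      linarith
    calc _ ≤ 10 * (1 / (1 + s ^ 2) + 1 / (1 + s' ^ 2)) * (2 * (s-s')^2) := by gcongr; linarith
      _ = _ := by ring

lemma pm_scale (ω s : ℝ) (hω : ω ≠ 0) : pm ω s = ω * pm 1 (ω * s) := by
  by_cases hs : s = 0
  · simp [hs, pm]
  have : (s:ℂ) ≠ 0 := by exact_mod_cast hs
  have : (ω:ℂ) ≠ 0 := by exact_mod_cast hω
  simp only [pm]; push_cast; field_simp

noncomputable def ww (x : ℝ) : ℝ≥0∞ := ENNReal.ofReal (1 / (1 + x ^ 2))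

lemma ww_meas : Measurable ww := by unfold ww; fun_prop

lemma pm_pt (ω s s' : ℝ) (hω : ω ≠ 0) (hs : s ≠ 0) (hs' : s' ≠ 0) :
    ‖pm ω s - pm ω s'‖ₑ ^ 2 * kap (s - s') ≤
      ENNReal.ofReal (20 * ω ^ 4) * ((ww (ω * s) + ww (ω * s')) * ww (ω * (s - s'))) := by
  have h := m_pt (ω * s) (ω * s') (by positivity) (by positivity)
  rw [pm_scale ω s hω, pm_scale ω s' hω, ← mul_sub]
  unfold ww kap
  rw [← ENNReal.ofReal_add (by positivity) (by positivity), ← ENNReal.ofReal_mul (by positivity),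
    ← ENNReal.ofReal_mul (by positivity), ← ofReal_norm, ← ENNReal.ofReal_pow (by positivity),
    ← ENNReal.ofReal_mul (by positivity)]
  apply ENNReal.ofReal_le_ofReal
  rw [norm_mul, mul_pow, norm_real, Real.norm_eq_abs, sq_abs]
  have e : 1 / (s - s') ^ 2 = ω ^ 2 * (1 / (ω * s - ω * s') ^ 2) := by
    rw [← mul_sub, mul_pow]; field_simp
  rw [e]
  have := mul_le_mul_of_nonneg_left h (by positivity : 0 ≤ ω ^ 4)
  rw [mul_sub ω s s']
  linarith

lemma ww_int (ω : ℝ) (hω : ω ≠ 0) : ∫⁻ s, ww (ω * s) = ENNReal.ofReal (Real.pi / |ω|) := by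
  unfold ww
  have hi : Integrable (fun x : ℝ => 1 / (1 + x ^ 2)) := by
    simpa using integrable_inv_one_add_sq
  rw [← ofReal_integral_eq_lintegral_ofReal (hi.comp_mul_left' hω)
    (Filter.Eventually.of_forall fun x => by positivity)]
  rw [Measure.integral_comp_mul_left (fun x : ℝ => 1 / (1 + x ^ 2)) ω]
  simp [integral_univ_inv_one_add_sq]
  rw [← ENNReal.ofReal_mul (by positivity)]
  congr 1
  field_simp

lemma pm_meas : Measurable (fun z : ℝ × ℝ => pm z.1 z.2) := by unfold pm; fun_prop
lemma kap_meas : Measurable kap := by unfold kap; fun_prop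

lemma pm_int (ω : ℝ) : ∫⁻ s, ∫⁻ s', ‖pm ω s - pm ω s'‖ₑ ^ 2 * kap (s - s') ≤
    ENNReal.ofReal (40 * Real.pi ^ 2) * ENNReal.ofReal (ω ^ 2) := by
  by_cases hω : ω = 0
  · subst hω; simp [pm]
  have hne : ∀ᵐ s : ℝ, s ≠ 0 := by
    simp [ae_iff]
  have hm := ww_meas
  calc _ ≤ ∫⁻ s, ∫⁻ s', ENNReal.ofReal (20 * ω ^ 4) * ((ww (ω * s) + ww (ω * s')) * ww (ω * (s - s'))) := by
        apply lintegral_mono_ae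
        filter_upwards [hne] with s hs
        apply lintegral_mono_ae
        filter_upwards [hne] with s' hs'
        exact pm_pt ω s s' hω hs hs'
    _ = ENNReal.ofReal (20 * ω ^ 4) * (∫⁻ s, ∫⁻ s', (ww (ω * s) * ww (ω * (s - s'))
          + ww (ω * s') * ww (ω * (s - s')))) := by
        rw [← lintegral_const_mul']
        · congr 1; ext s
          rw [← lintegral_const_mul']
          · simp_rw [add_mul]
          · exact ENNReal.ofReal_ne_top
        · exact ENNReal.ofReal_ne_top
    _ = ENNReal.ofReal (20 * ω ^ 4) * ((∫⁻ s, ∫⁻ s', ww (ω * s) * ww (ω * (s - s')))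
          + ∫⁻ s, ∫⁻ s', ww (ω * s') * ww (ω * (s - s'))) := by
        congr 1
        rw [← lintegral_add_left (by fun_prop)]
        congr 1; ext s
        rw [lintegral_add_left (by fun_prop)]
    _ = ENNReal.ofReal (20 * ω ^ 4) * (2 * (ENNReal.ofReal (Real.pi / |ω|) * ENNReal.ofReal (Real.pi / |ω|))) := by
        congr 1
        rw [two_mul]
        congr 1
        · have : ∀ s, ∫⁻ s', ww (ω * s) * ww (ω * (s - s')) = ww (ω * s) * ENNReal.ofReal (Real.pi / |ω|) := by
            intro s
            rw [lintegral_const_mul _ (by fun_prop), ← ww_int ω hω]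
            congr 1
            exact lintegral_sub_left_eq_self (fun x => ww (ω * x)) s
          simp_rw [this]
          rw [lintegral_mul_const _ (by fun_prop), ww_int ω hω]
        · rw [lintegral_lintegral_swap (by fun_prop)]
          have : ∀ s', ∫⁻ s, ww (ω * s') * ww (ω * (s - s')) = ww (ω * s') * ENNReal.ofReal (Real.pi / |ω|) := by
            intro s
            rw [lintegral_const_mul _ (by fun_prop), ← ww_int ω hω]
            congr 1
            exact lintegral_sub_right_eq_self (fun x => ww (ω * x)) s
          simp_rw [this]
          rw [lintegral_mul_const _ (by fun_prop), ww_int ω hω]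
    _ = _ := by
        have h2 : (2 : ℝ≥0∞) = ENNReal.ofReal 2 := by simp
        rw [h2, ← ENNReal.ofReal_mul (by positivity), ← ENNReal.ofReal_mul (by positivity),
          ← ENNReal.ofReal_mul (by positivity), ← ENNReal.ofReal_mul (by positivity)]
        congr 1
        have : 0 < |ω| := abs_pos.2 hω
        have e : ω ^ 4 = |ω| ^ 4 := by rw [← abs_pow, abs_of_nonneg]; positivity
        rw [e, ← sq_abs ω]
        field_simp
        ring

end TB

namespace TB
open scoped FourierTransform SchwartzMap

noncomputable def qq (f : ℝ → ℂ) (β s : ℝ) : ℂ := (f (β + s) - f β) / (s : ℂ)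

lemma lint_sq (f : 𝓢(ℝ, ℂ)) : ∫⁻ x, ‖f x‖ₑ ^ 2 = ENNReal.ofReal (∫ x, ‖f x‖ ^ 2) := by
  have hi : Integrable (fun x => ‖f x‖ ^ 2) := (f.memLp 2).integrable_norm_pow (by norm_num)
  rw [ofReal_integral_eq_lintegral_ofReal hi (Filter.Eventually.of_forall fun x => by positivity)]
  congr 1; ext x
  rw [ENNReal.ofReal_pow (by positivity), ofReal_norm]

lemma planch (f : 𝓢(ℝ, ℂ)) : ∫⁻ x, ‖𝓕 f x‖ₑ ^ 2 = ∫⁻ x, ‖f x‖ₑ ^ 2 := by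
  rw [lint_sq, lint_sq, SchwartzMap.integral_norm_sq_fourier]

noncomputable def DD (f : 𝓢(ℝ, ℂ)) (s : ℝ) : 𝓢(ℝ, ℂ) :=
  ((s : ℂ)⁻¹) • (f.compSubConstCLM ℂ (-s) - f)

lemma DD_apply (f : 𝓢(ℝ, ℂ)) (s β : ℝ) : DD f s β = qq f β s := by
  simp [DD, qq]; ring

lemma fourier_shift (f : 𝓢(ℝ, ℂ)) (s ξ : ℝ) : 𝓕 (f.compSubConstCLM ℂ (-s)) ξ =
    Complex.exp ((2 * Real.pi * ξ * s : ℝ) * I) * 𝓕 f ξ := by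
  rw [SchwartzMap.fourier_coe, SchwartzMap.fourier_coe]
  have := congrFun (VectorFourier.fourierIntegral_comp_add_right Real.fourierChar volume (innerₗ ℝ) (⇑f) s) ξ
  have e : (⇑(f.compSubConstCLM ℂ (-s))) = f ∘ fun v => v + s := by
    ext v; simp
  rw [e]
  refine (this.trans ?_)
  rw [Circle.smul_def, Real.fourierChar_apply, smul_eq_mul]
  congr 2
  simp; ring

lemma fourier_DD (f : 𝓢(ℝ, ℂ)) (s ξ : ℝ) : 𝓕 (DD f s) ξ = pm (2 * Real.pi * ξ) s * 𝓕 f ξ := by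
  have : 𝓕 (DD f s) = ((s : ℂ)⁻¹) • (𝓕 (f.compSubConstCLM ℂ (-s)) - 𝓕 f) := by
    simp only [DD, ← SchwartzMap.fourierTransformCLM_apply (𝕜 := ℂ), map_smul, map_sub]
  rw [this]
  simp only [_root_.smul_apply, _root_.sub_apply, fourier_shift, pm, smul_eq_mul]
  ring

lemma fourier_D (f : 𝓢(ℝ, ℂ)) (ξ : ℝ) :
    𝓕 (SchwartzMap.derivCLM ℂ ℂ f) ξ = (2 * Real.pi * ξ : ℝ) * I * 𝓕 f ξ := by
  rw [SchwartzMap.fourier_coe, SchwartzMap.fourier_coe]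
  have := congrFun (Real.fourier_deriv f.integrable f.differentiable (SchwartzMap.derivCLM ℂ ℂ f).integrable) ξ
  refine this.trans ?_
  rw [smul_eq_mul]; push_cast; ring

lemma lemA_slice (f : 𝓢(ℝ, ℂ)) (s s' : ℝ) : ∫⁻ β, ‖qq f β s - qq f β s'‖ₑ ^ 2 =
    ∫⁻ ξ, ‖pm (2 * Real.pi * ξ) s - pm (2 * Real.pi * ξ) s'‖ₑ ^ 2 * ‖𝓕 f ξ‖ₑ ^ 2 := by
  have := planch (DD f s - DD f s')
  simp only [_root_.sub_apply, DD_apply] at this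
  rw [← this]
  congr 1; ext ξ
  have : 𝓕 (DD f s - DD f s') = 𝓕 (DD f s) - 𝓕 (DD f s') := by
    simp only [← SchwartzMap.fourierTransformCLM_apply (𝕜 := ℂ), map_sub]
  rw [this, _root_.sub_apply, fourier_DD, fourier_DD, ← sub_mul, enorm_mul, mul_pow]

lemma qq_meas {f : ℝ → ℂ} (hf : Measurable f) : Measurable (fun z : ℝ × ℝ => qq f z.1 z.2) := by
  unfold qq; fun_prop

@[fun_prop]
lemma qq_meas' {X : Type*} [MeasurableSpace X] {f : ℝ → ℂ} (hf : Measurable f) {u v : X → ℝ}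
    (hu : Measurable u) (hv : Measurable v) : Measurable (fun x => qq f (u x) (v x)) :=
  (qq_meas hf).comp (hu.prodMk hv)

@[fun_prop]
lemma pm_meas' {X : Type*} [MeasurableSpace X] {u v : X → ℝ}
    (hu : Measurable u) (hv : Measurable v) : Measurable (fun x => pm (u x) (v x)) := by
  unfold pm; fun_prop

@[fun_prop]
lemma kap_meas' {X : Type*} [MeasurableSpace X] {u : X → ℝ}
    (hu : Measurable u) : Measurable (fun x => kap (u x)) :=
  kap_meas.comp hu

@[fun_prop]
lemma sch_meas (f : 𝓢(ℝ, ℂ)) : Measurable (⇑f) := f.continuous.measurable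

/-- cyclic exchange of three lower integrals -/
lemma swap3 {H : ℝ → ℝ → ℝ → ℝ≥0∞} (hH : Measurable (fun z : ℝ × ℝ × ℝ => H z.1 z.2.1 z.2.2)) :
    ∫⁻ x, ∫⁻ y, ∫⁻ z, H x y z = ∫⁻ y, ∫⁻ z, ∫⁻ x, H x y z := by
  have h1 : Measurable (fun p : ℝ × ℝ => ∫⁻ z, H p.1 p.2 z) := by
    apply Measurable.lintegral_prod_right' (f := fun z : (ℝ × ℝ) × ℝ => H z.1.1 z.1.2 z.2)
    exact hH.comp (by fun_prop : Measurable fun z : (ℝ × ℝ) × ℝ => (z.1.1, z.1.2, z.2))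
  rw [lintegral_lintegral_swap h1.aemeasurable]
  congr 1; ext y
  rw [lintegral_lintegral_swap]
  exact (hH.comp (by fun_prop : Measurable fun z : ℝ × ℝ => (z.1, y, z.2))).aemeasurable

/-- inverse cyclic exchange -/
lemma swap3' {H : ℝ → ℝ → ℝ → ℝ≥0∞} (hH : Measurable (fun z : ℝ × ℝ × ℝ => H z.1 z.2.1 z.2.2)) :
    ∫⁻ y, ∫⁻ z, ∫⁻ x, H x y z = ∫⁻ x, ∫⁻ y, ∫⁻ z, H x y z := (swap3 hH).symm

lemma lemA (f : 𝓢(ℝ, ℂ)) :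
    ∫⁻ β, ∫⁻ s, ∫⁻ s', ‖qq f β s - qq f β s'‖ₑ ^ 2 * kap (s - s') ≤
      ENNReal.ofReal (40 * Real.pi ^ 2) * ∫⁻ x, ‖deriv f x‖ₑ ^ 2 := by
  have hm := sch_meas f
  have hm2 := sch_meas (𝓕 f)
  have hd : ∫⁻ x, ‖deriv f x‖ₑ ^ 2 = ∫⁻ ξ, ENNReal.ofReal ((2 * Real.pi * ξ) ^ 2) * ‖𝓕 f ξ‖ₑ ^ 2 := by
    have := planch (SchwartzMap.derivCLM ℂ ℂ f)
    simp only [SchwartzMap.derivCLM_apply] at this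
    rw [← this]
    congr 1; ext ξ
    rw [fourier_D, enorm_mul, enorm_mul, mul_pow, mul_pow]
    congr 1
    rw [← ofReal_norm, ← ofReal_norm]
    simp only [norm_I, ENNReal.ofReal_one, one_pow, mul_one, norm_real, Real.norm_eq_abs]
    rw [← ENNReal.ofReal_pow (abs_nonneg _), sq_abs]
  rw [swap3 (by fun_prop)]
  have h1 : ∀ s s', ∫⁻ β, ‖qq f β s - qq f β s'‖ₑ ^ 2 * kap (s - s') =
      ∫⁻ ξ, (‖pm (2 * Real.pi * ξ) s - pm (2 * Real.pi * ξ) s'‖ₑ ^ 2 * kap (s - s')) * ‖𝓕 f ξ‖ₑ ^ 2 := by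
    intro s s'
    rw [lintegral_mul_const _ (by fun_prop), lemA_slice, ← lintegral_mul_const _ (by fun_prop)]
    congr 1; ext ξ; ring
  simp_rw [h1]
  rw [swap3' (by fun_prop), hd, ← lintegral_const_mul _ (by fun_prop)]
  apply lintegral_mono
  intro ξ
  have h2 : ∀ s, ∫⁻ s', (‖pm (2 * Real.pi * ξ) s - pm (2 * Real.pi * ξ) s'‖ₑ ^ 2 * kap (s - s')) * ‖𝓕 f ξ‖ₑ ^ 2
      = (∫⁻ s', (‖pm (2 * Real.pi * ξ) s - pm (2 * Real.pi * ξ) s'‖ₑ ^ 2 * kap (s - s'))) * ‖𝓕 f ξ‖ₑ ^ 2 := by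
    intro s
    rw [lintegral_mul_const _ (by fun_prop)]
  simp_rw [h2]
  rw [lintegral_mul_const', ← mul_assoc]
  · gcongr
    exact pm_int _
  · simp

end TB

namespace TB

def VV (x l : ℝ) : Set (ℝ × ℝ) := {p | x ≤ p.1 - |p.2| ∧ p.1 + |p.2| < x + l ∧ |p.2| ≤ l / 4}
def CC (x l : ℝ) : Set (ℝ × ℝ) := {p | x ≤ p.1 - |p.2| ∧ p.1 + |p.2| < x + l ∧ |p.2| ≤ l / 4 ∧ l / 8 < |p.2|}

lemma VV_meas (x l : ℝ) : MeasurableSet (VV x l) := by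
  unfold VV; measurability
lemma CC_meas (x l : ℝ) : MeasurableSet (CC x l) := by
  unfold CC; measurability

lemma CC_meas3 (l : ℝ) : MeasurableSet {q : ℝ × ℝ × ℝ | q.2 ∈ CC q.1 l} := by
  unfold CC
  have h1 : Measurable (fun q : ℝ × ℝ × ℝ => |q.2.2|) := by fun_prop
  have h2 : Measurable (fun q : ℝ × ℝ × ℝ => q.2.1) := by fun_prop
  refine MeasurableSet.inter (measurableSet_le measurable_fst (h2.sub h1)) ?_
  refine MeasurableSet.inter (measurableSet_lt (h2.add h1) (measurable_fst.add_const l)) ?_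
  exact MeasurableSet.inter (measurableSet_le h1 measurable_const) (measurableSet_lt measurable_const h1)

lemma bell_alg {Y1 Y2 W1 W2 W c K l : ℝ} (hK : 0 < K) (hl : 0 < l) (hW1 : 0 < W1) (hW2 : 0 < W2)
    (hc : 0 ≤ c) (hW : W1 + W2 + c / K ≤ W) (hW' : W ≤ 2 * l) :
    c * (Y1 + Y2) ^ 2 / l ^ 2 + 4 * K * ((Y1 + Y2) ^ 2 / W) ≤ 4 * K * (Y1 ^ 2 / W1 + Y2 ^ 2 / W2) := by
  have hcK : 0 ≤ c / K := by positivity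
  have hS : 0 < W1 + W2 := by positivity
  have hWp : 0 < W := by linarith
  have h1 : (Y1 + Y2) ^ 2 / (W1 + W2) ≤ Y1 ^ 2 / W1 + Y2 ^ 2 / W2 := by
    rw [div_add_div _ _ hW1.ne' hW2.ne', div_le_div_iff₀ hS (by positivity)]
    nlinarith [mul_nonneg (mul_nonneg hW1.le hW2.le) (sq_nonneg (Y1 * W2 - Y2 * W1)), sq_nonneg (Y1 * W2 - Y2 * W1)]
  have h2 : c / K / (4 * l ^ 2) + 1 / W ≤ 1 / (W1 + W2) := by
    have a : c / K / (4 * l ^ 2) ≤ (W - (W1 + W2)) / (W * (W1 + W2)) := by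
      apply div_le_div₀ (by linarith) (by linarith) (by positivity)
      nlinarith
    have b : (W - (W1 + W2)) / (W * (W1 + W2)) = 1 / (W1 + W2) - 1 / W := by field_simp
    linarith
  have h3 : c * (Y1 + Y2) ^ 2 / l ^ 2 + 4 * K * ((Y1 + Y2) ^ 2 / W)
      = 4 * K * ((Y1 + Y2) ^ 2 * (c / K / (4 * l ^ 2) + 1 / W)) := by
    field_simp
  rw [h3]
  gcongr
  refine le_trans ?_ h1
  calc _ ≤ (Y1 + Y2) ^ 2 * (1 / (W1 + W2)) := by gcongr
    _ = _ := by ring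

section CE

variable (μ : Measure (ℝ × ℝ)) (b : ℝ → ℝ)

noncomputable def YY (x l : ℝ) : ℝ := ∫ t in x..(x + l), b t
noncomputable def tt : ℕ → ℝ → ℝ → ℝ
  | 0, _, _ => 0
  | n + 1, x, l => (μ (CC x l)).toReal * (YY b x l) ^ 2 / l ^ 2 + tt n x (l / 2) + tt n (x + l / 2) (l / 2)

lemma YY_add (hb : Continuous b) (x l : ℝ) : YY b x l = YY b x (l / 2) + YY b (x + l / 2) (l / 2) := by
  unfold YY
  rw [show x + l / 2 + l / 2 = x + l by ring,
    intervalIntegral.integral_add_adjacent_intervals (hb.intervalIntegrable _ _) (hb.intervalIntegrable _ _)]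

lemma mu_super {K : ℝ} (hμ : ∀ x l, 0 < l → μ (VV x l) ≤ ENNReal.ofReal (K * l)) (x l : ℝ) (hl : 0 < l) :
    (μ (CC x l)).toReal + (μ (VV x (l / 2))).toReal + (μ (VV (x + l / 2) (l / 2))).toReal
      ≤ (μ (VV x l)).toReal := by
  have hf : ∀ x l, 0 < l → μ (VV x l) ≠ ⊤ := fun x l hl => ((hμ x l hl).trans_lt ENNReal.ofReal_lt_top).ne
  have hsub : CC x l ⊆ VV x l := fun p hp => ⟨hp.1, hp.2.1, hp.2.2.1⟩
  have hCf : μ (CC x l) ≠ ⊤ := ((measure_mono hsub).trans_lt (hf x l hl).lt_top).ne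
  rw [← ENNReal.toReal_add hCf (hf _ _ (by linarith)), ← ENNReal.toReal_add
    (ENNReal.add_ne_top.2 ⟨hCf, hf _ _ (by linarith)⟩) (hf _ _ (by linarith))]
  apply ENNReal.toReal_mono (hf x l hl)
  rw [← measure_union _ (VV_meas _ _), ← measure_union _ (VV_meas _ _)]
  · apply measure_mono
    rintro p ((hp | hp) | hp)
    · exact hsub hp
    · have := abs_nonneg p.2
      obtain ⟨h1, h2, h3⟩ := hp
      exact ⟨by linarith, by linarith, by linarith⟩
    · have := abs_nonneg p.2
      obtain ⟨h1, h2, h3⟩ := hp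
      exact ⟨by linarith, by linarith, by linarith⟩
  · rw [Set.disjoint_left]
    rintro p (hp | hp) hq
    · obtain ⟨h1, h2, h3, h4⟩ := hp
      obtain ⟨h1', h2', h3'⟩ := hq
      linarith
    · have := abs_nonneg p.2
      obtain ⟨h1, h2, h3⟩ := hp
      obtain ⟨h1', h2', h3'⟩ := hq
      linarith
  · rw [Set.disjoint_left]
    rintro p hp hq
    obtain ⟨h1, h2, h3, h4⟩ := hp
    obtain ⟨h1', h2', h3'⟩ := hq
    linarith

lemma tt_bound (hb : Continuous b) {K : ℝ} (hK : 0 < K)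
    (hμ : ∀ x l, 0 < l → μ (VV x l) ≤ ENNReal.ofReal (K * l)) (n : ℕ) : ∀ (x l : ℝ), 0 < l →
    tt μ b n x l ≤ 4 * K * (YY (fun t => b t ^ 2) x l - YY b x l ^ 2 / (l + (μ (VV x l)).toReal / K)) := by
  have hZ : ∀ x l, 0 < l → (μ (VV x l)).toReal / K ≤ l := by
    intro x l hl
    rw [div_le_iff₀ hK, mul_comm]
    exact ENNReal.toReal_le_of_le_ofReal (by positivity) (hμ x l hl)
  have hZ0 : ∀ x l, 0 ≤ (μ (VV x l)).toReal / K := fun x l => by positivity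
  induction n with
  | zero =>
    intro x l hl
    have cs : YY b x l ^ 2 ≤ l * YY (fun t => b t ^ 2) x l := by
      unfold YY
      have h0 : 0 ≤ ∫ t in x..(x+l), (b t - (∫ t in x..(x+l), b t) / l) ^ 2 :=
        intervalIntegral.integral_nonneg (by linarith) (fun t _ => sq_nonneg _)
      set m := (∫ t in x..(x+l), b t) with hm
      have e : ∫ t in x..(x+l), (b t - m / l) ^ 2 = (∫ t in x..(x+l), b t ^ 2) - 2 * (m / l) * m + l * (m / l) ^ 2 := by
        have : ∀ t, (b t - m / l) ^ 2 = b t ^ 2 - 2 * (m / l) * b t + (m / l) ^ 2 := fun t => by ring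
        simp_rw [this]
        rw [intervalIntegral.integral_add (by apply Continuous.intervalIntegrable; fun_prop) (by apply Continuous.intervalIntegrable; fun_prop),
          intervalIntegral.integral_sub (by apply Continuous.intervalIntegrable; fun_prop) (by apply Continuous.intervalIntegrable; fun_prop),
          intervalIntegral.integral_const_mul, ← hm]
        simp
      rw [e] at h0
      have : (∫ t in x..(x+l), b t ^ 2) - 2 * (m / l) * m + l * (m / l) ^ 2 = ((∫ t in x..(x+l), b t ^ 2) * l - m ^ 2) / l := by
        field_simp; ring
      rw [this] at h0
      have := (div_nonneg_iff.1 h0)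
      rcases this with h | h <;> nlinarith [h.1, h.2]
    have hX : 0 ≤ YY (fun t => b t ^ 2) x l :=
      intervalIntegral.integral_nonneg (by linarith) (fun t _ => sq_nonneg _)
    have : YY b x l ^ 2 / (l + (μ (VV x l)).toReal / K) ≤ YY (fun t => b t ^ 2) x l := by
      rw [div_le_iff₀ (by linarith [hZ0 x l])]
      nlinarith [hZ0 x l]
    simp only [tt]
    have := sub_nonneg.2 this
    positivity
  | succ n ih =>
    intro x l hl
    have i1 := ih x (l / 2) (by linarith)
    have i2 := ih (x + l / 2) (l / 2) (by linarith)
    simp only [tt]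
    rw [YY_add (fun t => b t ^ 2) (by fun_prop) x l, YY_add b hb x l]
    have hs := mu_super μ hμ x l hl
    have hs' : (μ (CC x l)).toReal / K + (μ (VV x (l / 2))).toReal / K + (μ (VV (x + l / 2) (l / 2))).toReal / K
      ≤ (μ (VV x l)).toReal / K := by
      rw [← add_div, ← add_div]; gcongr
    have := bell_alg (Y1 := YY b x (l / 2)) (Y2 := YY b (x + l / 2) (l / 2)) hK hl
      (W1 := l / 2 + (μ (VV x (l / 2))).toReal / K)
      (W2 := l / 2 + (μ (VV (x + l / 2) (l / 2))).toReal / K)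
      (W := l + (μ (VV x l)).toReal / K) (c := (μ (CC x l)).toReal) (by linarith [hZ0 x (l/2)])
      (by linarith [hZ0 (x + l/2) (l/2)]) (by positivity) (by linarith) (by linarith [hZ x l hl])
    linarith

lemma tt_nonneg (n : ℕ) : ∀ x l, 0 ≤ tt μ b n x l := by
  induction n with
  | zero => intro x l; simp [tt]
  | succ n ih => intro x l; simp only [tt]; have := ih x (l/2); have := ih (x + l/2) (l/2); positivity

variable [SFinite μ]

lemma muCC_meas (l : ℝ) : Measurable (fun x => μ (CC x l)) :=
  measurable_measure_prodMk_left (CC_meas3 l)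

lemma YY_meas (hb : Continuous b) (l : ℝ) : Measurable (fun x => YY b x l) := by
  unfold YY
  have : ∀ x, ∫ t in x..(x+l), b t = (∫ t in (0:ℝ)..(x+l), b t) - ∫ t in (0:ℝ)..x, b t := fun x =>
    (intervalIntegral.integral_interval_sub_left (hb.intervalIntegrable _ _) (hb.intervalIntegrable _ _)).symm
  simp_rw [this]
  have h : Continuous (fun x => ∫ t in (0:ℝ)..x, b t) :=
    intervalIntegral.continuous_primitive (fun _ _ => hb.intervalIntegrable _ _) 0
  exact ((h.comp (by fun_prop : Continuous fun x : ℝ => x + l)).sub h).measurable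

lemma tt_meas (hb : Continuous b) (n : ℕ) : ∀ l, Measurable (fun x => tt μ b n x l) := by
  have h1 := YY_meas b hb
  have h2 := muCC_meas μ
  induction n with
  | zero => intro l; simp only [tt]; fun_prop
  | succ n ih =>
    intro l
    simp only [tt]
    have h3 := (ih (l/2)).comp (by fun_prop : Measurable fun x : ℝ => x + l / 2)
    exact (((h2 l).ennreal_toReal.mul ((h1 l).pow_const 2)).div_const _ |>.add (ih (l/2))).add h3

lemma CE_J {G : ℝ × ℝ → ℝ≥0∞} (hG : Measurable G)
    (hGb : ∀ x l p, 0 < l → p ∈ CC x l → G p ≤ ENNReal.ofReal (8 * YY b x l / l))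
    (hf : ∀ x l, 0 < l → μ (CC x l) ≠ ⊤) (hY : ∀ x l, 0 < l → 0 ≤ YY b x l)
    (l : ℝ) (hl : 0 < l) :
    ENNReal.ofReal (l / 128) * ∫⁻ p in {p : ℝ × ℝ | l / 8 < |p.2| ∧ |p.2| ≤ l / 4}, G p ^ 2 ∂μ
     ≤ ∫⁻ x, ENNReal.ofReal ((μ (CC x l)).toReal * (YY b x l) ^ 2 / l ^ 2) := by
  have h1 : ∀ x, ENNReal.ofReal (1 / 64) * ∫⁻ p in CC x l, G p ^ 2 ∂μ ≤
      ENNReal.ofReal ((μ (CC x l)).toReal * (YY b x l) ^ 2 / l ^ 2) := by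
    intro x
    calc _ ≤ ENNReal.ofReal (1 / 64) * ∫⁻ p in CC x l, ENNReal.ofReal (8 * YY b x l / l) ^ 2 ∂μ := by
          apply mul_le_mul_right
          apply setLIntegral_mono' (CC_meas x l)
          intro p hp
          gcongr
          exact hGb x l p hl hp
      _ = ENNReal.ofReal (1 / 64) * (ENNReal.ofReal ((8 * YY b x l / l) ^ 2) * ENNReal.ofReal (μ (CC x l)).toReal) := by
          rw [setLIntegral_const, ENNReal.ofReal_toReal (hf x l hl), ENNReal.ofReal_pow]
          have := hY x l hl
          positivity
      _ = _ := by
          rw [← ENNReal.ofReal_mul (by positivity), ← ENNReal.ofReal_mul (by positivity)]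
          congr 1; ring
  refine le_trans ?_ (lintegral_mono h1)
  rw [lintegral_const_mul' _ _ ENNReal.ofReal_ne_top]
  have h2 : ∫⁻ x, ∫⁻ p in CC x l, G p ^ 2 ∂μ = ∫⁻ p, ∫⁻ x, {q : ℝ × ℝ × ℝ | q.2 ∈ CC q.1 l}.indicator (fun q => G q.2 ^ 2) (x, p) ∂volume ∂μ := by
    rw [lintegral_lintegral_swap]
    · congr 1; ext x
      rw [← lintegral_indicator (CC_meas x l)]
      rfl
    · have : Measurable ({q : ℝ × ℝ × ℝ | q.2 ∈ CC q.1 l}.indicator (fun q => G q.2 ^ 2)) :=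
        Measurable.indicator (by fun_prop) (CC_meas3 l)
      exact (this.comp measurable_swap).aemeasurable
  rw [h2]
  have hS : MeasurableSet {p : ℝ × ℝ | l / 8 < |p.2| ∧ |p.2| ≤ l / 4} := by
    have h1 : Measurable (fun q : ℝ × ℝ => |q.2|) := by fun_prop
    exact MeasurableSet.inter (measurableSet_lt measurable_const h1) (measurableSet_le h1 measurable_const)
  rw [← lintegral_indicator hS, ← lintegral_const_mul' _ _ ENNReal.ofReal_ne_top,
    ← lintegral_const_mul' _ _ ENNReal.ofReal_ne_top]
  apply lintegral_mono
  intro p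
  beta_reduce
  by_cases hp : p ∈ {p : ℝ × ℝ | l / 8 < |p.2| ∧ |p.2| ≤ l / 4}
  · rw [Set.indicator_of_mem hp]
    have h3 : ∫⁻ x in Set.Ioc (p.1 + |p.2| - l) (p.1 - |p.2|), G p ^ 2 ≤
        ∫⁻ x, {q : ℝ × ℝ × ℝ | q.2 ∈ CC q.1 l}.indicator (fun q => G q.2 ^ 2) (x, p) := by
      rw [← lintegral_indicator measurableSet_Ioc]
      apply lintegral_mono
      intro x
      beta_reduce
      by_cases hx : x ∈ Set.Ioc (p.1 + |p.2| - l) (p.1 - |p.2|)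
      · rw [Set.indicator_of_mem hx, Set.indicator_of_mem]
        exact ⟨hx.2, by linarith [hx.1], hp.2, hp.1⟩
      · rw [Set.indicator_of_notMem hx]; exact zero_le
    refine le_trans ?_ (mul_le_mul_right h3 _)
    rw [setLIntegral_const, Real.volume_Ioc, mul_comm (G p ^ 2), ← mul_assoc, ← ENNReal.ofReal_mul (by positivity)]
    gcongr
    have := hp.2
    linarith
  · rw [Set.indicator_of_notMem hp]; simp

lemma slide {φ : ℝ → ℝ≥0∞} (hφ : Measurable φ) (l : ℝ) :
    ∫⁻ x, ∫⁻ t in Set.Ioc x (x + l), φ t = ENNReal.ofReal l * ∫⁻ t, φ t := by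
  have h1 : ∀ x, ∫⁻ t in Set.Ioc x (x + l), φ t = ∫⁻ u in Set.Ioc 0 l, φ (x + u) := by
    intro x
    rw [← lintegral_indicator measurableSet_Ioc, ← lintegral_indicator measurableSet_Ioc,
      ← lintegral_add_left_eq_self _ x]
    congr 1; ext u
    simp only [Set.indicator, Set.mem_Ioc]
    congr 1
    simp
  simp_rw [h1]
  rw [lintegral_lintegral_swap (by fun_prop)]
  have h2 : ∀ u, ∫⁻ x, φ (x + u) = ∫⁻ x, φ x := fun u => lintegral_add_right_eq_self φ u
  simp_rw [h2]
  rw [setLIntegral_const, Real.volume_Ioc, mul_comm]; simp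

lemma CE_sum {G : ℝ × ℝ → ℝ≥0∞} (hG : Measurable G) (hb : Continuous b)
    (hGb : ∀ x l p, 0 < l → p ∈ CC x l → G p ≤ ENNReal.ofReal (8 * YY b x l / l))
    (hf : ∀ x l, 0 < l → μ (CC x l) ≠ ⊤) (hY : ∀ x l, 0 < l → 0 ≤ YY b x l) (n : ℕ) :
    ∀ l, 0 < l →
    ENNReal.ofReal (l / 128) * ∫⁻ p in {p : ℝ × ℝ | l / 2 ^ n / 4 < |p.2| ∧ |p.2| ≤ l / 4}, G p ^ 2 ∂μ
     ≤ ∫⁻ x, ENNReal.ofReal (tt μ b n x l) := by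
  induction n with
  | zero =>
    intro l hl
    have : {p : ℝ × ℝ | l / 2 ^ 0 / 4 < |p.2| ∧ |p.2| ≤ l / 4} = ∅ := by
      ext p; simp
    rw [this]; simp
  | succ n ih =>
    intro l hl
    have i1 := ih (l / 2) (by linarith)
    have j := CE_J μ b hG hGb hf hY l hl
    have hm := tt_meas μ b hb n (l / 2)
    have hm2 : Measurable (fun x => tt μ b n (x + l/2) (l / 2)) := hm.comp (by fun_prop : Measurable fun x : ℝ => x + l / 2)
    have e : ∫⁻ x, ENNReal.ofReal (tt μ b (n+1) x l) =
        (∫⁻ x, ENNReal.ofReal ((μ (CC x l)).toReal * (YY b x l) ^ 2 / l ^ 2)) +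
          2 * ∫⁻ x, ENNReal.ofReal (tt μ b n x (l / 2)) := by
      simp only [tt]
      have : ∀ x, ENNReal.ofReal ((μ (CC x l)).toReal * (YY b x l) ^ 2 / l ^ 2 + tt μ b n x (l / 2) + tt μ b n (x + l / 2) (l / 2))
         = ENNReal.ofReal ((μ (CC x l)).toReal * (YY b x l) ^ 2 / l ^ 2) + ENNReal.ofReal (tt μ b n x (l / 2)) + ENNReal.ofReal (tt μ b n (x + l / 2) (l / 2)) := by
        intro x
        have := tt_nonneg μ b n x (l/2)
        rw [ENNReal.ofReal_add (by positivity) (tt_nonneg _ _ _ _ _), ENNReal.ofReal_add (by positivity) (tt_nonneg _ _ _ _ _)]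
      simp_rw [this]
      rw [lintegral_add_right _ (by fun_prop), lintegral_add_right _ (by fun_prop), two_mul, add_assoc]
      congr 2
      exact lintegral_add_right_eq_self (fun x => ENNReal.ofReal (tt μ b n x (l/2))) (l/2)
    rw [e]
    refine le_trans ?_ (add_le_add j (mul_le_mul_right i1 2))
    have h2 : (2 : ℝ≥0∞) = ENNReal.ofReal 2 := by simp
    rw [← mul_assoc, h2, ← ENNReal.ofReal_mul (by positivity), show 2 * (l / 2 / 128) = l / 128 by ring, ← mul_add]
    apply mul_le_mul_right
    refine le_trans (lintegral_mono_set ?_) (lintegral_union_le _ _ _)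
    intro p hp
    have e3 : l / 2 / 2 ^ n = l / 2 ^ (n + 1) := by rw [pow_succ]; field_simp
    rcases lt_or_ge (l / 8) |p.2| with h | h
    · left; exact ⟨h, hp.2⟩
    · right; refine ⟨?_, by linarith⟩
      rw [e3]; exact hp.1

theorem CE {G : ℝ × ℝ → ℝ≥0∞} (hG : Measurable G) (hb : Continuous b) (hb0 : ∀ t, 0 ≤ b t)
    (hGb : ∀ x l p, 0 < l → p ∈ CC x l → G p ≤ ENNReal.ofReal (8 * YY b x l / l))
    {K : ℝ} (hK : 0 < K)
    (hμ : ∀ x l, 0 < l → μ (VV x l) ≤ ENNReal.ofReal (K * l)) (h0 : μ {p | p.2 = 0} = 0) :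
    ∫⁻ p, G p ^ 2 ∂μ ≤ ENNReal.ofReal (512 * K) * ∫⁻ t, ENNReal.ofReal (b t ^ 2) := by
  have hf : ∀ x l, 0 < l → μ (CC x l) ≠ ⊤ := fun x l hl =>
    ((measure_mono (fun p hp => ⟨hp.1, hp.2.1, hp.2.2.1⟩ : CC x l ⊆ VV x l)).trans_lt
      ((hμ x l hl).trans_lt ENNReal.ofReal_lt_top)).ne
  have hY : ∀ x l, 0 < l → 0 ≤ YY b x l := fun x l hl =>
    intervalIntegral.integral_nonneg (by linarith) (fun t _ => hb0 t)
  have key : ∀ n l, 0 < l → ∫⁻ p in {p : ℝ × ℝ | l / 2 ^ n / 4 < |p.2| ∧ |p.2| ≤ l / 4}, G p ^ 2 ∂μ ≤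
      ENNReal.ofReal (512 * K) * ∫⁻ t, ENNReal.ofReal (b t ^ 2) := by
    intro n l hl
    have h1 := CE_sum μ b hG hb hGb hf hY n l hl
    have h2 : ∫⁻ x, ENNReal.ofReal (tt μ b n x l) ≤ ENNReal.ofReal (4 * K) * (ENNReal.ofReal l * ∫⁻ t, ENNReal.ofReal (b t ^ 2)) := by
      calc _ ≤ ∫⁻ x, ENNReal.ofReal (4 * K) * ∫⁻ t in Set.Ioc x (x + l), ENNReal.ofReal (b t ^ 2) := by
            apply lintegral_mono
            intro x
            have e : ∫⁻ t in Set.Ioc x (x + l), ENNReal.ofReal (b t ^ 2) = ENNReal.ofReal (YY (fun t => b t ^ 2) x l) := by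
              unfold YY
              rw [intervalIntegral.integral_of_le (by linarith), ofReal_integral_eq_lintegral_ofReal]
              · have : Continuous (fun t => b t ^ 2) := by fun_prop
                exact (this.integrableOn_Icc).mono_set Set.Ioc_subset_Icc_self
              · exact Filter.Eventually.of_forall fun t => sq_nonneg _
            dsimp only
            rw [e, ← ENNReal.ofReal_mul (by positivity)]
            apply ENNReal.ofReal_le_ofReal
            refine (tt_bound μ b hb hK hμ n x l hl).trans ?_
            have : 0 ≤ YY b x l ^ 2 / (l + (μ (VV x l)).toReal / K) := by positivity
            gcongr; linarith
        _ = _ := by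
            rw [lintegral_const_mul' _ _ ENNReal.ofReal_ne_top, slide (by fun_prop)]
    have h3 := h1.trans h2
    have e : ENNReal.ofReal (4 * K) * (ENNReal.ofReal l * ∫⁻ t, ENNReal.ofReal (b t ^ 2)) =
       ENNReal.ofReal (l / 128) * (ENNReal.ofReal (512 * K) * ∫⁻ t, ENNReal.ofReal (b t ^ 2)) := by
      rw [← mul_assoc, ← mul_assoc, ← ENNReal.ofReal_mul (by positivity), ← ENNReal.ofReal_mul (by positivity)]
      congr 2; ring
    rw [e] at h3
    exact (ENNReal.mul_le_mul_iff_right (by simp; positivity) ENNReal.ofReal_ne_top).1 h3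
  set S : ℕ → Set (ℝ × ℝ) := fun m => {p | (2:ℝ)⁻¹ ^ m < |p.2| ∧ |p.2| ≤ 2 ^ m} with hS
  have hSm : Monotone S := by
    intro m n hmn p hp
    refine ⟨lt_of_le_of_lt ?_ hp.1, hp.2.trans ?_⟩
    · exact pow_le_pow_of_le_one (by norm_num) (by norm_num) hmn
    · exact pow_le_pow_right₀ (by norm_num) hmn
  have hk : ∀ m, ∫⁻ p in S m, G p ^ 2 ∂μ ≤ ENNReal.ofReal (512 * K) * ∫⁻ t, ENNReal.ofReal (b t ^ 2) := by
    intro m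
    convert key (2 * m) (4 * 2 ^ m) (by positivity) using 6
    · rw [pow_mul', sq, inv_pow]; field_simp
      try ring_nf
    · ring_nf
  have hU : (⋃ m, S m) = {p : ℝ × ℝ | p.2 = 0}ᶜ := by
    ext p
    simp only [hS, Set.mem_iUnion, Set.mem_ofPred_eq, Set.mem_compl_iff]
    constructor
    · rintro ⟨m, h1, h2⟩ h
      rw [h, abs_zero] at h1
      have : (0:ℝ) < 2⁻¹ ^ m := by positivity
      linarith
    · intro h
      obtain ⟨m1, h1⟩ := exists_pow_lt_of_lt_one (abs_pos.2 h) (by norm_num : (2:ℝ)⁻¹ < 1)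
      obtain ⟨m2, h2⟩ := pow_unbounded_of_one_lt |p.2| (by norm_num : (1:ℝ) < 2)
      exact ⟨max m1 m2, lt_of_le_of_lt (pow_le_pow_of_le_one (by norm_num) (by norm_num) (le_max_left _ _)) h1,
        h2.le.trans (pow_le_pow_right₀ (by norm_num) (le_max_right _ _))⟩
  have hM : MeasurableSet {p : ℝ × ℝ | p.2 = 0} := measurableSet_eq_fun measurable_snd measurable_const
  rw [← lintegral_add_compl _ hM, Measure.restrict_eq_zero.2 h0, lintegral_zero_measure, zero_add, ← hU,
    setLIntegral_iUnion_of_directed _ hSm.directed_le]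
  exact iSup_le hk
end CE
end TB

namespace TB
open scoped SchwartzMap

lemma exists_chi : ∃ (χ : ℝ → ℝ) (C : ℝ), 0 ≤ C ∧ ContDiff ℝ (⊤ : ℕ∞) χ ∧ HasCompactSupport χ ∧
    (∀ t ∈ Set.Icc (0:ℝ) 1, χ t = 1) ∧ (∀ t, |χ t| ≤ 1) ∧ (∀ t, |deriv χ t| ≤ C) ∧
    (∀ t, t ∉ Set.Icc (-1:ℝ) 2 → χ t = 0 ∧ deriv χ t = 0) := by
  let χ : ContDiffBump (1/2 : ℝ) := ⟨1/2, 1, by norm_num, by norm_num⟩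
  have hd : Continuous (deriv χ) := (χ.contDiff (n := 1)).continuous_deriv le_rfl
  obtain ⟨C, hC⟩ := hd.bounded_above_of_compact_support χ.hasCompactSupport.deriv
  have hsupp : ∀ t, t ∉ Set.Icc (-1:ℝ) 2 → t ∉ tsupport χ := by
    intro t ht h
    rw [χ.tsupport_eq, Metric.mem_closedBall, Real.dist_eq] at h
    have h' : |t - 1/2| ≤ 1 := h
    rw [abs_le] at h'
    exact ht ⟨by linarith [h'.1], by linarith [h'.2]⟩
  refine ⟨χ, C, (norm_nonneg _).trans (hC 0), χ.contDiff, χ.hasCompactSupport, ?_, ?_, ?_, ?_⟩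
  · intro t ht
    apply χ.one_of_mem_closedBall
    rw [Metric.mem_closedBall, Real.dist_eq, abs_le]
    show -(1/2 : ℝ) ≤ _ ∧ _ ≤ (1/2 : ℝ)
    constructor <;> linarith [ht.1, ht.2]
  · intro t
    rw [abs_of_nonneg χ.nonneg]; exact χ.le_one
  · exact hC
  · intro t ht
    refine ⟨image_eq_zero_of_notMem_tsupport (hsupp t ht), ?_⟩
    by_contra h
    exact hsupp t ht (support_deriv_subset h)

lemma exists_loc : ∃ D : ℝ, 0 < D ∧ ∀ (f : 𝓢(ℝ, ℂ)) (M : ℝ), 0 ≤ M → (∀ x y, ‖f x - f y‖ ≤ M * |x - y|) →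
    ∀ x l : ℝ, 0 < l → ∃ k : 𝓢(ℝ, ℂ), (∀ y ∈ Set.Icc x (x + l), k y = f y - f x) ∧
      ∫⁻ y, ‖deriv k y‖ₑ ^ 2 ≤ ENNReal.ofReal (D * M ^ 2 * l) := by
  obtain ⟨χ, C, hC0, hχ, hcs, h1, hb, hd, hz⟩ := exists_chi
  refine ⟨3 * (2 * C + 1) ^ 2, by positivity, ?_⟩
  intro f M hM hL x l hl
  let ψ : ℝ → ℂ := fun y => ((χ ((y - x) / l) : ℝ) : ℂ) * (f y - f x)
  have hψ : ContDiff ℝ (⊤ : ℕ∞) ψ := by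
    apply ContDiff.mul
    · exact Complex.ofRealCLM.contDiff.comp (hχ.comp (by fun_prop))
    · exact (f.smooth _).sub contDiff_const
  have hψs : HasCompactSupport ψ := by
    apply HasCompactSupport.intro (K := Set.Icc (x - l) (x + 2 * l)) isCompact_Icc
    intro y hy
    have : (y - x) / l ∉ Set.Icc (-1:ℝ) 2 := by
      intro h
      rw [Set.mem_Icc, le_div_iff₀ hl, div_le_iff₀ hl] at h
      exact hy ⟨by linarith [h.1], by linarith [h.2]⟩
    simp [ψ, (hz _ this).1]
  refine ⟨hψs.toSchwartzMap hψ, ?_, ?_⟩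
  · intro y hy
    show ψ y = _
    have : (y - x) / l ∈ Set.Icc (0:ℝ) 1 := by
      rw [Set.mem_Icc, le_div_iff₀ hl, div_le_iff₀ hl]
      exact ⟨by linarith [hy.1], by linarith [hy.2]⟩
    simp [ψ, h1 _ this]
  · show ∫⁻ y, ‖deriv ψ y‖ₑ ^ 2 ≤ _
    have hder : ∀ y, deriv ψ y = ((deriv χ ((y - x) / l) / l : ℝ) : ℂ) * (f y - f x) + (χ ((y - x) / l) : ℝ) * deriv f y := by
      intro y
      have a1 : HasDerivAt (fun y : ℝ => χ ((y - x) / l)) (deriv χ ((y - x) / l) * (1 / l)) y := by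
        have : HasDerivAt χ (deriv χ ((y - x) / l)) ((y - x) / l) :=
          (hχ.differentiable (by simp) _).hasDerivAt
        exact this.comp y (((hasDerivAt_id y).sub_const x).div_const l)
      have a2 := a1.ofReal_comp
      have a3 : HasDerivAt (fun y => f y - f x) (deriv f y) y := (f.differentiable y).hasDerivAt.sub_const _
      have a4 := HasDerivAt.deriv (f := ψ) (a2.mul a3)
      rw [a4, mul_one_div]
    have hfd : ∀ y, ‖deriv f y‖ ≤ M := by
      intro y
      apply norm_deriv_le_of_lip' hM
      exact Filter.Eventually.of_forall fun z => by simpa using hL z y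
    have hbd : ∀ y, ‖deriv ψ y‖ₑ ^ 2 ≤ (Set.Icc (x - l) (x + 2 * l)).indicator (fun _ => ENNReal.ofReal (((2 * C + 1) * M) ^ 2)) y := by
      intro y
      by_cases hy : y ∈ Set.Icc (x - l) (x + 2 * l)
      · rw [Set.indicator_of_mem hy, ENNReal.ofReal_pow (by positivity), ← ofReal_norm]
        gcongr
        rw [hder y]
        refine (norm_add_le _ _).trans ?_
        rw [norm_mul, norm_mul, norm_real, norm_real, Real.norm_eq_abs, Real.norm_eq_abs, abs_div, abs_of_pos hl]
        have b1 : ‖f y - f x‖ ≤ M * (2 * l) := by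
          refine (hL y x).trans ?_
          gcongr
          rw [abs_le]; constructor <;> linarith [hy.1, hy.2]
        calc _ ≤ C / l * (M * (2 * l)) + 1 * M := by
              gcongr
              · exact hd _
              · exact hb _
              · exact hfd y
          _ = _ := by field_simp
      · rw [Set.indicator_of_notMem hy]
        have : (y - x) / l ∉ Set.Icc (-1:ℝ) 2 := by
          intro h
          rw [Set.mem_Icc, le_div_iff₀ hl, div_le_iff₀ hl] at h
          exact hy ⟨by linarith [h.1], by linarith [h.2]⟩
        rw [hder y, (hz _ this).1, (hz _ this).2]; simp
    refine (lintegral_mono hbd).trans ?_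
    rw [lintegral_indicator measurableSet_Icc, setLIntegral_const, Real.volume_Icc, ← ENNReal.ofReal_mul (by positivity)]
    apply ENNReal.ofReal_le_ofReal
    apply le_of_eq; ring

/-- truncated square function -/
noncomputable def NN (f : ℝ → ℂ) (p : ℝ × ℝ) : ℝ≥0∞ :=
  ∫⁻ s', {r : ℝ | |r| ≤ |p.2|}.indicator (fun s' => ‖qq f p.1 p.2 - qq f p.1 s'‖ₑ ^ 2 * kap (p.2 - s')) s'

lemma NN_meas {f : ℝ → ℂ} (hf : Measurable f) : Measurable (NN f) := by
  unfold NN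
  have hs : MeasurableSet {q : (ℝ × ℝ) × ℝ | |q.2| ≤ |q.1.2|} := by
    have h1 : Measurable (fun q : (ℝ × ℝ) × ℝ => |q.2|) := by fun_prop
    have h2 : Measurable (fun q : (ℝ × ℝ) × ℝ => |q.1.2|) := by fun_prop
    exact measurableSet_le h1 h2
  apply Measurable.lintegral_prod_right' (f := fun q : (ℝ × ℝ) × ℝ => {q : (ℝ × ℝ) × ℝ | |q.2| ≤ |q.1.2|}.indicator
    (fun q => ‖qq f q.1.1 q.1.2 - qq f q.1.1 q.2‖ₑ ^ 2 * kap (q.1.2 - q.2)) q)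
  exact Measurable.indicator (by fun_prop) hs

lemma carleson_box : ∃ D : ℝ, 0 < D ∧ ∀ (f : 𝓢(ℝ, ℂ)) (M : ℝ), 0 ≤ M → (∀ x y, ‖f x - f y‖ ≤ M * |x - y|) →
    ∀ x l : ℝ, 0 < l → (volume.withDensity (NN f)) (VV x l) ≤ ENNReal.ofReal (D * M ^ 2 * l) := by
  obtain ⟨D, hD, H⟩ := exists_loc
  refine ⟨40 * Real.pi ^ 2 * D, by positivity, ?_⟩
  intro f M hM hL x l hl
  obtain ⟨k, hk, hkd⟩ := H f M hM hL x l hl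
  rw [withDensity_apply _ (VV_meas x l), ← lintegral_indicator (VV_meas x l)]
  have hm := sch_meas k
  calc _ ≤ ∫⁻ p : ℝ × ℝ, ∫⁻ s', ‖qq k p.1 p.2 - qq k p.1 s'‖ₑ ^ 2 * kap (p.2 - s') := by
        apply lintegral_mono
        intro p
        by_cases hp : p ∈ VV x l
        · rw [Set.indicator_of_mem hp]
          apply lintegral_mono
          intro s'
          beta_reduce
          by_cases hs : s' ∈ {r : ℝ | |r| ≤ |p.2|}
          · rw [Set.indicator_of_mem hs]
            obtain ⟨v1, v2, v3⟩ := hp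
            have hs : |s'| ≤ |p.2| := hs
            have q : ∀ s, |s| ≤ |p.2| → qq k p.1 s = qq f p.1 s := by
              intro s hs
              have := abs_le.1 (hs)
              have := abs_nonneg p.2
              unfold qq
              rw [hk p.1 ⟨by linarith, by linarith⟩, hk (p.1 + s) ⟨by linarith, by linarith⟩]
              ring
            rw [q _ le_rfl, q _ hs]
          · rw [Set.indicator_of_notMem hs]; exact zero_le
        · rw [Set.indicator_of_notMem hp]; exact zero_le
    _ = ∫⁻ β, ∫⁻ s, ∫⁻ s', ‖qq k β s - qq k β s'‖ₑ ^ 2 * kap (s - s') := by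
        rw [Measure.volume_eq_prod, lintegral_prod]
        apply Measurable.aemeasurable
        apply Measurable.lintegral_prod_right' (f := fun q : (ℝ × ℝ) × ℝ => ‖qq k q.1.1 q.1.2 - qq k q.1.1 q.2‖ₑ ^ 2 * kap (q.1.2 - q.2))
        fun_prop
    _ ≤ ENNReal.ofReal (40 * Real.pi ^ 2) * ENNReal.ofReal (D * M ^ 2 * l) := by
        refine (lemA k).trans ?_
        gcongr
    _ = _ := by
        rw [← ENNReal.ofReal_mul (by positivity)]; congr 1; ring

end TB

namespace TB
open scoped SchwartzMap

lemma dcont (g : 𝓢(ℝ, ℂ)) : Continuous (deriv g) := (SchwartzMap.derivCLM ℂ ℂ g).continuous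

lemma ftc (g : 𝓢(ℝ, ℂ)) (x y : ℝ) : ∫ t in x..y, deriv g t = g y - g x := by
  apply intervalIntegral.integral_deriv_eq_sub
  · intro t _; exact g.differentiable t
  · exact (dcont g).intervalIntegrable _ _

lemma linfty_fin (f : 𝓢(ℝ, ℂ)) : eLpNorm (deriv f) ⊤ volume ≠ ⊤ := by
  have h := ((SchwartzMap.derivCLM ℂ ℂ f).memLp (⊤ : ℝ≥0∞) (μ := volume)).eLpNorm_ne_top
  have e : ⇑(SchwartzMap.derivCLM ℂ ℂ f) = deriv f := rfl
  rwa [e] at h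

lemma lip (f : 𝓢(ℝ, ℂ)) (x y : ℝ) :
    ‖f x - f y‖ ≤ (eLpNorm (deriv f) ⊤ volume).toReal * |x - y| := by
  rw [← ftc]
  apply intervalIntegral.norm_integral_le_of_norm_le_const_ae
  have := ae_le_eLpNormEssSup (f := deriv f) (μ := volume)
  filter_upwards [this] with t ht _
  rw [← eLpNorm_exponent_top] at ht
  have := ENNReal.toReal_mono (linfty_fin f) ht
  simpa using this

lemma qq_le (f : 𝓢(ℝ, ℂ)) (β s : ℝ) : ‖qq f β s‖ₑ ≤ eLpNorm (deriv f) ⊤ volume := by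
  rw [← ENNReal.ofReal_toReal (linfty_fin f), ← ofReal_norm]
  apply ENNReal.ofReal_le_ofReal
  unfold qq
  rw [norm_div, norm_real, Real.norm_eq_abs]
  apply div_le_of_le_mul₀ (abs_nonneg _) ENNReal.toReal_nonneg
  simpa using lip f (β + s) β

lemma hGb (g : 𝓢(ℝ, ℂ)) (x l : ℝ) (p : ℝ × ℝ) (hl : 0 < l) (hp : p ∈ CC x l) :
    ‖qq g p.1 p.2‖ₑ ≤ ENNReal.ofReal (8 * YY (fun t => ‖deriv g t‖) x l / l) := by
  obtain ⟨h1, h2, h3, h4⟩ := hp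
  rw [← ofReal_norm]
  apply ENNReal.ofReal_le_ofReal
  have hY : ‖g (p.1 + p.2) - g p.1‖ ≤ YY (fun t => ‖deriv g t‖) x l := by
    rw [← ftc]
    refine (intervalIntegral.norm_integral_le_integral_norm_uIoc).trans ?_
    unfold YY
    rw [intervalIntegral.integral_of_le (by linarith)]
    apply setIntegral_mono_set
    · exact ((dcont g).norm.integrableOn_Icc).mono_set Set.Ioc_subset_Icc_self
    · exact Filter.Eventually.of_forall fun t => norm_nonneg _
    · apply Filter.Eventually.of_forall
      intro t ht
      have ht : min p.1 (p.1 + p.2) < t ∧ t ≤ max p.1 (p.1 + p.2) := ht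
      have := neg_abs_le p.2
      have := le_abs_self p.2
      constructor
      · refine lt_of_le_of_lt ?_ ht.1
        apply le_min <;> linarith [abs_nonneg p.2]
      · refine ht.2.trans ?_
        apply max_le <;> linarith [abs_nonneg p.2]
  have hY0 := (norm_nonneg _).trans hY
  unfold qq
  rw [norm_div, norm_real, Real.norm_eq_abs, div_le_div_iff₀ (by linarith) hl]
  calc _ ≤ YY (fun t => ‖deriv g t‖) x l * (8 * |p.2|) := by gcongr; linarith
    _ = _ := by ring

lemma qq_avg (g : 𝓢(ℝ, ℂ)) (β s : ℝ) :
    ‖qq g β s‖ₑ ≤ ∫⁻ u in Set.Ioc (0:ℝ) 1, ‖deriv g (β + u * s)‖ₑ := by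
  by_cases hs : s = 0
  · simp [qq, hs]
  have : qq g β s = ∫ u in (0:ℝ)..1, deriv g (β + u * s) := by
    have := intervalIntegral.integral_comp_add_mul (a := 0) (b := 1) (deriv g) hs β
    rw [ftc] at this
    simp only [mul_comm s] at this
    rw [this, qq]
    simp [div_eq_inv_mul]
  rw [this, intervalIntegral.integral_of_le zero_le_one]
  exact enorm_integral_le_lintegral_enorm _

lemma int_rpow : ∫⁻ u in Set.Ioc (0:ℝ) 1, ENNReal.ofReal (u ^ (-(1/2) : ℝ)) = 2 := by
  rw [← ofReal_integral_eq_lintegral_ofReal]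
  · rw [← intervalIntegral.integral_of_le zero_le_one, integral_rpow (by norm_num)]
    norm_num
  · rw [← IntegrableOn, ← intervalIntegrable_iff_integrableOn_Ioc_of_le zero_le_one]
    exact intervalIntegral.intervalIntegrable_rpow' (by norm_num)
  · filter_upwards [ae_restrict_mem measurableSet_Ioc] with u hu
    exact Real.rpow_nonneg hu.1.le _

lemma CS {α : Type*} [MeasurableSpace α] (μ : Measure α) {f g : α → ℝ≥0∞} (hf : AEMeasurable f μ) (hg : AEMeasurable g μ) :
    (∫⁻ a, f a * g a ∂μ) ^ 2 ≤ (∫⁻ a, f a ^ 2 ∂μ) * ∫⁻ a, g a ^ 2 ∂μ := by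
  have := ENNReal.lintegral_mul_le_Lp_mul_Lq μ Real.HolderConjugate.two_two hf hg
  calc _ ≤ _ := pow_le_pow_left' this 2
    _ = _ := by
      rw [mul_pow, ← ENNReal.rpow_natCast, ← ENNReal.rpow_natCast, ← ENNReal.rpow_mul, ← ENNReal.rpow_mul]
      norm_num

lemma hardy (g : 𝓢(ℝ, ℂ)) (β : ℝ) :
    ∫⁻ s, ‖qq g β s‖ₑ ^ 2 ≤ 4 * ∫⁻ x, ‖deriv g x‖ₑ ^ 2 := by
  have hm := (dcont g).measurable
  have h1 : ∀ s, ‖qq g β s‖ₑ ^ 2 ≤ 2 * ∫⁻ u in Set.Ioc (0:ℝ) 1, ENNReal.ofReal (u ^ (1/2 : ℝ)) * ‖deriv g (β + u * s)‖ₑ ^ 2 := by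
    intro s
    calc _ ≤ (∫⁻ u in Set.Ioc (0:ℝ) 1, ‖deriv g (β + u * s)‖ₑ) ^ 2 := by gcongr; exact qq_avg g β s
      _ = (∫⁻ u in Set.Ioc (0:ℝ) 1, ENNReal.ofReal (u ^ (-(1/4) : ℝ)) * (ENNReal.ofReal (u ^ (1/4 : ℝ)) * ‖deriv g (β + u * s)‖ₑ)) ^ 2 := by
          congr 1
          apply setLIntegral_congr_fun measurableSet_Ioc
          intro u hu
          beta_reduce
          rw [← mul_assoc, ← ENNReal.ofReal_mul (Real.rpow_nonneg hu.1.le _), ← Real.rpow_add hu.1]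
          norm_num
      _ ≤ _ := CS _ (by fun_prop) (by fun_prop)
      _ = _ := by
          rw [← int_rpow]
          congr 1
          · apply setLIntegral_congr_fun measurableSet_Ioc
            intro u hu
            beta_reduce
            rw [← ENNReal.ofReal_pow (Real.rpow_nonneg hu.1.le _), ← Real.rpow_natCast, ← Real.rpow_mul hu.1.le]
            norm_num
          · apply setLIntegral_congr_fun measurableSet_Ioc
            intro u hu
            beta_reduce
            rw [mul_pow, ← ENNReal.ofReal_pow (Real.rpow_nonneg hu.1.le _), ← Real.rpow_natCast, ← Real.rpow_mul hu.1.le]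
            norm_num
  calc _ ≤ ∫⁻ s, 2 * ∫⁻ u in Set.Ioc (0:ℝ) 1, ENNReal.ofReal (u ^ (1/2 : ℝ)) * ‖deriv g (β + u * s)‖ₑ ^ 2 := lintegral_mono h1
    _ = 2 * ∫⁻ s, ∫⁻ u in Set.Ioc (0:ℝ) 1, ENNReal.ofReal (u ^ (1/2 : ℝ)) * ‖deriv g (β + u * s)‖ₑ ^ 2 := by
        rw [lintegral_const_mul' _ _ (by norm_num)]
    _ = 2 * ∫⁻ u in Set.Ioc (0:ℝ) 1, ∫⁻ s, ENNReal.ofReal (u ^ (1/2 : ℝ)) * ‖deriv g (β + u * s)‖ₑ ^ 2 := by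
        rw [lintegral_lintegral_swap]
        exact Measurable.aemeasurable (by unfold Function.uncurry; fun_prop)
    _ = 2 * ∫⁻ u in Set.Ioc (0:ℝ) 1, ENNReal.ofReal (u ^ (-(1/2) : ℝ)) * ∫⁻ x, ‖deriv g x‖ₑ ^ 2 := by
        congr 1
        apply setLIntegral_congr_fun measurableSet_Ioc
        intro u hu
        beta_reduce
        have hu0 : u ≠ 0 := hu.1.ne'
        rw [lintegral_const_mul' _ _ (by simp)]
        have e1 : ∫⁻ s, ‖deriv g (β + u * s)‖ₑ ^ 2 = ENNReal.ofReal (u⁻¹) * ∫⁻ x, ‖deriv g x‖ₑ ^ 2 := by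
          have hG : Measurable (fun y => ‖deriv g (β + y)‖ₑ ^ 2) := by fun_prop
          have := Real.map_volume_mul_left hu0
          have e := lintegral_map (μ := volume) hG (measurable_const_mul u)
          rw [this, lintegral_smul_measure, lintegral_add_left_eq_self (fun y => ‖deriv g y‖ₑ ^ 2)] at e
          rw [← e, abs_of_pos (inv_pos.2 hu.1)]; rfl
        rw [e1, ← mul_assoc, ← ENNReal.ofReal_mul (Real.rpow_nonneg hu.1.le _)]
        congr 2
        rw [← Real.rpow_neg_one, ← Real.rpow_add hu.1]; norm_num
    _ = _ := by
        rw [lintegral_mul_const _ (by fun_prop), int_rpow, ← mul_assoc]; norm_num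

end TB

namespace TB
open scoped SchwartzMap

lemma kap_symm (s t : ℝ) : kap (s - t) = kap (t - s) := by
  unfold kap; congr 2; ring

lemma sq_add_le (a b : ℝ≥0∞) : (a + b) ^ 2 ≤ 2 * a ^ 2 + 2 * b ^ 2 := by
  have := ENNReal.rpow_add_le_mul_rpow_add_rpow a b (p := 2) (by norm_num)
  norm_num at this
  rw [← mul_add]; exact this

lemma GN (D : ℝ) (hD : 0 < D) (HD : ∀ (f : 𝓢(ℝ, ℂ)) (M : ℝ), 0 ≤ M → (∀ x y, ‖f x - f y‖ ≤ M * |x - y|) →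
    ∀ x l : ℝ, 0 < l → (volume.withDensity (NN f)) (VV x l) ≤ ENNReal.ofReal (D * M ^ 2 * l)) (f g : 𝓢(ℝ, ℂ)) :
    ∫⁻ β, ∫⁻ s, ‖qq g β s‖ₑ ^ 2 * NN f (β, s) ≤
      ENNReal.ofReal (512 * D) * eLpNorm (deriv f) ⊤ volume ^ 2 * ∫⁻ x, ‖deriv g x‖ₑ ^ 2 := by
  have hmf := sch_meas f
  have hmg := sch_meas g
  have hN := NN_meas hmf
  by_cases hM : eLpNorm (deriv f) ⊤ volume = 0
  · have hF : ∀ β s, qq f β s = 0 := by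
      intro β s
      have := qq_le f β s
      rw [hM] at this
      simpa using this
    have : ∀ p, NN f p = 0 := by
      intro p; simp [NN, hF]
    simp [this]
  have hM' : 0 < (eLpNorm (deriv f) ⊤ volume).toReal := ENNReal.toReal_pos hM (linfty_fin f)
  set M := (eLpNorm (deriv f) ⊤ volume).toReal with hMd
  have key := CE (volume.withDensity (NN f)) (fun t => ‖deriv g t‖) (G := fun p => ‖qq g p.1 p.2‖ₑ) (by fun_prop)
    (dcont g).norm (fun t => norm_nonneg _) (hGb g) (K := D * M ^ 2) (by positivity)
    (HD f M hM'.le (lip f)) (by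
      apply withDensity_absolutelyContinuous
      rw [Measure.volume_eq_prod, Measure.measure_prod_null]
      · filter_upwards with x
        have : (Prod.mk x ⁻¹' {p : ℝ × ℝ | p.2 = 0}) = {0} := by ext; simp
        rw [this]; simp
      · exact measurableSet_eq_fun measurable_snd measurable_const)
  rw [lintegral_withDensity_eq_lintegral_mul _ hN (by fun_prop), Measure.volume_eq_prod, lintegral_prod _ (by
    apply Measurable.aemeasurable
    exact hN.mul (by fun_prop))] at key
  calc _ = _ := by
        congr 1; ext β; congr 1; ext s
        rw [mul_comm]; rfl
    _ ≤ _ := key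
    _ = _ := by
        rw [← ENNReal.ofReal_toReal (linfty_fin f), ← hMd, ← ENNReal.ofReal_pow hM'.le, ← ENNReal.ofReal_mul (by positivity)]
        congr 2
        · ring
        · ext t
          rw [ENNReal.ofReal_pow (norm_nonneg _), ofReal_norm]

lemma symm2 {Φ : ℝ → ℝ → ℝ≥0∞} (hΦ : Measurable (Function.uncurry Φ)) (hs : ∀ s t, Φ s t = Φ t s) :
    ∫⁻ s, ∫⁻ t, Φ s t ≤ 2 * ∫⁻ s, ∫⁻ t, {r : ℝ | |r| ≤ |s|}.indicator (Φ s) t := by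
  have hm : Measurable (fun p : ℝ × ℝ => {r : ℝ | |r| ≤ |p.1|}.indicator (Φ p.1) p.2) := by
    have : MeasurableSet {p : ℝ × ℝ | |p.2| ≤ |p.1|} := measurableSet_le (by fun_prop) (by fun_prop)
    exact hΦ.indicator this
  have hm' : Measurable (fun p : ℝ × ℝ => {r : ℝ | |r| ≤ |p.2|}.indicator (Φ p.2) p.1) :=
    hm.comp measurable_swap
  calc _ ≤ ∫⁻ s, ∫⁻ t, ({r : ℝ | |r| ≤ |s|}.indicator (Φ s) t + {r : ℝ | |r| ≤ |t|}.indicator (Φ t) s) := by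
        apply lintegral_mono; intro s; apply lintegral_mono; intro t
        beta_reduce
        rcases le_total |t| |s| with h | h
        · rw [Set.indicator_of_mem (show t ∈ {r : ℝ | |r| ≤ |s|} from h)]
          exact le_self_add
        · rw [Set.indicator_of_mem (show s ∈ {r : ℝ | |r| ≤ |t|} from h), hs s t]
          exact le_add_self
    _ = (∫⁻ s, ∫⁻ t, {r : ℝ | |r| ≤ |s|}.indicator (Φ s) t) + ∫⁻ s, ∫⁻ t, {r : ℝ | |r| ≤ |t|}.indicator (Φ t) s := by
        rw [← lintegral_add_left (Measurable.lintegral_prod_right' hm)]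
        congr 1; ext s
        rw [lintegral_add_left]
        exact hm.comp measurable_prodMk_left
    _ = _ := by
        rw [lintegral_lintegral_swap (f := fun s t => {r : ℝ | |r| ≤ |t|}.indicator (Φ t) s) hm'.aemeasurable, two_mul]

lemma TT : ∃ C : ℝ, 0 < C ∧ ∀ f g : 𝓢(ℝ, ℂ),
    ∫⁻ β, ∫⁻ s, ∫⁻ s', ‖qq f β s * qq g β s - qq f β s' * qq g β s'‖ₑ ^ 2 * kap (s - s') ≤
      ENNReal.ofReal C * eLpNorm (deriv f) ⊤ volume ^ 2 * ∫⁻ x, ‖deriv g x‖ₑ ^ 2 := by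
  obtain ⟨D, hD, HD⟩ := carleson_box
  refine ⟨4 * (40 * Real.pi ^ 2) + 4 * (512 * D), by positivity, ?_⟩
  intro f g
  have hmf := sch_meas f
  have hmg := sch_meas g
  have hN := NN_meas hmf
  set m := eLpNorm (deriv f) ⊤ volume with hm
  have hmt : m ≠ ⊤ := linfty_fin f
  calc _ ≤ ∫⁻ β, 2 * ∫⁻ s, ∫⁻ s', {r : ℝ | |r| ≤ |s|}.indicator
          (fun s' => ‖qq f β s * qq g β s - qq f β s' * qq g β s'‖ₑ ^ 2 * kap (s - s')) s' := by
        apply lintegral_mono; intro β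
        apply symm2 (Φ := fun s s' => ‖qq f β s * qq g β s - qq f β s' * qq g β s'‖ₑ ^ 2 * kap (s - s'))
        · unfold Function.uncurry; fun_prop
        · intro s t; rw [kap_symm, enorm_sub_rev]
    _ ≤ ∫⁻ β, 2 * ∫⁻ s, ((2 * m ^ 2) * (∫⁻ s', ‖qq g β s - qq g β s'‖ₑ ^ 2 * kap (s - s')) +
          2 * (‖qq g β s‖ₑ ^ 2 * NN f (β, s))) := by
        apply lintegral_mono; intro β
        beta_reduce
        gcongr with s
        unfold NN
        rw [← lintegral_const_mul' _ _ (by finiteness), ← lintegral_const_mul' _ _ (by finiteness),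
          ← lintegral_const_mul' _ _ (by finiteness), ← lintegral_add_left (by fun_prop)]
        apply lintegral_mono; intro s'
        beta_reduce
        by_cases h : s' ∈ {r : ℝ | |r| ≤ |s|}
        · rw [Set.indicator_of_mem h, Set.indicator_of_mem h]
          have e : qq f β s * qq g β s - qq f β s' * qq g β s' =
            qq f β s' * (qq g β s - qq g β s') + qq g β s * (qq f β s - qq f β s') := by ring
          rw [e]
          calc _ ≤ (2 * (m * ‖qq g β s - qq g β s'‖ₑ) ^ 2 + 2 * (‖qq g β s‖ₑ * ‖qq f β s - qq f β s'‖ₑ) ^ 2) * kap (s - s') := by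
                gcongr
                refine le_trans ?_ (sq_add_le _ _)
                gcongr
                refine (enorm_add_le _ _).trans ?_
                rw [enorm_mul, enorm_mul]
                gcongr
                exact qq_le f β s'
            _ = _ := by ring
        · rw [Set.indicator_of_notMem h]; exact zero_le
    _ = 4 * m ^ 2 * (∫⁻ β, ∫⁻ s, ∫⁻ s', ‖qq g β s - qq g β s'‖ₑ ^ 2 * kap (s - s')) +
          4 * ∫⁻ β, ∫⁻ s, ‖qq g β s‖ₑ ^ 2 * NN f (β, s) := by
        have m2 : Measurable (fun p : ℝ × ℝ => ∫⁻ s', ‖qq g p.1 p.2 - qq g p.1 s'‖ₑ ^ 2 * kap (p.2 - s')) :=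
          Measurable.lintegral_prod_right' (f := fun q : (ℝ × ℝ) × ℝ => ‖qq g q.1.1 q.1.2 - qq g q.1.1 q.2‖ₑ ^ 2 * kap (q.1.2 - q.2)) (by fun_prop)
        have e1 : ∀ β, ∫⁻ s, ((2 * m ^ 2) * (∫⁻ s', ‖qq g β s - qq g β s'‖ₑ ^ 2 * kap (s - s')) +
          2 * (‖qq g β s‖ₑ ^ 2 * NN f (β, s))) = (2 * m ^ 2) * (∫⁻ s, ∫⁻ s', ‖qq g β s - qq g β s'‖ₑ ^ 2 * kap (s - s')) +
            2 * ∫⁻ s, ‖qq g β s‖ₑ ^ 2 * NN f (β, s) := by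
          intro β
          rw [lintegral_add_left, lintegral_const_mul' _ _ (by finiteness), lintegral_const_mul' _ _ (by finiteness)]
          exact (m2.comp measurable_prodMk_left).const_mul _
        simp_rw [e1]
        rw [lintegral_const_mul' _ _ (by finiteness), lintegral_add_left, lintegral_const_mul' _ _ (by finiteness), lintegral_const_mul' _ _ (by finiteness)]
        · ring
        · exact (Measurable.lintegral_prod_right' m2).const_mul _
    _ ≤ 4 * m ^ 2 * (ENNReal.ofReal (40 * Real.pi ^ 2) * ∫⁻ x, ‖deriv g x‖ₑ ^ 2) + 4 * (ENNReal.ofReal (512 * D) * m ^ 2 * ∫⁻ x, ‖deriv g x‖ₑ ^ 2) := by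
        gcongr
        · exact lemA g
        · exact GN D hD HD f g
    _ = _ := by
        rw [ENNReal.ofReal_add (by positivity) (by positivity), ENNReal.ofReal_mul (p := 4) (by norm_num), ENNReal.ofReal_mul (p := 4) (by norm_num)]
        norm_num
        ring

end TB

namespace TB
open scoped SchwartzMap

/-- the triple bracket -/
noncomputable def br (f g h : ℝ → ℂ) (α : ℝ) : ℂ := (1 / (Complex.I * (Real.pi : ℂ))) *
        ∫ β : ℝ, ((f α - f β) / ((α - β : ℝ) : ℂ)) *
          ((g α - g β) / ((α - β : ℝ) : ℂ)) * h β

lemma dq1 (f : ℝ → ℂ) (α β : ℝ) : (f α - f β) / ((α - β : ℝ) : ℂ) = qq f β (α - β) := by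
  simp [qq]

lemma dq2 (f : ℝ → ℂ) (α β : ℝ) : (f α - f β) / ((α - β : ℝ) : ℂ) = qq f α (β - α) := by
  have : ((α - β : ℝ) : ℂ) = -((β - α : ℝ) : ℂ) := by push_cast; ring
  rw [qq, this, div_neg, ← neg_div, neg_sub]; simp

lemma c_le : ‖(1 / (Complex.I * (Real.pi : ℂ)))‖ₑ ≤ 1 := by
  rw [← ofReal_norm, ← ENNReal.ofReal_one]
  apply ENNReal.ofReal_le_ofReal
  rw [norm_div, norm_mul, norm_I, norm_real, norm_one, one_mul, Real.norm_eq_abs, abs_of_pos Real.pi_pos]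
  rw [div_le_one Real.pi_pos]
  linarith [Real.pi_gt_three]

lemma br_sup (f g h : 𝓢(ℝ, ℂ)) (α : ℝ) : ‖br f g h α‖ₑ ^ 2 ≤
    4 * eLpNorm (deriv f) ⊤ volume ^ 2 * (∫⁻ x, ‖deriv g x‖ₑ ^ 2) * ∫⁻ x, ‖h x‖ₑ ^ 2 := by
  have hmg := sch_meas g
  have hmh := sch_meas h
  set m := eLpNorm (deriv f) ⊤ volume with hm
  have hmt : m ≠ ⊤ := linfty_fin f
  have h1 : ‖br f g h α‖ₑ ≤ m * ∫⁻ β, ‖qq g α (β - α)‖ₑ * ‖h β‖ₑ := by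
    unfold br
    rw [enorm_mul]
    calc _ ≤ 1 * ∫⁻ β, ‖((f α - f β) / ((α - β : ℝ) : ℂ)) *
          ((g α - g β) / ((α - β : ℝ) : ℂ)) * h β‖ₑ := by
          gcongr
          · exact c_le
          · exact enorm_integral_le_lintegral_enorm _
      _ ≤ _ := by
          rw [one_mul, ← lintegral_const_mul' _ _ hmt]
          apply lintegral_mono; intro β
          beta_reduce
          rw [dq2 f, dq2 g, enorm_mul, enorm_mul, mul_assoc]
          gcongr
          exact qq_le f _ _
  calc _ ≤ (m * ∫⁻ β, ‖qq g α (β - α)‖ₑ * ‖h β‖ₑ) ^ 2 := by gcongr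
    _ = m ^ 2 * (∫⁻ β, ‖qq g α (β - α)‖ₑ * ‖h β‖ₑ) ^ 2 := by ring
    _ ≤ m ^ 2 * ((∫⁻ β, ‖qq g α (β - α)‖ₑ ^ 2) * ∫⁻ x, ‖h x‖ₑ ^ 2) := by
        gcongr
        exact CS _ (by fun_prop) (by fun_prop)
    _ ≤ m ^ 2 * ((4 * ∫⁻ x, ‖deriv g x‖ₑ ^ 2) * ∫⁻ x, ‖h x‖ₑ ^ 2) := by
        gcongr
        rw [lintegral_sub_right_eq_self (fun s => ‖qq g α s‖ₑ ^ 2) α]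
        exact hardy g α
    _ = _ := by ring

lemma br_int (f g h : 𝓢(ℝ, ℂ)) (α : ℝ) :
    Integrable (fun β => qq f β (α - β) * qq g β (α - β) * h β) := by
  have hmf := sch_meas f
  have hmg := sch_meas g
  apply Integrable.bdd_mul (c := (eLpNorm (deriv f) ⊤ volume).toReal * (eLpNorm (deriv g) ⊤ volume).toReal) h.integrable
  · exact Measurable.aestronglyMeasurable (by fun_prop)
  · have : ∀ (k : 𝓢(ℝ, ℂ)) β s, ‖qq k β s‖ ≤ (eLpNorm (deriv k) ⊤ volume).toReal := by
      intro k β s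
      have := ENNReal.toReal_mono (linfty_fin k) (qq_le k β s)
      simpa using this
    filter_upwards with β
    rw [norm_mul]
    gcongr
    · exact this f _ _
    · exact this g _ _

lemma br_diff (f g h : 𝓢(ℝ, ℂ)) (α α' : ℝ) : ‖br f g h α - br f g h α'‖ₑ ^ 2 ≤
    (∫⁻ x, ‖h x‖ₑ ^ 2) * ∫⁻ β, ‖qq f β (α - β) * qq g β (α - β) - qq f β (α' - β) * qq g β (α' - β)‖ₑ ^ 2 := by
  have hmf := sch_meas f
  have hmg := sch_meas g
  have hmh := sch_meas h
  have h1 : ‖br f g h α - br f g h α'‖ₑ ≤ ∫⁻ β, ‖h β‖ₑ * ‖qq f β (α - β) * qq g β (α - β) - qq f β (α' - β) * qq g β (α' - β)‖ₑ := by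
    unfold br
    simp_rw [dq1]
    rw [← mul_sub, ← integral_sub (br_int f g h α) (br_int f g h α'), enorm_mul]
    calc _ ≤ 1 * ∫⁻ β, ‖qq f β (α - β) * qq g β (α - β) * h β - qq f β (α' - β) * qq g β (α' - β) * h β‖ₑ := by
          gcongr
          · exact c_le
          · exact enorm_integral_le_lintegral_enorm _
      _ = _ := by
          rw [one_mul]; congr 1; ext β
          rw [← sub_mul, enorm_mul, mul_comm]
  calc _ ≤ _ := pow_le_pow_left' h1 2
    _ ≤ _ := CS _ (by fun_prop) (by fun_prop)

lemma l2fin (h : 𝓢(ℝ, ℂ)) : ∫⁻ x, ‖h x‖ₑ ^ 2 ≠ ⊤ := by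
  rw [lint_sq]; exact ENNReal.ofReal_ne_top

lemma br_half (f g h : 𝓢(ℝ, ℂ)) :
    ∫⁻ α, ∫⁻ α', ENNReal.ofReal (‖br f g h α - br f g h α'‖ ^ 2 / (α - α') ^ 2) ≤
    (∫⁻ x, ‖h x‖ₑ ^ 2) * ∫⁻ β, ∫⁻ s, ∫⁻ s', ‖qq f β s * qq g β s - qq f β s' * qq g β s'‖ₑ ^ 2 * kap (s - s') := by
  have hmf := sch_meas f
  have hmg := sch_meas g
  calc _ ≤ ∫⁻ α, ∫⁻ α', (∫⁻ x, ‖h x‖ₑ ^ 2) * ∫⁻ β, ‖qq f β (α - β) * qq g β (α - β) - qq f β (α' - β) * qq g β (α' - β)‖ₑ ^ 2 * kap (α - α') := by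
        apply lintegral_mono; intro α; apply lintegral_mono; intro α'
        beta_reduce
        rw [lintegral_mul_const _ (by fun_prop), ← mul_assoc, div_eq_mul_one_div, ENNReal.ofReal_mul (by positivity),
          ENNReal.ofReal_pow (norm_nonneg _), ofReal_norm]
        change _ * kap (α - α') ≤ _
        gcongr
        exact br_diff f g h α α'
    _ = (∫⁻ x, ‖h x‖ₑ ^ 2) * ∫⁻ α, ∫⁻ α', ∫⁻ β, ‖qq f β (α - β) * qq g β (α - β) - qq f β (α' - β) * qq g β (α' - β)‖ₑ ^ 2 * kap (α - α') := by
        rw [← lintegral_const_mul' _ _ (l2fin h)]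
        congr 1; ext α
        rw [← lintegral_const_mul' _ _ (l2fin h)]
    _ = _ := by
        congr 1
        rw [swap3' (H := fun β α α' => ‖qq f β (α - β) * qq g β (α - β) - qq f β (α' - β) * qq g β (α' - β)‖ₑ ^ 2 * kap (α - α')) (by fun_prop)]
        congr 1; ext β
        rw [← lintegral_sub_right_eq_self (fun s => ∫⁻ s', ‖qq f β s * qq g β s - qq f β s' * qq g β s'‖ₑ ^ 2 * kap (s - s')) β]
        congr 1; ext α
        rw [← lintegral_sub_right_eq_self (fun s' => ‖qq f β (α - β) * qq g β (α - β) - qq f β s' * qq g β s'‖ₑ ^ 2 * kap (α - β - s')) β]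
        congr 1; ext α'
        rw [sub_sub_sub_cancel_right]

lemma l2sq (u : ℝ → ℂ) : ∫⁻ x, ‖u x‖ₑ ^ 2 = eLpNorm u 2 volume ^ 2 := by
  rw [eLpNorm_eq_lintegral_rpow_enorm_toReal (by norm_num) (by norm_num), ← ENNReal.rpow_natCast, ← ENNReal.rpow_mul]
  norm_num

lemma main : ∃ C : ℝ, 0 < C ∧ ∀ f g h : 𝓢(ℝ, ℂ),
    eLpNorm (br f g h) ⊤ volume + Hhalf (br f g h)
      ≤ ENNReal.ofReal C * eLpNorm (deriv (⇑f)) ⊤ volume *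
          eLpNorm (deriv (⇑g)) 2 volume * eLpNorm (⇑h) 2 volume := by
  obtain ⟨C, hC, H⟩ := TT
  refine ⟨2 + √C, by positivity, ?_⟩
  intro f g h
  set m := eLpNorm (deriv (⇑f)) ⊤ volume
  set n := eLpNorm (deriv (⇑g)) 2 volume with hn
  set k := eLpNorm (⇑h) 2 volume with hk
  have e1 : eLpNorm (br f g h) ⊤ volume ≤ 2 * m * n * k := by
    rw [eLpNorm_exponent_top]
    refine essSup_le_of_ae_le _ ?_
    filter_upwards with α
    have := br_sup f g h α
    rw [l2sq, l2sq] at this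
    apply (ENNReal.pow_le_pow_left_iff (n := 2) (by norm_num)).1
    refine this.trans (le_of_eq ?_)
    have : (4 : ℝ≥0∞) = 2 ^ 2 := by norm_num
    rw [this]; ring
  have e2 : Hhalf (br f g h) ≤ ENNReal.ofReal (√C) * m * n * k := by
    unfold Hhalf
    have h1 : ENNReal.ofReal (1 / (2 * Real.pi)) ≤ 1 := by
      rw [← ENNReal.ofReal_one]
      apply ENNReal.ofReal_le_ofReal
      rw [div_le_one (by positivity)]
      linarith [Real.pi_gt_three]
    have h2 : ENNReal.ofReal (1 / (2 * Real.pi)) *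
        ∫⁻ α : ℝ, ∫⁻ β : ℝ, ENNReal.ofReal (‖br f g h α - br f g h β‖ ^ 2 / (α - β) ^ 2) ≤
        (ENNReal.ofReal (√C) * m * n * k) ^ 2 := by
      calc _ ≤ 1 * ((∫⁻ x, ‖h x‖ₑ ^ 2) * (ENNReal.ofReal C * m ^ 2 * ∫⁻ x, ‖deriv g x‖ₑ ^ 2)) := by
            gcongr
            refine (br_half f g h).trans ?_
            gcongr
            exact H f g
        _ = _ := by
            rw [l2sq, l2sq, ← hn, ← hk]
            have : ENNReal.ofReal C = ENNReal.ofReal (√C) ^ 2 := by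
              rw [← ENNReal.ofReal_pow (by positivity), Real.sq_sqrt hC.le]
            rw [this]; ring
    calc _ ≤ ((ENNReal.ofReal (√C) * m * n * k) ^ 2) ^ (1/2 : ℝ) := by gcongr
      _ = _ := by
          rw [← ENNReal.rpow_natCast, ← ENNReal.rpow_mul]; norm_num
  refine (add_le_add e1 e2).trans (le_of_eq ?_)
  rw [ENNReal.ofReal_add (by norm_num) (by positivity)]
  norm_num
  ring

end TB

/-- there is a universal `C > 0` so that for Schwartz `f, g, h`, the triple
bracket `[f, g; h](α) = (1/(iπ)) ∫ ((f(α)−f(β))/(α−β))((g(α)−g(β))/(α−β)) h(β) dβ`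
satisfies `‖[f, g; h]‖_{L^∞} + ‖[f, g; h]‖_{Ḣ^{1/2}} ≤ C‖f'‖_{L^∞}‖g'‖_{L²}‖h‖_{L²}`. -/
theorem statement12 : ∃ C : ℝ, 0 < C ∧ ∀ f g h : SchwartzMap ℝ ℂ,
    eLpNorm (fun α : ℝ => (1 / (Complex.I * (Real.pi : ℂ))) *
        ∫ β : ℝ, ((f α - f β) / ((α - β : ℝ) : ℂ)) *
          ((g α - g β) / ((α - β : ℝ) : ℂ)) * h β) ⊤ volume
      + Hhalf (fun α : ℝ => (1 / (Complex.I * (Real.pi : ℂ))) *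
        ∫ β : ℝ, ((f α - f β) / ((α - β : ℝ) : ℂ)) *
          ((g α - g β) / ((α - β : ℝ) : ℂ)) * h β)
      ≤ ENNReal.ofReal C * eLpNorm (deriv (⇑f)) ⊤ volume *
          eLpNorm (deriv (⇑g)) 2 volume * eLpNorm (⇑h) 2 volume := by
  exact TB.main
end

section
/- For all integers m, n ≥ 0 there exists a constant C(m, n) > 0 such that for all complex-valued Schwartz functions f, g ∈ 𝒮(ℝ), the function T(α) := (1/π) ∫_ℝ ((f(α) − f(β))/(α − β)) · g^{(n)}(β) dβ (the integral converging absolutely for each α, where g^{(n)} is the n-th derivative of g) is smooth and its m-th derivative satisfies ‖T^{(m)}‖_{L²(ℝ)} ≤ C(m, n)·‖f^{(m+n)}‖_{L^∞(ℝ)}·‖g‖_{L²(ℝ)}, where f^{(m+n)} denotes the (m+n)-th derivative of f. -/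
open MeasureTheory Complex
open scoped ENNReal NNReal

section
open MeasureTheory Complex
open scoped ENNReal NNReal
open FourierTransform SchwartzMap

namespace Comm

theorem fourier_continuous {f : ℝ → ℂ} (hf : Integrable f) : Continuous (𝓕 f) :=
  VectorFourier.fourierIntegral_continuous Real.continuous_fourierChar (by fun_prop) hf

theorem integral_fourier_mul {f g : ℝ → ℂ} (hf : Integrable f) (hg : Integrable g) :
    ∫ x, 𝓕 f x * g x = ∫ x, f x * 𝓕 g x := by
  have := VectorFourier.integral_fourierIntegral_smul_eq_flip (𝕜 := ℝ) (V := ℝ) (W := ℝ)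
    (e := Real.fourierChar) (μ := volume) (ν := volume) (L := innerₗ ℝ)
    Real.continuous_fourierChar (by fun_prop) hf hg
  rw [flip_innerₗ] at this
  exact this

theorem fourier_L2_ae {f : ℝ → ℂ} (hf : Integrable f) (h2 : MemLp f 2 volume) :
    (𝓕 (h2.toLp f) : Lp ℂ 2 (volume : Measure ℝ)) =ᵐ[volume] 𝓕 f := by
  refine ae_eq_of_integral_contDiff_smul_eq ?_ ?_ ?_
  · exact (Lp.memLp _).locallyIntegrable (by norm_num)
  · exact (fourier_continuous hf).locallyIntegrable
  · intro g hg hgs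
    have hgs' : HasCompactSupport (fun x => (g x : ℂ)) :=
      hgs.comp_left (g := fun x : ℝ => (x:ℂ)) rfl
    let G : 𝓢(ℝ, ℂ) := hgs'.toSchwartzMap (Complex.ofRealCLM.contDiff.comp hg)
    have h1 := congrArg (fun T => T G) (Lp.fourier_toTemperedDistribution_eq (h2.toLp f))
    simp only [TemperedDistribution.fourier_apply, Lp.toTemperedDistribution_apply] at h1
    have e1 : ∀ x, G x = g x := fun x => rfl
    simp only [e1] at h1
    have h3 : ∀ x : ℝ, ∀ z : ℂ, (g x) • z = (g x : ℂ) • z := fun x z => by simp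
    simp only [h3]
    rw [← h1]
    have h4 : ∫ x, (𝓕 G) x • (h2.toLp f) x = ∫ x, (𝓕 G) x • f x := by
      refine integral_congr_ae ?_
      filter_upwards [h2.coeFn_toLp] with x hx
      rw [hx]
    rw [h4]
    simp only [smul_eq_mul]
    exact integral_fourier_mul (f := G) (g := f) G.integrable hf

theorem plancherel_memLp {f : ℝ → ℂ} (hf : Integrable f) (h2 : MemLp f 2 volume) :
    MemLp (𝓕 f) 2 volume :=
  (memLp_congr_ae (fourier_L2_ae hf h2)).1 (Lp.memLp _)

theorem plancherel_eLpNorm {f : ℝ → ℂ} (hf : Integrable f) (h2 : MemLp f 2 volume) :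
    eLpNorm (𝓕 f) 2 volume = eLpNorm f 2 volume := by
  rw [← eLpNorm_congr_ae (fourier_L2_ae hf h2), ← eLpNorm_congr_ae h2.coeFn_toLp]
  have := Lp.norm_fourier_eq (h2.toLp f)
  rw [Lp.norm_def, Lp.norm_def] at this
  exact (ENNReal.toReal_eq_toReal_iff' (Lp.eLpNorm_ne_top _) (Lp.eLpNorm_ne_top _)).1 this

theorem plancherel_inner {f g : ℝ → ℂ} (hf : Integrable f) (h2 : MemLp f 2 volume)
    (hg : Integrable g) (hg2 : MemLp g 2 volume) :
    ∫ x, 𝓕 g x * starRingEnd ℂ (𝓕 f x) = ∫ x, g x * starRingEnd ℂ (f x) := by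
  have := Lp.inner_fourier_eq (h2.toLp f) (hg2.toLp g)
  rw [L2.inner_def, L2.inner_def] at this
  simp only [RCLike.inner_apply] at this
  calc _ = _ := ?_
    _ = _ := this
    _ = _ := ?_
  · refine integral_congr_ae ?_
    filter_upwards [fourier_L2_ae hf h2, fourier_L2_ae hg hg2] with x h1 h2
    rw [h1, h2]
  · refine integral_congr_ae ?_
    filter_upwards [h2.coeFn_toLp, hg2.coeFn_toLp] with x h1 h2
    rw [h1, h2]

/-- squared L2 norm -/
noncomputable def Q (u : ℝ → ℂ) : ℝ := ∫ x, ‖u x‖ ^ 2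

theorem Q_nonneg (u : ℝ → ℂ) : 0 ≤ Q u := integral_nonneg fun _ => by positivity

theorem Q_eq (u : ℝ → ℂ) : ((Q u : ℝ) : ℂ) = ∫ x, u x * starRingEnd ℂ (u x) := by
  unfold Q
  rw [← integral_complex_ofReal]
  congr 1; ext x
  rw [Complex.mul_conj, Complex.normSq_eq_norm_sq]

theorem plancherel_Q {f : ℝ → ℂ} (hf : Integrable f) (h2 : MemLp f 2 volume) :
    Q (𝓕 f) = Q f := by
  have := plancherel_inner hf h2 hf h2
  rw [← Q_eq, ← Q_eq] at this
  exact_mod_cast this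

theorem integrable_sq {u : ℝ → ℂ} (h : MemLp u 2 volume) : Integrable (fun x => ‖u x‖ ^ 2) :=
  (memLp_two_iff_integrable_sq_norm h.1).1 h

theorem Q_eLp {u : ℝ → ℂ} (h : MemLp u 2 volume) :
    eLpNorm u 2 volume = ENNReal.ofReal (Real.sqrt (Q u)) := by
  rw [h.eLpNorm_eq_integral_rpow_norm (by norm_num) (by norm_num)]
  congr 1
  simp [Q, Real.sqrt_eq_rpow]

theorem amgm (x y t : ℝ) (ht : 0 < t) : x * y ≤ (t * x ^ 2 + t⁻¹ * y ^ 2) / 2 := by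
  have : 0 ≤ (t * x - y) ^ 2 / t := by positivity
  have e : (t * x - y) ^ 2 / t = t * x ^ 2 + t⁻¹ * y ^ 2 - 2 * (x * y) := by
    field_simp; ring
  linarith

theorem of_forall_t {X P R : ℝ} (hP : 0 ≤ P) (hR : 0 ≤ R)
    (h : ∀ t : ℝ, 0 < t → X ≤ (t * P + t⁻¹ * R) / 2) : X ≤ Real.sqrt P * Real.sqrt R := by
  refine le_of_forall_pos_le_add fun ε hε => ?_
  -- perturb
  have hs : ∀ η : ℝ, 0 < η → X ≤ Real.sqrt (P + η) * Real.sqrt (R + η) := by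
    intro η hη
    have a1 : 0 < Real.sqrt (P + η) := Real.sqrt_pos.2 (by linarith)
    have a2 : 0 < Real.sqrt (R + η) := Real.sqrt_pos.2 (by linarith)
    have := h (Real.sqrt (R + η) / Real.sqrt (P + η)) (by positivity)
    refine this.trans ?_
    have b1 : P ≤ Real.sqrt (P + η) ^ 2 := by rw [Real.sq_sqrt (by linarith)]; linarith
    have b2 : R ≤ Real.sqrt (R + η) ^ 2 := by rw [Real.sq_sqrt (by linarith)]; linarith
    calc _ ≤ (Real.sqrt (R + η) / Real.sqrt (P + η) * Real.sqrt (P + η) ^ 2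
          + (Real.sqrt (R + η) / Real.sqrt (P + η))⁻¹ * Real.sqrt (R + η) ^ 2) / 2 := by gcongr
      _ = _ := by field_simp; ring
  have ht : Filter.Tendsto (fun η : ℝ => Real.sqrt (P + η) * Real.sqrt (R + η))
      (nhdsWithin 0 (Set.Ioi 0)) (nhds (Real.sqrt P * Real.sqrt R)) := by
    have : Continuous (fun η : ℝ => Real.sqrt (P + η) * Real.sqrt (R + η)) := by fun_prop
    have := this.tendsto 0
    simp only [add_zero] at this
    exact this.mono_left nhdsWithin_le_nhds
  have := ge_of_tendsto ht (by filter_upwards [self_mem_nhdsWithin] with η hη using hs η hη)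
  linarith

theorem cs {f g : ℝ → ℂ} (hf : MemLp f 2 volume) (hg : MemLp g 2 volume) :
    ‖∫ x, f x * g x‖ ≤ Real.sqrt (Q f) * Real.sqrt (Q g) := by
  refine of_forall_t (Q_nonneg _) (Q_nonneg _) fun t ht => ?_
  refine (norm_integral_le_integral_norm _).trans ?_
  calc _ ≤ ∫ x, (t * ‖f x‖ ^ 2 + t⁻¹ * ‖g x‖ ^ 2) / 2 := by
        refine integral_mono_of_nonneg (.of_forall fun _ => norm_nonneg _) ?_ (.of_forall fun x => ?_)
        · exact (((integrable_sq hf).const_mul _).add ((integrable_sq hg).const_mul _)).div_const _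
        · simp only [norm_mul]; exact amgm _ _ _ ht
    _ = _ := by
        rw [integral_div, integral_add ((integrable_sq hf).const_mul _)
          ((integrable_sq hg).const_mul _), integral_const_mul, integral_const_mul]; rfl

end Comm
end

section
open MeasureTheory Complex
open scoped ENNReal NNReal
open FourierTransform SchwartzMap

namespace Comm

structure Adm (φ : ℝ → ℂ) : Prop where
  meas : Measurable φ
  int : Integrable φ
  bdd : ∃ K, ∀ x, ‖φ x‖ ≤ K

theorem Adm.memLp {φ : ℝ → ℂ} (h : Adm φ) : MemLp φ 2 volume := by
  obtain ⟨K, hK⟩ := h.bdd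
  rw [memLp_two_iff_integrable_sq_norm h.int.1]
  simp only [pow_two]
  exact h.int.norm.bdd_mul (c := K) h.int.1.norm (.of_forall fun x => by simpa using hK x)

theorem Adm.mul {φ q : ℝ → ℂ} (h : Adm φ) (hq : Measurable q) {K : ℝ} (hK : ∀ x, ‖q x‖ ≤ K) :
    Adm (fun x => q x * φ x) := by
  obtain ⟨K', hK'⟩ := h.bdd
  refine ⟨hq.mul h.meas, h.int.bdd_mul (c := K) hq.aestronglyMeasurable (.of_forall hK), K * K', ?_⟩
  intro x
  rw [norm_mul]
  exact mul_le_mul (hK x) (hK' x) (norm_nonneg _) ((norm_nonneg _).trans (hK x))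

theorem Adm.comp_neg {φ : ℝ → ℂ} (h : Adm φ) : Adm (fun x => φ (-x)) := by
  obtain ⟨K', hK'⟩ := h.bdd
  exact ⟨h.meas.comp measurable_neg, h.int.comp_neg, K', fun x => hK' _⟩

theorem Adm.add {φ ψ : ℝ → ℂ} (h : Adm φ) (h' : Adm ψ) : Adm (fun x => φ x + ψ x) := by
  obtain ⟨K, hK⟩ := h.bdd
  obtain ⟨K', hK'⟩ := h'.bdd
  exact ⟨h.meas.add h'.meas, h.int.add h'.int, K + K', fun x => (norm_add_le _ _).trans (add_le_add (hK x) (hK' x))⟩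

theorem Adm.norm {φ : ℝ → ℂ} (h : Adm φ) : Adm (fun x => (‖φ x‖ : ℂ)) := by
  obtain ⟨K, hK⟩ := h.bdd
  refine ⟨by have := h.meas; fun_prop, h.int.norm.ofReal, K, fun x => by simpa using hK x⟩

/-- Hankel type operator -/
noncomputable def H (φ u : ℝ → ℂ) (a : ℝ) : ℂ := ∫ b, φ (a + b) * u b

theorem H_eq_conv (φ u : ℝ → ℂ) :
    H φ u = MeasureTheory.convolution (fun b => u (-b)) φ (ContinuousLinearMap.mul ℂ ℂ) volume := by
  ext a
  unfold H MeasureTheory.convolution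
  rw [← integral_neg_eq_self]
  simp only [ContinuousLinearMap.mul_apply', neg_neg]
  congr 1; ext b; rw [mul_comm, sub_eq_add_neg]

theorem Adm.H_int {φ u : ℝ → ℂ} (h : Adm φ) (hu : Adm u) (a : ℝ) :
    Integrable (fun b => φ (a + b) * u b) := by
  obtain ⟨K, hK⟩ := h.bdd
  exact hu.int.bdd_mul (c := K) (h.meas.comp (measurable_const.add measurable_id)).aestronglyMeasurable
    (.of_forall fun x => hK _)

theorem Adm.H {φ u : ℝ → ℂ} (h : Adm φ) (hu : Adm u) : Adm (H φ u) := by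
  obtain ⟨K, hK⟩ := h.bdd
  refine ⟨?_, ?_, K * ∫ b, ‖u b‖, ?_⟩
  · have h1 := h.meas
    have h2 := hu.meas
    have : StronglyMeasurable (Function.uncurry fun a b : ℝ => φ (a + b) * u b) := by
      apply Measurable.stronglyMeasurable
      simp only [Function.uncurry_def]
      fun_prop
    exact this.integral_prod_right.measurable
  · rw [H_eq_conv]
    exact hu.comp_neg.int.integrable_convolution _ h.int
  · intro a
    refine (norm_integral_le_integral_norm _).trans ?_
    rw [← integral_const_mul]
    refine integral_mono_of_nonneg (.of_forall fun _ => norm_nonneg _) (hu.int.norm.const_mul _)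
      (.of_forall fun x => ?_)
    simp only [norm_mul]
    gcongr
    exact hK _

theorem fourier_H {φ u : ℝ → ℂ} (h : Adm φ) (hu : Adm u) (x : ℝ) :
    𝓕 (H φ u) x = 𝓕 (fun b => u (-b)) x * 𝓕 φ x := by
  rw [H_eq_conv]
  exact Real.fourier_mul_convolution_eq hu.comp_neg.int h.int x

theorem Q_comp_neg (u : ℝ → ℂ) : Q (fun b => u (-b)) = Q u := by
  unfold Q
  exact integral_neg_eq_self (fun x => ‖u x‖ ^ 2) volume

theorem Q_H_le {φ u : ℝ → ℂ} (h : Adm φ) (hu : Adm u) {M : ℝ} (hM : ∀ x, ‖𝓕 φ x‖ ≤ M) :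
    Q (H φ u) ≤ M ^ 2 * Q u := by
  rw [← plancherel_Q (h.H hu).int (h.H hu).memLp, ← Q_comp_neg u,
    ← plancherel_Q hu.comp_neg.int hu.comp_neg.memLp]
  unfold Q
  rw [← integral_const_mul]
  refine integral_mono_of_nonneg (.of_forall fun _ => by positivity)
    ((integrable_sq (plancherel_memLp hu.comp_neg.int hu.comp_neg.memLp)).const_mul _)
    (.of_forall fun x => ?_)
  simp only [fourier_H h hu, norm_mul, mul_pow]
  rw [mul_comm]
  gcongr
  exact hM x

theorem inner_H_le {φ₁ φ₂ u₁ u₂ : ℝ → ℂ} (h₁ : Adm φ₁) (h₂ : Adm φ₂) (hu₁ : Adm u₁) (hu₂ : Adm u₂) :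
    ‖∫ a, H φ₁ u₁ a * starRingEnd ℂ (H φ₂ u₂ a)‖ ≤
      Real.sqrt (Q (H φ₁ u₂)) * Real.sqrt (Q (H φ₂ u₁)) := by
  rw [← plancherel_inner (h₂.H hu₂).int (h₂.H hu₂).memLp (h₁.H hu₁).int (h₁.H hu₁).memLp]
  rw [← plancherel_Q (h₁.H hu₂).int (h₁.H hu₂).memLp, ← plancherel_Q (h₂.H hu₁).int (h₂.H hu₁).memLp]
  have k1 := plancherel_memLp (h₁.H hu₂).int (h₁.H hu₂).memLp
  have k2 := plancherel_memLp (h₂.H hu₁).int (h₂.H hu₁).memLp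
  refine of_forall_t (Q_nonneg _) (Q_nonneg _) fun t ht => ?_
  refine (norm_integral_le_integral_norm _).trans ?_
  calc _ ≤ ∫ x, (t * ‖𝓕 (H φ₁ u₂) x‖ ^ 2 + t⁻¹ * ‖𝓕 (H φ₂ u₁) x‖ ^ 2) / 2 := by
        refine integral_mono_of_nonneg (.of_forall fun _ => norm_nonneg _) ?_ (.of_forall fun x => ?_)
        · exact (((integrable_sq k1).const_mul _).add ((integrable_sq k2).const_mul _)).div_const _
        · refine le_trans (le_of_eq ?_) (amgm _ _ _ ht)
          simp only [fourier_H h₁ hu₁, fourier_H h₂ hu₂, fourier_H h₂ hu₁, fourier_H h₁ hu₂, norm_mul, map_mul,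
            RCLike.norm_conj]
          ring
    _ = _ := by
        rw [integral_div, integral_add ((integrable_sq k1).const_mul _)
          ((integrable_sq k2).const_mul _), integral_const_mul, integral_const_mul]; rfl

/-- superposition lemma -/
theorem int_pow_exp (j : ℕ) {L : ℝ} (hL : 0 < L) :
    ∫ s in Set.Ioi (0:ℝ), s ^ j * Real.exp (-(s * L)) = j.factorial / L ^ (j + 1) := by
  have := Real.integral_rpow_mul_exp_neg_mul_Ioi (a := j + 1) (r := L) (by positivity) hL
  rw [Real.Gamma_nat_eq_factorial] at this
  simp only [add_sub_cancel_right, Real.rpow_natCast] at this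
  have e : ((j:ℝ) + 1) = ((j + 1 : ℕ) : ℝ) := by push_cast; ring
  rw [e, Real.rpow_natCast] at this
  simp only [mul_comm L] at this
  rw [this, div_pow, one_pow]; field_simp

theorem integrable_pow_exp (j : ℕ) {L : ℝ} (hL : 0 < L) :
    IntegrableOn (fun s : ℝ => s ^ j * Real.exp (-(s * L))) (Set.Ioi 0) := by
  by_contra h
  have := integral_undef h
  rw [int_pow_exp j hL] at this
  have : 0 < (j.factorial : ℝ) / L ^ (j + 1) := by positivity
  linarith

section sup
variable {Z : Type*} [MeasurableSpace Z] {ν : Measure Z}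

theorem superpos_int (j : ℕ) {K : Z → ℂ} (hK : Integrable K ν) {Λ : Z → ℝ} (hΛ : Measurable Λ)
    {δ : ℝ} (hδ : 0 < δ) (hs : ∀ z, K z ≠ 0 → δ ≤ Λ z) :
    Integrable (fun p : ℝ × Z => ((p.1 ^ j * Real.exp (-(p.1 * Λ p.2)) : ℝ) : ℂ) * K p.2)
      ((volume.restrict (Set.Ioi 0)).prod ν) := by
  have hd : Integrable (fun p : ℝ × Z => (p.1 ^ j * Real.exp (-(p.1 * δ))) * ‖K p.2‖)
      ((volume.restrict (Set.Ioi 0)).prod ν) :=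
    (integrable_pow_exp j hδ).mul_prod hK.norm
  refine hd.mono' ?_ ?_
  · refine AEStronglyMeasurable.mul ?_ hK.1.comp_snd
    apply Measurable.aestronglyMeasurable
    fun_prop
  · have hpos : ∀ᵐ p ∂((volume.restrict (Set.Ioi (0:ℝ))).prod ν), 0 < p.1 := by
      have : ∀ᵐ s ∂(volume.restrict (Set.Ioi (0:ℝ))), 0 < s := ae_restrict_mem measurableSet_Ioi
      exact Measure.quasiMeasurePreserving_fst.ae this
    filter_upwards [hpos] with p hp
    by_cases h0 : K p.2 = 0
    · simp [h0]
    · rw [norm_mul, Complex.norm_real, Real.norm_of_nonneg (by positivity)]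
      have := hs _ h0
      gcongr

theorem superpos [SFinite ν] (j : ℕ) {K : Z → ℂ} (hK : Integrable K ν) {Λ : Z → ℝ} (hΛ : Measurable Λ)
    {δ : ℝ} (hδ : 0 < δ) (hs : ∀ z, K z ≠ 0 → δ ≤ Λ z) :
    ∫ z, ((j.factorial / Λ z ^ (j + 1) : ℝ) : ℂ) * K z ∂ν =
      ∫ s in Set.Ioi (0:ℝ), (s : ℂ) ^ j * ∫ z, (Real.exp (-(s * Λ z)) : ℂ) * K z ∂ν := by
  have h := integral_integral_swap (f := fun (s : ℝ) (z : Z) =>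
    ((s ^ j * Real.exp (-(s * Λ z)) : ℝ) : ℂ) * K z) (superpos_int j hK hΛ hδ hs)
  calc _ = ∫ z, (∫ s in Set.Ioi (0:ℝ), ((s ^ j * Real.exp (-(s * Λ z)) : ℝ) : ℂ) * K z) ∂ν := by
        congr 1; ext z
        by_cases h0 : K z = 0
        · simp [h0]
        rw [integral_mul_const, integral_complex_ofReal, int_pow_exp j (hδ.trans_le (hs z h0))]
    _ = _ := h.symm
    _ = _ := by
        congr 1; ext s
        rw [← integral_const_mul]
        congr 1; ext z
        push_cast; ring
end sup

end Comm
end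

section
open MeasureTheory Complex
open scoped ENNReal NNReal
open FourierTransform SchwartzMap

namespace Comm

theorem poisson_integral {s : ℝ} (hs : 0 < s) :
    ∫ y : ℝ, 2 * s / (s ^ 2 + 4 * Real.pi ^ 2 * y ^ 2) = 1 ∧
    Integrable (fun y : ℝ => 2 * s / (s ^ 2 + 4 * Real.pi ^ 2 * y ^ 2)) := by
  have e : (fun y : ℝ => 2 * s / (s ^ 2 + 4 * Real.pi ^ 2 * y ^ 2)) =
      fun y => (2 / s) * (1 + ((2 * Real.pi / s) * y) ^ 2)⁻¹ := by
    ext y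
    have : 0 < s ^ 2 + 4 * Real.pi ^ 2 * y ^ 2 := by positivity
    have : 0 < (1 + ((2 * Real.pi / s) * y) ^ 2) := by positivity
    field_simp
    ring
  rw [e]
  constructor
  · rw [integral_const_mul, Measure.integral_comp_mul_left (fun x => (1 + x ^ 2)⁻¹),
      integral_univ_inv_one_add_sq, abs_of_pos (by positivity)]
    have := Real.pi_pos
    simp only [smul_eq_mul]
    field_simp
  · exact (integrable_inv_one_add_sq.comp_mul_left' (by positivity)).const_mul _

theorem fourier_exp_abs {s : ℝ} (hs : 0 < s) (y : ℝ) :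
    ∫ c : ℝ, cexp (((-2 * Real.pi * c * y : ℝ) : ℂ) * I) * (Real.exp (-(s * |c|)) : ℂ) =
      ((2 * s / (s ^ 2 + 4 * Real.pi ^ 2 * y ^ 2) : ℝ) : ℂ) := by
  have hz1 : (-(s : ℂ) - 2 * Real.pi * y * I).re < 0 := by simp [hs]
  have hz2 : 0 < ((s : ℂ) - 2 * Real.pi * y * I).re := by simp [hs]
  have i1 := integrableOn_exp_mul_complex_Ioi hz1 0
  have i2 := integrableOn_exp_mul_complex_Iic hz2 0
  have v1 := integral_exp_mul_complex_Ioi hz1 0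
  have v2 := integral_exp_mul_complex_Iic hz2 0
  set F : ℝ → ℂ := fun c : ℝ =>
    cexp (((-2 * Real.pi * c * y : ℝ) : ℂ) * I) * (Real.exp (-(s * |c|)) : ℂ) with hF
  have e1 : Set.EqOn (fun x : ℝ => cexp ((-(s : ℂ) - 2 * Real.pi * y * I) * x)) F (Set.Ioi 0) := by
    intro c hc
    have hc : 0 < c := hc
    simp only [hF, abs_of_pos hc]
    push_cast
    rw [← Complex.exp_add]; congr 1; ring
  have e2 : Set.EqOn (fun x : ℝ => cexp (((s : ℂ) - 2 * Real.pi * y * I) * x)) F (Set.Iic 0) := by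
    intro c hc
    have hc : c ≤ 0 := hc
    simp only [hF, abs_of_nonpos hc]
    push_cast
    rw [← Complex.exp_add]; congr 1; ring
  rw [setIntegral_congr_fun measurableSet_Ioi e1] at v1
  rw [setIntegral_congr_fun measurableSet_Iic e2] at v2
  rw [← setIntegral_univ, ← Set.Iic_union_Ioi (a := (0:ℝ)), setIntegral_union
    (Set.Iic_disjoint_Ioi le_rfl) measurableSet_Ioi (i2.congr_fun e2 measurableSet_Iic)
    (i1.congr_fun e1 measurableSet_Ioi), v1, v2]
  have n1 : (-(s : ℂ) - 2 * Real.pi * y * I) ≠ 0 := by intro h; rw [h] at hz1; simp at hz1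
  have n2 : ((s : ℂ) - 2 * Real.pi * y * I) ≠ 0 := by intro h; rw [h] at hz2; simp at hz2
  have n3 : (s:ℂ) ^ 2 + 4 * Real.pi ^ 2 * y ^ 2 ≠ 0 := by
    have : 0 < s ^ 2 + 4 * Real.pi ^ 2 * y ^ 2 := by positivity
    exact_mod_cast this.ne'
  push_cast
  simp only [mul_zero, Complex.exp_zero]
  rw [div_add_div _ _ n2 n1, div_eq_div_iff (mul_ne_zero n2 n1) n3]
  ring_nf
  simp only [I_sq]
  ring

theorem integrable_exp_abs {s : ℝ} (hs : 0 < s) :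
    Integrable (fun c : ℝ => (Real.exp (-(s * |c|)) : ℂ)) := by
  by_contra h
  have := fourier_exp_abs hs 0
  simp only [mul_zero, ofReal_zero, zero_mul, Complex.exp_zero, one_mul] at this
  rw [integral_undef h] at this
  have h2 : 0 < 2 * s / (s ^ 2 + 4 * Real.pi ^ 2 * 0 ^ 2) := by positivity
  have h3 := h2.ne
  apply h3
  exact_mod_cast this

theorem poisson_bound (φ : 𝓢(ℝ, ℂ)) {M : ℝ} (hM : ∀ x, ‖𝓕 (φ : ℝ → ℂ) x‖ ≤ M) {s : ℝ}
    (hs : 0 ≤ s) (x : ℝ) :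
    ‖𝓕 (fun c => (Real.exp (-(s * |c|)) : ℂ) * φ c) x‖ ≤ M := by
  rcases hs.eq_or_lt with rfl | hs
  · simpa using hM x
  set Ψ : 𝓢(ℝ, ℂ) := 𝓕⁻ φ with hΨ
  have hφ : ∀ c, φ c = 𝓕 (Ψ : ℝ → ℂ) c := by
    intro c
    rw [← SchwartzMap.fourier_coe, hΨ, FourierTransform.fourier_fourierInv_eq]
  have hb : ∀ y, ‖Ψ y‖ ≤ M := by
    intro y
    rw [hΨ, SchwartzMap.fourierInv_coe, Real.fourierInv_eq_fourier_neg]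
    exact hM _
  set ρ : ℝ → ℂ := fun c => cexp (((-2 * Real.pi * c * x : ℝ) : ℂ) * I) * (Real.exp (-(s * |c|)) : ℂ)
    with hρ
  have hρi : Integrable ρ := by
    refine (integrable_exp_abs hs).bdd_mul (c := 1) (by fun_prop) (.of_forall fun c => ?_)
    rw [Complex.norm_exp_ofReal_mul_I]
  have hρF : ∀ y, 𝓕 ρ y = ((2 * s / (s ^ 2 + 4 * Real.pi ^ 2 * (x + y) ^ 2) : ℝ) : ℂ) := by
    intro y
    rw [← fourier_exp_abs hs (x + y), Real.fourier_real_eq_integral_exp_smul]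
    congr 1; ext c
    rw [hρ, smul_eq_mul, ← mul_assoc, ← Complex.exp_add]
    congr 2
    push_cast; ring
  have key : 𝓕 (fun c => (Real.exp (-(s * |c|)) : ℂ) * φ c) x = ∫ y, 𝓕 ρ y * Ψ y := by
    rw [integral_fourier_mul hρi Ψ.integrable, Real.fourier_real_eq_integral_exp_smul]
    congr 1; ext c
    rw [hφ, hρ, smul_eq_mul, ← mul_assoc]
  rw [key]
  obtain ⟨p1, p2⟩ := poisson_integral hs
  refine (norm_integral_le_integral_norm _).trans ?_
  calc _ ≤ ∫ y : ℝ, M * (2 * s / (s ^ 2 + 4 * Real.pi ^ 2 * (x + y) ^ 2)) := by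
        refine integral_mono_of_nonneg (.of_forall fun _ => norm_nonneg _)
          ((p2.comp_add_left x).const_mul _) (.of_forall fun y => ?_)
        simp only [norm_mul, hρF, Complex.norm_real]
        rw [Real.norm_of_nonneg (by positivity), mul_comm]
        gcongr
        exact hb y
    _ = M := by
        rw [integral_const_mul, integral_add_left_eq_self
          (fun y => 2 * s / (s ^ 2 + 4 * Real.pi ^ 2 * y ^ 2)) x, p1, mul_one]

end Comm
end

section
open MeasureTheory Complex
open scoped ENNReal NNReal
open FourierTransform SchwartzMap

namespace Comm

theorem adm_schwartz (φ : 𝓢(ℝ, ℂ)) : Adm φ := by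
  refine ⟨φ.continuous.measurable, φ.integrable, ?_⟩
  obtain ⟨C, hC⟩ := φ.decay 0 0
  exact ⟨C, fun x => by simpa using hC.2 x⟩

/-- multiplication by `x ^ k` -/
noncomputable def mx (k : ℕ) (φ : 𝓢(ℝ, ℂ)) : 𝓢(ℝ, ℂ) :=
  smulLeftCLM ℂ (fun x : ℝ => (x : ℂ) ^ k) φ

theorem mx_apply (k : ℕ) (φ : 𝓢(ℝ, ℂ)) (x : ℝ) : mx k φ x = (x : ℂ) ^ k * φ x := by
  unfold mx
  rw [smulLeftCLM_apply_apply, smul_eq_mul]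
  have h : Function.HasTemperateGrowth (fun x : ℝ => (x : ℂ)) := Complex.ofRealCLM.hasTemperateGrowth
  exact h.pow k

structure Nice (u : ℝ → ℂ) : Prop where
  meas : Measurable u
  bdd : ∃ K, ∀ x, ‖u x‖ ≤ K
  supp : ∃ δ > 0, ∃ L, ∀ x, u x ≠ 0 → δ ≤ x ∧ x ≤ L

theorem Nice.adm {u : ℝ → ℂ} (h : Nice u) : Adm u := by
  refine ⟨h.meas, ?_, h.bdd⟩
  obtain ⟨K, hK⟩ := h.bdd
  obtain ⟨δ, hδ, L, hL⟩ := h.supp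
  have : IntegrableOn u (Set.Icc δ L) := by
    refine Measure.integrableOn_of_bounded (M := K) (by simp) h.meas.aestronglyMeasurable
      (.of_forall hK)
  refine (integrableOn_iff_integrable_of_support_subset ?_).1 this
  intro x hx
  exact hL x hx

theorem Nice.mul {u q : ℝ → ℂ} (h : Nice u) (hq : Continuous q) : Nice (fun x => q x * u x) := by
  obtain ⟨K, hK⟩ := h.bdd
  obtain ⟨δ, hδ, L, hL⟩ := h.supp
  obtain ⟨C, hC⟩ := isCompact_Icc.exists_bound_of_continuousOn (s := Set.Icc δ L) hq.continuousOn
  refine ⟨hq.measurable.mul h.meas, ⟨max 0 (C * K), fun x => ?_⟩, δ, hδ, L, fun x hx => hL x ?_⟩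
  · by_cases hx : u x = 0
    · simp [hx]
    · rw [norm_mul]
      refine le_max_of_le_right ?_
      have := hC x (hL x hx)
      exact mul_le_mul this (hK x) (norm_nonneg _) ((norm_nonneg _).trans this)
  · exact right_ne_zero_of_mul hx

noncomputable def D (n : ℕ) (s : ℝ) (u : ℝ → ℂ) (b : ℝ) : ℂ :=
  ((b ^ n * Real.exp (-(s * b)) : ℝ) : ℂ) * u b

theorem Nice.D {u : ℝ → ℂ} (h : Nice u) (n : ℕ) (s : ℝ) : Nice (D n s u) :=
  h.mul (q := fun b => ((b ^ n * Real.exp (-(s * b)) : ℝ) : ℂ)) (by fun_prop)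

theorem energy (n : ℕ) {μ : ℝ} (hμ : 0 < μ) {u : ℝ → ℂ} (h : Nice u) :
    IntegrableOn (fun s => s ^ (2 * n + 1) * Q (D (n + 1) (s * μ) u)) (Set.Ioi 0) ∧
    ∫ s in Set.Ioi (0:ℝ), s ^ (2 * n + 1) * Q (D (n + 1) (s * μ) u) =
      (2 * n + 1).factorial / (2 * μ) ^ (2 * n + 2) * Q u := by
  set K : ℝ → ℂ := fun b => ((‖D (n + 1) 0 u b‖ ^ 2 : ℝ) : ℂ) with hKdef
  have hK : Integrable K := (integrable_sq (h.D (n + 1) 0).adm.memLp).ofReal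
  obtain ⟨δ, hδ, L, hL⟩ := h.supp
  have hs : ∀ b, K b ≠ 0 → 2 * μ * δ ≤ 2 * μ * b := by
    intro b hb
    have : u b ≠ 0 := by rintro h0; simp [hKdef, D, h0] at hb
    have := (hL b this).1
    gcongr
  have hm : Measurable fun b : ℝ => 2 * μ * b := by fun_prop
  have e := superpos (2 * n + 1) hK hm (δ := 2 * μ * δ) (by positivity) hs
  have ei := superpos_int (2 * n + 1) hK hm (δ := 2 * μ * δ) (by positivity) hs
  have eQ : ∀ s, ∫ b, (Real.exp (-(s * (2 * μ * b))) : ℂ) * K b = ((Q (D (n + 1) (s * μ) u) : ℝ) : ℂ) := by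
    intro s
    unfold Q
    rw [← integral_complex_ofReal]
    congr 1; ext b
    rw [hKdef, ← ofReal_mul]
    congr 1
    simp only [D, norm_mul, Complex.norm_real, Real.norm_eq_abs, abs_mul, Real.abs_exp, zero_mul, neg_zero, Real.exp_zero,
      mul_one, mul_pow, ← Real.exp_nat_mul]
    have : Real.exp (-(s * (2 * μ * b))) = Real.exp (((2:ℕ):ℝ) * -(s * μ * b)) := by
      congr 1; push_cast; ring
    rw [this]; ring
  constructor
  · have := ei.integral_prod_left
    have := this.re
    refine this.congr (.of_forall fun s => ?_)
    simp only [ofReal_mul, mul_assoc, integral_const_mul, RCLike.re_to_complex]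
    have h3 := eQ s
    simp only [mul_assoc] at h3
    rw [h3, ← ofReal_mul, ofReal_re]
  · simp only [eQ] at e
    have e2 : ∫ b, (((2 * n + 1).factorial / (2 * μ * b) ^ (2 * n + 1 + 1) : ℝ) : ℂ) * K b =
        (((2 * n + 1).factorial / (2 * μ) ^ (2 * n + 2) * Q u : ℝ) : ℂ) := by
      unfold Q
      rw [← integral_const_mul, ← integral_complex_ofReal]
      congr 1; ext b
      rw [hKdef, ← ofReal_mul]
      congr 1
      by_cases hu : u b = 0
      · simp [D, hu]
      have hb : 0 < b := hδ.trans_le (hL b hu).1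
      simp only [D, norm_mul, Complex.norm_real, Real.norm_eq_abs, zero_mul, neg_zero, Real.exp_zero,
        mul_one, abs_pow, abs_of_pos hb]
      field_simp
      ring
    rw [e2] at e
    have e3 : ∀ s : ℝ, (s:ℂ) ^ (2 * n + 1) * ((Q (D (n + 1) (s * μ) u) : ℝ) : ℂ) =
      ((s ^ (2 * n + 1) * Q (D (n + 1) (s * μ) u) : ℝ) : ℂ) := by intro s; push_cast; ring
    simp only [e3] at e
    rw [integral_complex_ofReal] at e
    exact_mod_cast e.symm

noncomputable def Bil (φ u v : ℝ → ℂ) : ℂ := ∫ a, v a * H φ u a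

theorem Bil_le {φ u v : ℝ → ℂ} (h : Adm φ) (hu : Adm u) (hv : Adm v) :
    ‖Bil φ u v‖ ≤ Real.sqrt (Q v) * Real.sqrt (Q (H φ u)) :=
  cs hv.memLp (h.H hu).memLp

theorem Bil_le' {φ u v : ℝ → ℂ} (h : Adm φ) (hu : Adm u) (hv : Adm v) {M : ℝ} (hM : ∀ x, ‖𝓕 φ x‖ ≤ M) :
    ‖Bil φ u v‖ ≤ M * (Real.sqrt (Q u) * Real.sqrt (Q v)) := by
  have hM0 : 0 ≤ M := (norm_nonneg _).trans (hM 0)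
  refine (Bil_le h hu hv).trans ?_
  have := Real.sqrt_le_sqrt (Q_H_le h hu hM)
  rw [Real.sqrt_mul (by positivity), Real.sqrt_sq hM0] at this
  calc _ ≤ Real.sqrt (Q v) * (M * Real.sqrt (Q u)) := by gcongr
    _ = _ := by ring

theorem Bil_int {φ u v : ℝ → ℂ} (h : Adm φ) (hu : Adm u) (hv : Adm v) :
    Integrable (fun z : ℝ × ℝ => φ (z.1 + z.2) * (v z.1 * u z.2)) (volume.prod volume) := by
  obtain ⟨K, hK⟩ := h.bdd
  exact (hv.int.mul_prod hu.int).bdd_mul (c := K)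
    (h.meas.comp (measurable_fst.add measurable_snd)).aestronglyMeasurable (.of_forall fun x => hK _)

theorem Bil_prod {φ u v : ℝ → ℂ} (h : Adm φ) (hu : Adm u) (hv : Adm v) :
    Bil φ u v = ∫ z : ℝ × ℝ, φ (z.1 + z.2) * (v z.1 * u z.2) := by
  rw [Measure.volume_eq_prod, integral_prod _ (Bil_int h hu hv)]
  unfold Bil H
  congr 1; ext a
  rw [← integral_const_mul]
  congr 1; ext b; ring

theorem superBil (j m n : ℕ) {μ : ℝ} (hμ : 0 < μ) {φ ψ u v : ℝ → ℂ} (hφ : Adm φ) (hψ : Adm ψ)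
    (hu : Nice u) (hv : Nice v) (hr : ∀ c : ℝ, 0 < c → (c : ℂ) ^ (j + 1) * φ c = ψ c) :
    Bil φ (D n 0 u) (D m 0 v) = ((μ ^ (j + 1) / j.factorial : ℝ) : ℂ) *
      ∫ s in Set.Ioi (0:ℝ), (s : ℂ) ^ j * Bil ψ (D n (s * μ) u) (D m (s * μ) v) := by
  rw [Bil_prod hφ (hu.D _ _).adm (hv.D _ _).adm]
  obtain ⟨δ, hδ, L, hL⟩ := hu.supp
  obtain ⟨δ', hδ', L', hL'⟩ := hv.supp
  have e := superpos j (Bil_int hψ (hu.D n 0).adm (hv.D m 0).adm) (Λ := fun z => μ * (z.1 + z.2))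
    (by fun_prop) (δ := μ * δ) (by positivity) (by
      intro z hz
      have h1 := right_ne_zero_of_mul hz
      have h2 := (hL _ (right_ne_zero_of_mul (right_ne_zero_of_mul h1))).1
      have h3 := (hL' _ (right_ne_zero_of_mul (left_ne_zero_of_mul h1))).1
      have : δ ≤ z.1 + z.2 := by linarith
      gcongr)
  have e1 : ∀ s : ℝ, ∫ z : ℝ × ℝ, (Real.exp (-(s * (μ * (z.1 + z.2)))) : ℂ) *
      (ψ (z.1 + z.2) * (D m 0 v z.1 * D n 0 u z.2)) ∂(volume.prod volume) =
      Bil ψ (D n (s * μ) u) (D m (s * μ) v) := by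
    intro s
    rw [Bil_prod hψ (hu.D _ _).adm (hv.D _ _).adm, Measure.volume_eq_prod]
    congr 1; ext z
    have : Real.exp (-(s * (μ * (z.1 + z.2)))) = Real.exp (-(s * μ * z.1)) * Real.exp (-(s * μ * z.2)) := by
      rw [← Real.exp_add]; congr 1; ring
    rw [this]
    simp only [D, zero_mul, neg_zero, Real.exp_zero, mul_one]
    push_cast; ring
  simp only [e1] at e
  rw [← e, ← integral_const_mul, Measure.volume_eq_prod]
  congr 1; ext z
  by_cases h1 : v z.1 = 0
  · simp [D, h1]
  by_cases h2 : u z.2 = 0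
  · simp [D, h2]
  have h3 := (hL _ h2).1
  have h4 := (hL' _ h1).1
  have hc : 0 < z.1 + z.2 := by linarith
  rw [← hr _ hc]
  have : (μ ^ (j + 1) / j.factorial * (j.factorial / (μ * (z.1 + z.2)) ^ (j + 1)) * (z.1 + z.2) ^ (j + 1) : ℝ) = 1 := by
    have : (j.factorial : ℝ) ≠ 0 := by positivity
    field_simp
    rw [← mul_pow]
  have h := congrArg (fun x : ℝ => (x : ℂ)) this
  push_cast at h ⊢
  linear_combination -(φ (z.1 + z.2) * (D m 0 v z.1 * D n 0 u z.2)) * h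

/-- interior case -/
theorem interior (m n : ℕ) (φ : 𝓢(ℝ, ℂ)) {M : ℝ} (hM : ∀ x, ‖𝓕 (mx (m + 1 + (n + 1)) φ : ℝ → ℂ) x‖ ≤ M)
    {u v : ℝ → ℂ} (hu : Nice u) (hv : Nice v) :
    ‖Bil φ (D (n + 1) 0 u) (D (m + 1) 0 v)‖ ≤
      ((2 * n + 1).factorial * (2 * m + 1).factorial) * M * (Real.sqrt (Q u) * Real.sqrt (Q v)) := by
  have hM0 : 0 ≤ M := (norm_nonneg _).trans (hM 0)
  rw [superBil (m + n + 1) (m + 1) (n + 1) one_pos (adm_schwartz φ) (adm_schwartz (mx (m + 1 + (n + 1)) φ)) hu hv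
    (fun c hc => by rw [mx_apply]; congr 2; ring)]
  obtain ⟨iu, eu⟩ := energy n one_pos hu
  obtain ⟨iv, ev⟩ := energy m one_pos hv
  rw [norm_mul, Complex.norm_real, Real.norm_of_nonneg (by positivity), one_pow]
  have f1 : (1:ℝ) / (m + n + 1).factorial ≤ 1 := by
    rw [div_le_one (by positivity)]
    exact_mod_cast Nat.factorial_pos _
  refine (mul_le_of_le_one_left (norm_nonneg _) f1).trans ?_
  refine (norm_integral_le_integral_norm _).trans ?_
  have key : ∀ t : ℝ, 0 < t → ∫ s in Set.Ioi (0:ℝ), ‖(s : ℂ) ^ (m + n + 1) *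
      Bil (mx (m + 1 + (n + 1)) φ) (D (n + 1) (s * 1) u) (D (m + 1) (s * 1) v)‖ ≤
      (t * (M * ((2 * n + 1).factorial / (2 * 1) ^ (2 * n + 2) * Q u)) +
      t⁻¹ * (M * ((2 * m + 1).factorial / (2 * 1) ^ (2 * m + 2) * Q v))) / 2 := by
    intro t ht
    rw [← eu, ← ev, ← integral_const_mul, ← integral_const_mul, ← integral_const_mul, ← integral_const_mul,
      ← integral_add ((iu.const_mul _).const_mul _) ((iv.const_mul _).const_mul _), ← integral_div]
    refine integral_mono_of_nonneg (.of_forall fun _ => norm_nonneg _)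
      ((((iu.const_mul _).const_mul _).add ((iv.const_mul _).const_mul _)).div_const _) ?_
    filter_upwards [ae_restrict_mem measurableSet_Ioi] with s hs
    have hs : 0 < s := hs
    rw [norm_mul, norm_pow, Complex.norm_real, Real.norm_of_nonneg hs.le]
    have b := Bil_le' (adm_schwartz (mx (m + 1 + (n + 1)) φ)) (hu.D (n + 1) (s * 1)).adm (hv.D (m + 1) (s * 1)).adm hM
    have a := amgm (s ^ n * Real.sqrt (Q (D (n + 1) (s * 1) u))) (s ^ m * Real.sqrt (Q (D (m + 1) (s * 1) v))) t ht
    rw [mul_pow, mul_pow, Real.sq_sqrt (Q_nonneg _), Real.sq_sqrt (Q_nonneg _)] at a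
    calc _ ≤ s ^ (m + n + 1) * (M * (Real.sqrt (Q (D (n + 1) (s * 1) u)) * Real.sqrt (Q (D (m + 1) (s * 1) v)))) := by gcongr
      _ = (s * M) * ((s ^ n * Real.sqrt (Q (D (n + 1) (s * 1) u))) * (s ^ m * Real.sqrt (Q (D (m + 1) (s * 1) v)))) := by ring
      _ ≤ (s * M) * _ := mul_le_mul_of_nonneg_left a (by positivity)
      _ = _ := by ring
  have q1 := Q_nonneg u
  have q2 := Q_nonneg v
  refine (of_forall_t (by positivity) (by positivity) key).trans ?_
  have g : ∀ k : ℕ, ∀ q : ℝ, 0 ≤ q → Real.sqrt (M * ((2 * k + 1).factorial / (2 * 1) ^ (2 * k + 2) * q)) ≤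
      Real.sqrt M * ((2 * k + 1).factorial * Real.sqrt q) := by
    intro k q hq
    rw [Real.sqrt_mul hM0, Real.sqrt_mul (by positivity)]
    gcongr
    have h1 : (1:ℝ) ≤ (2 * k + 1).factorial := by exact_mod_cast Nat.factorial_pos _
    rw [Real.sqrt_le_left (by positivity)]
    have h2 : (1:ℝ) ≤ (2 * 1) ^ (2 * k + 2) := one_le_pow₀ (by norm_num)
    calc _ ≤ ((2 * k + 1).factorial : ℝ) := div_le_self (by positivity) h2
      _ ≤ _ := by nlinarith
  calc _ ≤ (Real.sqrt M * ((2 * n + 1).factorial * Real.sqrt (Q u))) * (Real.sqrt M * ((2 * m + 1).factorial * Real.sqrt (Q v))) :=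
        mul_le_mul (g n _ q1) (g m _ q2) (Real.sqrt_nonneg _) (by positivity)
    _ = ((2 * n + 1).factorial * (2 * m + 1).factorial) * (Real.sqrt M * Real.sqrt M) * (Real.sqrt (Q u) * Real.sqrt (Q v)) := by ring
    _ = _ := by rw [Real.mul_self_sqrt hM0]

end Comm
end

section
open MeasureTheory Complex
open scoped ENNReal NNReal
open FourierTransform SchwartzMap

namespace Comm

noncomputable def E (s : ℝ) (Φ : ℝ → ℂ) (c : ℝ) : ℂ := (Real.exp (-(s * |c|)) : ℂ) * Φ c

noncomputable def X (Φ : ℝ → ℂ) (n : ℕ) (u : ℝ → ℂ) (s a : ℝ) : ℂ := H (E s Φ) (D n s u) a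

theorem Adm.E {Φ : ℝ → ℂ} (h : Adm Φ) {s : ℝ} (hs : 0 ≤ s) : Adm (E s Φ) := by
  refine h.mul (q := fun c => (Real.exp (-(s * |c|)) : ℂ)) (K := 1) (by fun_prop) ?_
  intro x
  rw [Complex.norm_real, Real.norm_of_nonneg (by positivity), Real.exp_le_one_iff]
  have : 0 ≤ s * |x| := by positivity
  linarith

theorem X_meas {Φ u : ℝ → ℂ} (h : Adm Φ) (hu : Nice u) (n : ℕ) :
    StronglyMeasurable (fun p : ℝ × ℝ => X Φ n u p.1 p.2) := by
  have h1 := h.meas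
  have h2 := hu.meas
  have : StronglyMeasurable (Function.uncurry fun (p : ℝ × ℝ) (b : ℝ) => Comm.E p.1 Φ (p.2 + b) * D n p.1 u b) := by
    apply Measurable.stronglyMeasurable
    unfold Comm.E D Function.uncurry
    fun_prop
  exact this.integral_prod_right

theorem X_bound {Φ u : ℝ → ℂ} (h : Adm Φ) (hu : Nice u) (n : ℕ) {δ : ℝ} (hδ : ∀ x, u x ≠ 0 → δ ≤ x)
    {s : ℝ} (hs : 0 ≤ s) (a : ℝ) :
    ‖X Φ n u s a‖ ≤ Real.exp (-(s * δ)) * ‖H (fun x => (‖Φ x‖ : ℂ)) (fun x => (‖D n 0 u x‖ : ℂ)) a‖ := by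
  have e : H (fun x => (‖Φ x‖ : ℂ)) (fun x => (‖D n 0 u x‖ : ℂ)) a = ((∫ b, ‖Φ (a + b)‖ * ‖D n 0 u b‖ : ℝ) : ℂ) := by
    unfold H
    rw [← integral_complex_ofReal]
    congr 1; ext b; push_cast; ring
  have hi : Integrable (fun b => ‖Φ (a + b)‖ * ‖D n 0 u b‖) := by
    have := (h.H_int (hu.D n 0).adm a).norm
    simpa using this
  rw [e, Complex.norm_real, Real.norm_of_nonneg (integral_nonneg fun _ => by positivity), ← integral_const_mul]
  unfold X H
  refine norm_integral_le_of_norm_le (hi.const_mul _) (.of_forall fun b => ?_)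
  by_cases hb : u b = 0
  · simp [D, hb]
  have hb := hδ b hb
  unfold Comm.E D
  simp only [norm_mul, Complex.norm_real, Real.norm_eq_abs, abs_mul, Real.abs_exp, zero_mul, neg_zero, Real.exp_zero, mul_one]
  have e1 : Real.exp (-(s * |a + b|)) ≤ 1 := by
    rw [Real.exp_le_one_iff]
    have : 0 ≤ s * |a + b| := by positivity
    linarith
  have e2 : Real.exp (-(s * b)) ≤ Real.exp (-(s * δ)) := by
    gcongr
  calc _ = Real.exp (-(s * |a + b|)) * Real.exp (-(s * b)) * (‖Φ (a + b)‖ * (|b ^ n| * ‖u b‖)) := by ring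
    _ ≤ 1 * Real.exp (-(s * δ)) * (‖Φ (a + b)‖ * (|b ^ n| * ‖u b‖)) := by gcongr
    _ = _ := by ring

theorem XX_int {Φ Ψ u : ℝ → ℂ} (h : Adm Φ) (h' : Adm Ψ) (hu : Nice u) (n m : ℕ) :
    Integrable (fun p : ℝ × ℝ => (p.1 : ℂ) * (X Φ n u p.1 p.2 * starRingEnd ℂ (X Ψ m u p.1 p.2)))
      ((volume.restrict (Set.Ioi 0)).prod volume) := by
  obtain ⟨δ, hδ, L, hL⟩ := hu.supp
  have hL : ∀ x, u x ≠ 0 → δ ≤ x := fun x hx => (hL x hx).1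
  have a1 := (h.norm.H (hu.D n 0).adm.norm)
  have a2 := (h'.norm.H (hu.D m 0).adm.norm)
  have ai := a1.memLp.integrable_mul a2.memLp
  have hd := (integrable_pow_exp 1 (L := 2 * δ) (by positivity)).mul_prod ai.norm
  refine hd.mono' ?_ ?_
  · have m1 := (X_meas h hu n).measurable
    have m2 := (X_meas h' hu m).measurable
    refine Measurable.aestronglyMeasurable ?_
    have : Measurable fun p : ℝ × ℝ => (p.1 : ℂ) := by fun_prop
    exact this.mul (m1.mul (Complex.continuous_conj.measurable.comp m2))
  · have : ∀ᵐ p ∂((volume.restrict (Set.Ioi (0:ℝ))).prod (volume : Measure ℝ)), p.1 ∈ Set.Ioi (0:ℝ) :=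
      Measure.quasiMeasurePreserving_fst.ae (ae_restrict_mem measurableSet_Ioi)
    filter_upwards [this] with p hp
    have hp : 0 < p.1 := hp
    have b1 := X_bound h hu n hL hp.le p.2
    have b2 := X_bound h' hu m hL hp.le p.2
    simp only [norm_mul, RCLike.norm_conj, Complex.norm_real, Real.norm_of_nonneg hp.le, Pi.mul_apply, pow_one]
    have ee : Real.exp (-(p.1 * (2 * δ))) = Real.exp (-(p.1 * δ)) * Real.exp (-(p.1 * δ)) := by
      rw [← Real.exp_add]; congr 1; ring
    rw [ee]
    refine (mul_le_mul_of_nonneg_left (mul_le_mul b1 b2 (norm_nonneg _) (by positivity)) hp.le).trans (le_of_eq ?_)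
    ring

noncomputable def R (φ : 𝓢(ℝ, ℂ)) (c : ℝ) : ℂ := (if 0 < c then 2 else 0) * mx 1 φ c

theorem R_eq (φ : 𝓢(ℝ, ℂ)) (c : ℝ) : R φ c = ((c + |c| : ℝ) : ℂ) * φ c := by
  unfold R
  rw [mx_apply]
  split_ifs with h
  · rw [abs_of_pos h]; push_cast; ring
  · rw [abs_of_nonpos (not_lt.1 h)]; simp

theorem adm_R (φ : 𝓢(ℝ, ℂ)) : Adm (R φ) := by
  refine (adm_schwartz (mx 1 φ)).mul (q := fun c => if 0 < c then 2 else 0) (K := 2) ?_ ?_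
  · exact Measurable.ite measurableSet_Ioi measurable_const measurable_const
  · intro x; split_ifs <;> simp

theorem pw (φ : 𝓢(ℝ, ℂ)) {u : ℝ → ℂ} (hu : Nice u) (a : ℝ)
    (i1 : IntegrableOn (fun s : ℝ => (s : ℂ) * (X (R φ) 0 u s a * starRingEnd ℂ (X (R φ) 0 u s a))) (Set.Ioi 0))
    (i2 : IntegrableOn (fun s : ℝ => (s : ℂ) * (X (R φ) 1 u s a * starRingEnd ℂ (X φ 0 u s a))) (Set.Ioi 0)) :
    (∫ s in Set.Ioi (0:ℝ), (s : ℂ) * (X (R φ) 0 u s a * starRingEnd ℂ (X (R φ) 0 u s a))).re +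
    4 * (∫ s in Set.Ioi (0:ℝ), (s : ℂ) * (X (R φ) 1 u s a * starRingEnd ℂ (X φ 0 u s a))).re ≤
    ‖H φ u a‖ ^ 2 := by
  set κ : ℝ → ℂ := fun b => φ (a + b) * u b with hκ
  have hκn : Nice κ := hu.mul (q := fun b => φ (a + b)) (by have := φ.continuous; fun_prop)
  -- weights
  set κr : ℝ → ℂ := fun b => ((a + b + |a + b| : ℝ) : ℂ) * κ b with hκr
  set κm : ℝ → ℂ := fun b => ((|a + b| + b - a : ℝ) : ℂ) * κ b with hκm
  set κc : ℝ → ℂ := fun b => ((b * (a + b + |a + b|) : ℝ) : ℂ) * κ b with hκc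
  have nr : Nice κr := hκn.mul (q := fun b => ((a + b + |a + b| : ℝ) : ℂ)) (by fun_prop)
  have nm : Nice κm := hκn.mul (q := fun b => ((|a + b| + b - a : ℝ) : ℂ)) (by fun_prop)
  have nc : Nice κc := hκn.mul (q := fun b => ((b * (a + b + |a + b|) : ℝ) : ℂ)) (by fun_prop)
  set w : ℝ → ℝ → ℂ := fun s b => ((Real.exp (-(s * (|a + b| + b))) : ℝ) : ℂ) with hw
  have wr : ∀ (v : ℝ → ℂ), Nice v → ∀ s, Integrable (fun b => w s b * v b) := fun v hv s =>
    (hv.mul (q := w s) (by simp only [hw]; fun_prop)).adm.int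
  have conjI : ∀ v : ℝ → ℂ, Integrable v → Integrable (fun b => starRingEnd ℂ (v b)) := fun v hv =>
    Complex.conjCLE.toContinuousLinearMap.integrable_comp hv
  have prodI : ∀ v v' : ℝ → ℂ, Integrable v → Integrable v' →
      Integrable (fun z : ℝ × ℝ => v z.1 * starRingEnd ℂ (v' z.2)) (volume.prod volume) := fun v v' hv hv' =>
    hv.mul_prod (conjI v' hv')
  have prodE : ∀ v v' : ℝ → ℂ, 
      ∫ z : ℝ × ℝ, v z.1 * starRingEnd ℂ (v' z.2) ∂(volume.prod volume) = (∫ b, v b) * starRingEnd ℂ (∫ b, v' b) := by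
    intro v v'
    rw [integral_prod_mul v (fun b => starRingEnd ℂ (v' b)), integral_conj]
  set Λ : ℝ × ℝ → ℝ := fun z => (|a + z.1| + z.1) + (|a + z.2| + z.2) with hΛ
  set K : ℝ × ℝ → ℂ := fun z => ((Λ z ^ 2 : ℝ) : ℂ) * (κ z.1 * starRingEnd ℂ (κ z.2)) with hK
  have Keq : ∀ z, K z = κr z.1 * starRingEnd ℂ (κr z.2) + κm z.1 * starRingEnd ℂ (κm z.2) +
      2 * (κc z.1 * starRingEnd ℂ (κ z.2)) + 2 * (κ z.1 * starRingEnd ℂ (κc z.2)) := by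
    intro z
    have q1 : (|a + z.1| + z.1) ^ 2 = a ^ 2 + 2 * z.1 * (a + z.1 + |a + z.1|) := by
      have := sq_abs (a + z.1); nlinarith
    have q2 : (|a + z.2| + z.2) ^ 2 = a ^ 2 + 2 * z.2 * (a + z.2 + |a + z.2|) := by
      have := sq_abs (a + z.2); nlinarith
    have q : Λ z ^ 2 = (a + z.1 + |a + z.1|) * (a + z.2 + |a + z.2|) + (|a + z.1| + z.1 - a) * (|a + z.2| + z.2 - a)
      + 2 * (z.1 * (a + z.1 + |a + z.1|)) + 2 * (z.2 * (a + z.2 + |a + z.2|)) := by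
      simp only [hΛ]; linear_combination q1 + q2
    simp only [hK, q, hκr, hκm, hκc, map_mul, Complex.conj_ofReal]
    push_cast; ring
  have KI : Integrable K (volume.prod volume) := by
    have := (((prodI _ _ nr.adm.int nr.adm.int).add (prodI _ _ nm.adm.int nm.adm.int)).add
      ((prodI _ _ nc.adm.int hκn.adm.int).const_mul 2)).add ((prodI _ _ hκn.adm.int nc.adm.int).const_mul 2)
    exact this.congr (.of_forall fun z => (Keq z).symm)
  obtain ⟨δ, hδ, L, hL⟩ := hκn.supp
  have hs : ∀ z, K z ≠ 0 → δ ≤ Λ z := by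
    intro z hz
    have h1 := right_ne_zero_of_mul hz
    have h2 := (hL _ (left_ne_zero_of_mul h1)).1
    have h3 := (hL z.2 (by intro h0; simp [h0] at h1)).1
    have := abs_nonneg (a + z.1)
    have := abs_nonneg (a + z.2)
    simp only [hΛ]; linarith
  have hΛm : Measurable Λ := by simp only [hΛ]; fun_prop
  have e := superpos 1 KI hΛm hδ hs
  have ei := superpos_int 1 KI hΛm hδ hs
  have XA : ∀ s, X (R φ) 0 u s a = ∫ b, w s b * κr b := by
    intro s
    unfold X H
    congr 1; ext b
    simp only [E, R_eq, D, hw, hκr, hκ, pow_zero, one_mul, mul_add, neg_add, Real.exp_add]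
    push_cast; ring
  have XC : ∀ s, X (R φ) 1 u s a = ∫ b, w s b * κc b := by
    intro s
    unfold X H
    congr 1; ext b
    simp only [E, R_eq, D, hw, hκc, hκ, pow_one, mul_add, neg_add, Real.exp_add]
    push_cast; ring
  have XW : ∀ s, X φ 0 u s a = ∫ b, w s b * κ b := by
    intro s
    unfold X H
    congr 1; ext b
    simp only [E, D, hw, hκ, pow_zero, one_mul, mul_add, neg_add, Real.exp_add]
    push_cast; ring
  have inner : ∀ s, ∫ z, (Real.exp (-(s * Λ z)) : ℂ) * K z ∂(volume.prod volume) =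
      X (R φ) 0 u s a * starRingEnd ℂ (X (R φ) 0 u s a) +
      (∫ b, w s b * κm b) * starRingEnd ℂ (∫ b, w s b * κm b) +
      2 * (X (R φ) 1 u s a * starRingEnd ℂ (X φ 0 u s a)) +
      2 * (X φ 0 u s a * starRingEnd ℂ (X (R φ) 1 u s a)) := by
    intro s
    rw [XA, XC, XW, ← prodE, ← prodE, ← prodE, ← prodE, ← integral_const_mul, ← integral_const_mul,
      ← integral_add, ← integral_add, ← integral_add]
    · congr 1; ext z
      rw [Keq]
      simp only [hw, map_mul, Complex.conj_ofReal, hΛ, mul_add, neg_add, Real.exp_add]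
      push_cast; ring
    · exact ((prodI _ _ (wr _ nr s) (wr _ nr s)).add (prodI _ _ (wr _ nm s) (wr _ nm s))).add
        ((prodI _ _ (wr _ nc s) (wr _ hκn s)).const_mul 2)
    · exact (prodI _ _ (wr _ hκn s) (wr _ nc s)).const_mul 2
    · exact ((prodI _ _ (wr _ nr s) (wr _ nr s)).add (prodI _ _ (wr _ nm s) (wr _ nm s)))
    · exact (prodI _ _ (wr _ nc s) (wr _ hκn s)).const_mul 2
    · exact (prodI _ _ (wr _ nr s) (wr _ nr s))
    · exact (prodI _ _ (wr _ nm s) (wr _ nm s))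
  have lhs : ∫ z, ((Nat.factorial 1 / Λ z ^ (1 + 1) : ℝ) : ℂ) * K z ∂(volume.prod volume) =
      ((‖H φ u a‖ ^ 2 : ℝ) : ℂ) := by
    have : ((‖H φ u a‖ ^ 2 : ℝ) : ℂ) = (∫ b, κ b) * starRingEnd ℂ (∫ b, κ b) := by
      rw [Complex.mul_conj, Complex.normSq_eq_norm_sq]; rfl
    rw [this, ← prodE]
    congr 1; ext z
    by_cases hz : κ z.1 * starRingEnd ℂ (κ z.2) = 0
    · simp only [hK, hz, mul_zero]
    have h2 := (hL _ (left_ne_zero_of_mul hz)).1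
    have h3 := (hL z.2 (by intro h0; simp [h0] at hz)).1
    have hp : 0 < Λ z := by
      have := abs_nonneg (a + z.1)
      have := abs_nonneg (a + z.2)
      simp only [hΛ]; linarith
    simp only [hK]
    rw [← mul_assoc, ← ofReal_mul]
    have : ((Nat.factorial 1 : ℝ) / Λ z ^ (1 + 1) * Λ z ^ 2) = 1 := by
      simp; field_simp
    rw [this]; simp
  have iF : IntegrableOn (fun s : ℝ => (s : ℂ) * ∫ z, (Real.exp (-(s * Λ z)) : ℂ) * K z ∂(volume.prod volume)) (Set.Ioi 0) := by
    have := ei.integral_prod_left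
    refine this.congr (.of_forall fun s => ?_)
    simp only [ofReal_mul, mul_assoc, integral_const_mul, pow_one]
  rw [lhs] at e
  have e' := congrArg Complex.re e
  rw [ofReal_re] at e'
  rw [e']
  simp only [pow_one]
  have re_int : ∀ F : ℝ → ℂ, IntegrableOn F (Set.Ioi 0) → (∫ s in Set.Ioi (0:ℝ), F s).re = ∫ s in Set.Ioi (0:ℝ), (F s).re := by
    intro F hF
    exact (integral_re hF).symm
  have r1 : IntegrableOn (fun s : ℝ => ((s : ℂ) * (X (R φ) 0 u s a * starRingEnd ℂ (X (R φ) 0 u s a))).re) (Set.Ioi 0) := i1.re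
  have r2 : IntegrableOn (fun s : ℝ => ((s : ℂ) * (X (R φ) 1 u s a * starRingEnd ℂ (X φ 0 u s a))).re) (Set.Ioi 0) := i2.re
  rw [re_int _ i1, re_int _ i2, re_int _ iF, ← integral_const_mul, ← integral_add r1 (r2.const_mul 4)]
  refine setIntegral_mono_on (r1.add (r2.const_mul 4)) iF.re measurableSet_Ioi ?_
  intro s hs
  have hs : 0 < s := hs
  rw [inner s]
  simp only [RCLike.re_to_complex, Complex.re_ofReal_mul, add_re, Complex.mul_conj, ofReal_re]
  have n0 := Complex.normSq_nonneg (∫ b, w s b * κm b)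
  have s1 : (2 * (X (R φ) 1 u s a * starRingEnd ℂ (X φ 0 u s a))).re = 2 * (X (R φ) 1 u s a * starRingEnd ℂ (X φ 0 u s a)).re := by
    simp
  have s2 : (2 * (X φ 0 u s a * starRingEnd ℂ (X (R φ) 1 u s a))).re = 2 * (X (R φ) 1 u s a * starRingEnd ℂ (X φ 0 u s a)).re := by
    simp; ring
  rw [s1, s2]
  nlinarith [mul_nonneg hs.le n0]

theorem carleson (φ : 𝓢(ℝ, ℂ)) {M : ℝ} (hM : ∀ x, ‖𝓕 (φ : ℝ → ℂ) x‖ ≤ M) {u : ℝ → ℂ} (hu : Nice u) :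
    IntegrableOn (fun s => s * Q (X (R φ) 0 u s)) (Set.Ioi 0) ∧
    ∫ s in Set.Ioi (0:ℝ), s * Q (X (R φ) 0 u s) ≤ 6 * M ^ 2 * Q u := by
  have aR := adm_R φ
  have aφ := adm_schwartz φ
  have F1 := XX_int aR aR hu 0 0
  have F2 := XX_int aR aφ hu 1 0
  have QA : ∀ s : ℝ, ∫ a, (s : ℂ) * (X (R φ) 0 u s a * starRingEnd ℂ (X (R φ) 0 u s a)) =
      ((s * Q (X (R φ) 0 u s) : ℝ) : ℂ) := by
    intro s
    unfold Q
    rw [← integral_const_mul, ← integral_complex_ofReal]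
    congr 1; ext a
    rw [Complex.mul_conj, Complex.normSq_eq_norm_sq]; push_cast; ring
  have hi : IntegrableOn (fun s => s * Q (X (R φ) 0 u s)) (Set.Ioi 0) := by
    have := F1.integral_prod_left.re
    refine this.congr (.of_forall fun s => ?_)
    simp only [QA]
    exact ofReal_re _
  refine ⟨hi, ?_⟩
  have sw1 := integral_integral_swap (f := fun (s : ℝ) (a : ℝ) =>
    (s : ℂ) * (X (R φ) 0 u s a * starRingEnd ℂ (X (R φ) 0 u s a))) F1
  have sw2 := integral_integral_swap (f := fun (s : ℝ) (a : ℝ) =>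
    (s : ℂ) * (X (R φ) 1 u s a * starRingEnd ℂ (X φ 0 u s a))) F2
  simp only [QA] at sw1
  rw [integral_complex_ofReal] at sw1
  have re1 := congrArg Complex.re sw1
  rw [ofReal_re] at re1
  have p1 := F1.integral_prod_right
  have p2 := F2.integral_prod_right
  have rint : ∀ G : ℝ → ℂ, Integrable G → (∫ a, G a).re = ∫ a, (G a).re := fun G hG => (integral_re hG).symm
  have main : (∫ s in Set.Ioi (0:ℝ), s * Q (X (R φ) 0 u s)) +
      4 * (∫ s in Set.Ioi (0:ℝ), ∫ a, (s : ℂ) * (X (R φ) 1 u s a * starRingEnd ℂ (X φ 0 u s a))).re ≤ M ^ 2 * Q u := by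
    refine le_trans ?_ (Q_H_le aφ hu.adm hM)
    rw [re1, sw2, rint _ p1, rint _ p2, ← integral_const_mul]
    have r1 : Integrable (fun a : ℝ => (∫ s in Set.Ioi (0:ℝ), (s : ℂ) * (X (R φ) 0 u s a * starRingEnd ℂ (X (R φ) 0 u s a))).re) := p1.re
    have r2 : Integrable (fun a : ℝ => (∫ s in Set.Ioi (0:ℝ), (s : ℂ) * (X (R φ) 1 u s a * starRingEnd ℂ (X φ 0 u s a))).re) := p2.re
    rw [← integral_add r1 (r2.const_mul 4)]
    refine integral_mono_ae (r1.add (r2.const_mul 4)) (integrable_sq (aφ.H hu.adm).memLp) ?_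
    filter_upwards [F1.prod_left_ae, F2.prod_left_ae] with a h1 h2
    exact pw φ hu a h1 h2
  obtain ⟨iu, eu⟩ := energy 0 one_pos hu
  simp only [mul_one, mul_zero, zero_add, pow_one, Nat.factorial_one] at iu eu
  have bd : ‖∫ s in Set.Ioi (0:ℝ), ∫ a, (s : ℂ) * (X (R φ) 1 u s a * starRingEnd ℂ (X φ 0 u s a))‖ ≤
      (1/8) * (∫ s in Set.Ioi (0:ℝ), s * Q (X (R φ) 0 u s)) + 2 * M ^ 2 * (∫ s in Set.Ioi (0:ℝ), s * Q (D 1 s u)) := by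
    rw [← integral_const_mul, ← integral_const_mul, ← integral_add (hi.const_mul _) (iu.const_mul _)]
    refine norm_integral_le_of_norm_le ((hi.const_mul _).add (iu.const_mul _)) ?_
    filter_upwards [ae_restrict_mem measurableSet_Ioi] with s hs
    have hs : 0 < s := hs
    rw [integral_const_mul, norm_mul, Complex.norm_real, Real.norm_of_nonneg hs.le]
    have b := inner_H_le (aR.E hs.le) (aφ.E hs.le) (hu.D 1 s).adm (hu.D 0 s).adm
    have b2 : Q (H (E s φ) (D 1 s u)) ≤ M ^ 2 * Q (D 1 s u) :=
      Q_H_le (aφ.E hs.le) (hu.D 1 s).adm (poisson_bound φ hM hs.le)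
    set x := Real.sqrt (Q (H (E s (R φ)) (D 0 s u))) with hx
    set y := Real.sqrt (Q (H (E s φ) (D 1 s u))) with hy
    have hx2 : x ^ 2 = Q (X (R φ) 0 u s) := Real.sq_sqrt (Q_nonneg _)
    have hy2 : y ^ 2 = Q (H (E s φ) (D 1 s u)) := Real.sq_sqrt (Q_nonneg _)
    have : ‖∫ a, X (R φ) 1 u s a * starRingEnd ℂ (X φ 0 u s a)‖ ≤
        (1/8) * Q (X (R φ) 0 u s) + 2 * (M ^ 2 * Q (D 1 s u)) := by
      refine le_trans b ?_
      rw [← hx2]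
      nlinarith [sq_nonneg (x - 4 * y)]
    calc _ ≤ s * _ := mul_le_mul_of_nonneg_left this hs.le
      _ = _ := by ring
  have lo := (abs_le.1 ((Complex.abs_re_le_norm _).trans bd)).1
  rw [eu] at lo
  push_cast at lo
  linarith

/-- the edge case -/
theorem edge (φ : 𝓢(ℝ, ℂ)) {M : ℝ} (hM : ∀ x, ‖𝓕 (mx 1 φ : ℝ → ℂ) x‖ ≤ M)
    {u v : ℝ → ℂ} (hu : Nice u) (hv : Nice v) :
    ‖Bil φ (D 0 0 u) (D 1 0 v)‖ ≤ 6 * M * (Real.sqrt (Q u) * Real.sqrt (Q v)) := by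
  have hM0 : 0 ≤ M := (norm_nonneg _).trans (hM 0)
  rw [superBil 1 1 0 two_pos (adm_schwartz φ) (adm_schwartz (mx 2 φ)) hu hv
    (fun c hc => by rw [mx_apply])]
  obtain ⟨ia, ea⟩ := carleson (mx 1 φ) hM hu
  obtain ⟨iv, ev⟩ := energy 0 one_pos hv
  simp only [mul_one, mul_zero, zero_add, pow_one, Nat.factorial_one] at iv ev
  have id : ∀ s, 0 ≤ s → Bil (mx 2 φ) (D 0 (s * 2) u) (D 1 (s * 2) v) =
      2⁻¹ * Bil (E s (R (mx 1 φ))) (D 0 s u) (D 1 s v) := by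
    intro s hs
    rw [Bil_prod (adm_schwartz _) (hu.D _ _).adm (hv.D _ _).adm,
      Bil_prod ((adm_R _).E hs) (hu.D _ _).adm (hv.D _ _).adm, ← integral_const_mul]
    congr 1; ext z
    obtain ⟨δ, hδ, L, hL⟩ := hu.supp
    obtain ⟨δ', hδ', L', hL'⟩ := hv.supp
    by_cases h1 : v z.1 = 0
    · simp [D, h1]
    by_cases h2 : u z.2 = 0
    · simp [D, h2]
    have h3 := (hL _ h2).1
    have h4 := (hL' _ h1).1
    have hc : 0 < z.1 + z.2 := by linarith
    rw [mx_apply, E, R, if_pos hc, mx_apply, mx_apply, abs_of_pos hc]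
    unfold D
    have x1 : Real.exp (-(s * 2 * z.1)) = Real.exp (-(s * z.1)) * Real.exp (-(s * z.1)) := by
      rw [← Real.exp_add]; congr 1; ring
    have x2 : Real.exp (-(s * 2 * z.2)) = Real.exp (-(s * z.2)) * Real.exp (-(s * z.2)) := by
      rw [← Real.exp_add]; congr 1; ring
    rw [x1, x2, mul_add, neg_add, Real.exp_add]
    push_cast; ring
  have key : ∀ t : ℝ, 0 < t → ‖∫ s in Set.Ioi (0:ℝ), (s : ℂ) ^ 1 *
      Bil (mx 2 φ) (D 0 (s * 2) u) (D 1 (s * 2) v)‖ ≤ (t * (6 * M ^ 2 * Q u) + t⁻¹ * ((1/4) * Q v)) / 2 := by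
    intro t ht
    have : ‖∫ s in Set.Ioi (0:ℝ), (s : ℂ) ^ 1 * Bil (mx 2 φ) (D 0 (s * 2) u) (D 1 (s * 2) v)‖ ≤
      (t * (∫ s in Set.Ioi (0:ℝ), s * Q (X (R (mx 1 φ)) 0 u s)) + t⁻¹ * ∫ s in Set.Ioi (0:ℝ), s * Q (D 1 s v)) / 2 := by
      rw [← integral_const_mul, ← integral_const_mul, ← integral_add (ia.const_mul _) (iv.const_mul _), ← integral_div]
      refine norm_integral_le_of_norm_le (((ia.const_mul _).add (iv.const_mul _)).div_const _) ?_
      filter_upwards [ae_restrict_mem measurableSet_Ioi] with s hs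
      have hs : 0 < s := hs
      rw [id s hs.le, norm_mul, pow_one, Complex.norm_real, Real.norm_of_nonneg hs.le, norm_mul]
      have b := Bil_le ((adm_R (mx 1 φ)).E hs.le) (hu.D 0 s).adm (hv.D 1 s).adm
      have a := amgm (Real.sqrt (Q (X (R (mx 1 φ)) 0 u s))) (Real.sqrt (Q (D 1 s v))) t ht
      rw [Real.sq_sqrt (Q_nonneg _), Real.sq_sqrt (Q_nonneg _), mul_comm] at a
      have hh : ‖(2⁻¹ : ℂ)‖ ≤ 1 := by norm_num
      calc _ ≤ s * (1 * ‖Bil (E s (R (mx 1 φ))) (D 0 s u) (D 1 s v)‖) := by gcongr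
        _ ≤ s * (1 * ((t * Q (X (R (mx 1 φ)) 0 u s) + t⁻¹ * Q (D 1 s v)) / 2)) := by
          have := b.trans a
          gcongr
        _ = _ := by ring
    refine this.trans ?_
    rw [ev]
    have : t * (∫ s in Set.Ioi (0:ℝ), s * Q (X (R (mx 1 φ)) 0 u s)) ≤ t * (6 * M ^ 2 * Q u) := by gcongr
    norm_num at *
    linarith
  have q1 := Q_nonneg u
  have q2 := Q_nonneg v
  have k := of_forall_t (by positivity) (by positivity) key
  rw [norm_mul, Complex.norm_real]
  have g : Real.sqrt (6 * M ^ 2 * Q u) * Real.sqrt (1/4 * Q v) ≤ (3/2) * M * (Real.sqrt (Q u) * Real.sqrt (Q v)) := by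
    rw [Real.sqrt_mul (by positivity), Real.sqrt_mul (by positivity), Real.sqrt_mul (by positivity), Real.sqrt_sq hM0]
    have h6 : Real.sqrt 6 ≤ 3 := by rw [Real.sqrt_le_left] <;> norm_num
    have h4 : Real.sqrt (1/4) ≤ 1/2 := by rw [Real.sqrt_le_left] <;> norm_num
    calc _ ≤ 3 * M * Real.sqrt (Q u) * (1/2 * Real.sqrt (Q v)) := by gcongr
      _ = _ := by ring
  have := k.trans g
  norm_num at this ⊢
  linarith

end Comm
end

section
open MeasureTheory Complex
open scoped ENNReal NNReal
open FourierTransform SchwartzMap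

namespace Comm

theorem mx_mx (k l : ℕ) (φ : 𝓢(ℝ, ℂ)) : mx k (mx l φ) = mx (k + l) φ := by
  ext x
  rw [mx_apply, mx_apply, mx_apply]; ring

def Est (m n : ℕ) : Prop := ∃ C : ℝ, 0 ≤ C ∧ ∀ (φ : 𝓢(ℝ, ℂ)) (M : ℝ),
  (∀ x, ‖𝓕 (mx (m + n) φ : ℝ → ℂ) x‖ ≤ M) → ∀ u v : ℝ → ℂ, Nice u → Nice v →
  ‖Bil φ (D n 0 u) (D m 0 v)‖ ≤ C * M * (Real.sqrt (Q u) * Real.sqrt (Q v))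

theorem Bil_rec (m n : ℕ) (φ : 𝓢(ℝ, ℂ)) {u v : ℝ → ℂ} (hu : Nice u) (hv : Nice v) :
    Bil φ (D n 0 u) (D (m + 1) 0 v) + Bil φ (D (n + 1) 0 u) (D m 0 v) = Bil (mx 1 φ) (D n 0 u) (D m 0 v) := by
  have a := adm_schwartz φ
  have a' := adm_schwartz (mx 1 φ)
  rw [Bil_prod a (hu.D _ _).adm (hv.D _ _).adm, Bil_prod a (hu.D _ _).adm (hv.D _ _).adm,
    Bil_prod a' (hu.D _ _).adm (hv.D _ _).adm, Measure.volume_eq_prod, ← integral_add (Bil_int a (hu.D _ _).adm (hv.D _ _).adm)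
      (Bil_int a (hu.D _ _).adm (hv.D _ _).adm)]
  congr 1; ext z
  rw [mx_apply]
  simp only [D]; push_cast; ring

theorem Est.stepm {m n : ℕ} (h : Est m n) (h' : Est m (n + 1)) : Est (m + 1) n := by
  obtain ⟨C, hC, h⟩ := h
  obtain ⟨C', hC', h'⟩ := h'
  refine ⟨C + C', by positivity, fun φ M hM u v hu hv => ?_⟩
  have e := Bil_rec m n φ hu hv
  have b1 := h (mx 1 φ) M (by rw [mx_mx, show m + n + 1 = m + 1 + n by ring]; exact hM) u v hu hv
  have b2 := h' φ M (by rw [show m + (n + 1) = m + 1 + n by ring]; exact hM) u v hu hv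
  rw [eq_sub_of_add_eq e]
  refine (norm_sub_le _ _).trans ((add_le_add b1 b2).trans (le_of_eq ?_))
  ring

theorem Est.stepn {m n : ℕ} (h : Est m n) (h' : Est (m + 1) n) : Est m (n + 1) := by
  obtain ⟨C, hC, h⟩ := h
  obtain ⟨C', hC', h'⟩ := h'
  refine ⟨C + C', by positivity, fun φ M hM u v hu hv => ?_⟩
  have e := Bil_rec m n φ hu hv
  have b1 := h (mx 1 φ) M (by rw [mx_mx]; exact hM) u v hu hv
  have b2 := h' φ M (by rw [show m + 1 + n = m + (n + 1) by ring]; exact hM) u v hu hv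
  rw [eq_sub_of_add_eq' e]
  refine (norm_sub_le _ _).trans ((add_le_add b1 b2).trans (le_of_eq ?_))
  ring

theorem est_interior (m n : ℕ) : Est (m + 1) (n + 1) :=
  ⟨((2 * n + 1).factorial * (2 * m + 1).factorial), by positivity, fun φ M hM u v hu hv => interior m n φ hM hu hv⟩

theorem est_10 : Est 1 0 := ⟨6, by norm_num, fun φ M hM u v hu hv => edge φ hM hu hv⟩

theorem est_00 : Est 0 0 := by
  refine ⟨1, by norm_num, fun φ M hM u v hu hv => ?_⟩
  have d : ∀ w, D 0 0 w = w := by intro w; ext b; simp [D]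
  have e : mx 0 φ = φ := by ext x; simp [mx_apply]
  rw [d, d, one_mul]
  exact Bil_le' (adm_schwartz φ) hu.adm hv.adm (by simpa only [add_zero, e] using hM)

theorem est_m0 (m : ℕ) : Est m 0 := by
  induction m with
  | zero => exact est_00
  | succ m ih =>
    cases m with
    | zero => exact est_10
    | succ k => exact ih.stepm (est_interior k 0)

theorem est_all (m n : ℕ) : Est m n := by
  cases m with
  | succ m =>
    cases n with
    | zero => exact est_m0 _
    | succ n => exact est_interior m n
  | zero =>
    induction n with
    | zero => exact est_00
    | succ n ih =>
      refine ih.stepn ?_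
      cases n with
      | zero => exact est_10
      | succ k => exact est_interior 0 k

end Comm
end

section
open MeasureTheory Complex
open scoped ENNReal NNReal
open FourierTransform SchwartzMap

namespace Comm

noncomputable def tr (j : ℕ) (γ : ℝ → ℂ) : ℝ → ℂ := (Set.Icc (1 / ((j : ℝ) + 1)) ((j : ℝ) + 1)).indicator γ

theorem tr_nice (j : ℕ) {γ : ℝ → ℂ} (h : Adm γ) : Nice (tr j γ) := by
  obtain ⟨K, hK⟩ := h.bdd
  refine ⟨h.meas.indicator measurableSet_Icc, ⟨K, fun x => ?_⟩, 1 / ((j : ℝ) + 1), by positivity, j + 1, fun x hx => ?_⟩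
  · exact (norm_indicator_le_norm_self _ _).trans (hK x)
  · exact Set.mem_of_indicator_ne_zero (s := Set.Icc (1 / ((j : ℝ) + 1)) ((j : ℝ) + 1)) (f := γ) hx

theorem tr_tendsto (γ : ℝ → ℂ) (x : ℝ) (hx : 0 < x) : ∀ᶠ j in Filter.atTop, tr j γ x = γ x := by
  obtain ⟨N, hN⟩ := exists_nat_gt (max x (1 / x))
  filter_upwards [Filter.eventually_ge_atTop N] with j hj
  have hj' : (N : ℝ) ≤ j := by exact_mod_cast hj
  have h1 := (le_max_left x (1 / x)).trans hN.le
  have h2 := (le_max_right x (1 / x)).trans hN.le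
  have hm : x ∈ Set.Icc (1 / ((j : ℝ) + 1)) ((j : ℝ) + 1) := by
    refine ⟨?_, by linarith⟩
    rw [div_le_comm₀ (by positivity) hx]
    linarith
  exact Set.indicator_of_mem hm _

theorem tr_neg (j : ℕ) (γ : ℝ → ℂ) (x : ℝ) (hx : x ≤ 0) : tr j γ x = 0 := by
  refine Set.indicator_of_notMem (fun h => ?_) _
  have : 0 < 1 / ((j : ℝ) + 1) := by positivity
  linarith [h.1]

theorem Q_tr (j : ℕ) {γ : ℝ → ℂ} (h : Adm γ) : Q (tr j γ) ≤ Q γ := by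
  refine integral_mono (integrable_sq (tr_nice j h).adm.memLp) (integrable_sq h.memLp) (fun x => ?_)
  have := norm_indicator_le_norm_self (s := (Set.Icc (1 / ((j : ℝ) + 1)) ((j : ℝ) + 1))) γ x
  simp only
  gcongr
  exact this

noncomputable def G (m n : ℕ) (φ γ : ℝ → ℂ) (a : ℝ) : ℂ :=
  if 0 < a then (a : ℂ) ^ m * ∫ b in Set.Ioi (0:ℝ), φ (a + b) * ((b : ℂ) ^ n * γ b) else 0

theorem Hankel (m n : ℕ) : ∃ C : ℝ, 0 ≤ C ∧ ∀ (φ γ : 𝓢(ℝ, ℂ)) (M : ℝ),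
    (∀ x, ‖𝓕 (mx (m + n) φ : ℝ → ℂ) x‖ ≤ M) →
    eLpNorm (G m n φ γ) 2 volume ≤ ENNReal.ofReal (C * M) * eLpNorm γ 2 volume := by
  obtain ⟨C, hC, h⟩ := est_all m n
  refine ⟨C, hC, fun φ γ M hM => ?_⟩
  have hM0 : 0 ≤ M := (norm_nonneg _).trans (hM 0)
  have aφ := adm_schwartz φ
  have aγ := adm_schwartz γ
  set u : ℕ → ℝ → ℂ := fun j => tr j γ with hu
  have nu : ∀ j, Nice (u j) := fun j => tr_nice j aγ
  set w : ℕ → ℝ → ℂ := fun j a => (a : ℂ) ^ m * H φ (D n 0 (u j)) a with hw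
  set W : ℕ → ℝ → ℂ := fun j => tr j (w j) with hW
  have nW : ∀ j, Nice (W j) := by
    intro j
    have : W j = fun a : ℝ => (a : ℂ) ^ m * tr j (H φ (D n 0 (u j))) a := by
      ext a
      simp only [hW, tr, hw]
      by_cases ha : a ∈ Set.Icc (1 / ((j : ℝ) + 1)) ((j : ℝ) + 1)
      · rw [Set.indicator_of_mem ha, Set.indicator_of_mem ha]
      · rw [Set.indicator_of_notMem ha, Set.indicator_of_notMem ha, mul_zero]
    rw [this]
    exact (tr_nice j (aφ.H ((nu j).D n 0).adm)).mul (q := fun a => (a : ℂ) ^ m) (by fun_prop)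
  have QW : ∀ j, Q (W j) ≤ (C * M) ^ 2 * Q γ := by
    intro j
    set v : ℝ → ℂ := fun a => starRingEnd ℂ (W j a) with hv
    have nv : Nice v := by
      obtain ⟨K, hK⟩ := (nW j).bdd
      obtain ⟨δ, hδ, L, hL⟩ := (nW j).supp
      exact ⟨Complex.continuous_conj.measurable.comp (nW j).meas, ⟨K, fun x => by simpa [hv] using hK x⟩, δ, hδ, L,
        fun x hx => hL x (by intro h0; simp [hv, h0] at hx)⟩
    have Qv : Q v = Q (W j) := by simp [Q, hv]
    have e : Bil φ (D n 0 (u j)) (D m 0 v) = ((Q (W j) : ℝ) : ℂ) := by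
      unfold Bil Q
      rw [← integral_complex_ofReal]
      congr 1; ext a
      simp only [D, hv, hW, tr]
      by_cases ha : a ∈ Set.Icc (1 / ((j : ℝ) + 1)) ((j : ℝ) + 1)
      · rw [Set.indicator_of_mem ha, ofReal_pow, ← Complex.conj_mul']
        simp only [hw, D, zero_mul, neg_zero, Real.exp_zero]
        push_cast; ring
      · rw [Set.indicator_of_notMem ha]; simp
    have b := h φ M hM (u j) v (nu j) nv
    rw [e, Qv, Complex.norm_real, Real.norm_of_nonneg (Q_nonneg _)] at b
    have b2 := Q_tr j aγ
    have q0 := Q_nonneg (W j)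
    have q1 := Q_nonneg (u j)
    set x := Real.sqrt (Q (W j)) with hx
    have hx2 : x ^ 2 = Q (W j) := Real.sq_sqrt q0
    have hy2 : Real.sqrt (Q (u j)) ^ 2 = Q (u j) := Real.sq_sqrt q1
    have x0 : 0 ≤ x := Real.sqrt_nonneg _
    have y0 : 0 ≤ Real.sqrt (Q (u j)) := Real.sqrt_nonneg _
    have hxle : x ≤ C * M * Real.sqrt (Q (u j)) := by
      by_contra hlt
      push Not at hlt
      have : 0 ≤ C * M * Real.sqrt (Q (u j)) := by positivity
      nlinarith
    calc Q (W j) = x ^ 2 := hx2.symm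
      _ ≤ (C * M * Real.sqrt (Q (u j))) ^ 2 := by gcongr
      _ = (C * M) ^ 2 * Q (u j) := by rw [mul_pow, hy2]
      _ ≤ _ := by gcongr
  have lim : ∀ a, Filter.Tendsto (fun j => W j a) Filter.atTop (nhds (G m n φ γ a)) := by
    intro a
    by_cases ha : 0 < a
    · have t1 : Filter.Tendsto (fun j => w j a) Filter.atTop (nhds (G m n φ γ a)) := by
        rw [G, if_pos ha]
        refine Filter.Tendsto.const_mul _ ?_
        rw [← integral_indicator measurableSet_Ioi]
        have ai := (aφ.H_int (adm_schwartz (mx n γ)) a).norm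
        refine tendsto_integral_of_dominated_convergence _ (fun j => (aφ.H_int ((nu j).D n 0).adm a).1) ai ?_ ?_
        · intro j
          refine .of_forall fun b => ?_
          rw [norm_mul, norm_mul, mx_apply]
          gcongr
          simp only [D, zero_mul, neg_zero, Real.exp_zero, mul_one, norm_mul]
          push_cast
          gcongr
          exact norm_indicator_le_norm_self _ _
        · refine .of_forall fun b => ?_
          by_cases hb : 0 < b
          · rw [Set.indicator_of_mem (show b ∈ Set.Ioi (0:ℝ) from hb)]
            refine tendsto_const_nhds.congr' ?_
            filter_upwards [tr_tendsto γ b hb] with j hj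
            simp only [D, hu, hj, zero_mul, neg_zero, Real.exp_zero, mul_one]
            push_cast; ring
          · rw [Set.indicator_of_notMem (show b ∉ Set.Ioi (0:ℝ) from hb)]
            refine tendsto_const_nhds.congr ?_
            intro j
            simp only [D, hu, tr_neg j γ b (not_lt.1 hb), mul_zero]
      refine t1.congr' ?_
      filter_upwards [tr_tendsto (fun _ => 1) a ha] with j hj
      have : a ∈ Set.Icc (1 / ((j : ℝ) + 1)) ((j : ℝ) + 1) := by
        refine Set.mem_of_indicator_ne_zero (f := fun _ : ℝ => (1 : ℂ)) ?_
        rw [tr] at hj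
        rw [hj]; exact one_ne_zero
      exact (Set.indicator_of_mem this _).symm
    · rw [G, if_neg ha]
      refine tendsto_const_nhds.congr fun j => ?_
      exact (tr_neg j _ a (not_lt.1 ha)).symm
  refine (Lp.eLpNorm_lim_le_liminf_eLpNorm (fun j => (nW j).adm.int.1) _ (.of_forall lim)).trans ?_
  refine Filter.liminf_le_of_le (by isBoundedDefault) fun b hb => ?_
  obtain ⟨j, hj⟩ := hb.exists
  refine hj.trans ?_
  rw [Q_eLp (nW j).adm.memLp, Q_eLp aγ.memLp, ← ENNReal.ofReal_mul (by positivity)]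
  refine ENNReal.ofReal_le_ofReal ?_
  have := Real.sqrt_le_sqrt (QW j)
  rwa [Real.sqrt_mul (by positivity), Real.sqrt_sq (by positivity)] at this

end Comm
end

section
open MeasureTheory Complex
open scoped ENNReal NNReal
open FourierTransform SchwartzMap

namespace Comm

/-- sign kernel -/
noncomputable def kk (a b : ℝ) : ℂ :=
  (Set.Ioi (0:ℝ) ×ˢ Set.Ioi (0:ℝ)).indicator (fun _ => (1 : ℂ)) (a, b) -
  (Set.Iio (0:ℝ) ×ˢ Set.Iio (0:ℝ)).indicator (fun _ => (1 : ℂ)) (a, b)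

theorem kk_pos {a b : ℝ} (ha : 0 < a) (hb : 0 < b) : kk a b = 1 := by
  simp [kk, Set.indicator, ha, hb, ha.not_gt]

theorem kk_neg {a b : ℝ} (ha : a < 0) (hb : b < 0) : kk a b = -1 := by
  simp [kk, Set.indicator, ha, hb, ha.not_gt]

theorem kk_zero {a b : ℝ} (h1 : ¬ (0 < a ∧ 0 < b)) (h2 : ¬ (a < 0 ∧ b < 0)) : kk a b = 0 := by
  simp only [kk, Set.indicator, Set.mem_prod, Set.mem_Ioi, Set.mem_Iio, h1, h2, if_false, sub_zero]

theorem kk_meas : Measurable (fun z : ℝ × ℝ => kk z.1 z.2) := by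
  unfold kk
  exact (measurable_const.indicator (measurableSet_Ioi.prod measurableSet_Ioi)).sub
    (measurable_const.indicator (measurableSet_Iio.prod measurableSet_Iio))

theorem kk_cases (a b : ℝ) : (‖kk a b‖ = 1 ∧ 0 ≤ a * b) ∨ kk a b = 0 := by
  by_cases h1 : 0 < a ∧ 0 < b
  · left; rw [kk_pos h1.1 h1.2]; exact ⟨by simp, (mul_pos h1.1 h1.2).le⟩
  by_cases h2 : a < 0 ∧ b < 0
  · left; rw [kk_neg h2.1 h2.2]; exact ⟨by simp, (mul_pos_of_neg_of_neg h2.1 h2.2).le⟩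
  right; exact kk_zero h1 h2

theorem kk_bound (m : ℕ) (φ : 𝓢(ℝ, ℂ)) : ∃ K, 0 ≤ K ∧ ∀ a b : ℝ,
    |a| ^ m * ‖kk a b * φ (a + b)‖ ≤ K * ((1 + a ^ 2)⁻¹ * (1 + b ^ 2)⁻¹) := by
  obtain ⟨K0, h0⟩ := (adm_schwartz (mx m φ)).bdd
  obtain ⟨K2, h2⟩ := (adm_schwartz (mx (m + 2) φ)).bdd
  obtain ⟨K4, h4⟩ := (adm_schwartz (mx (m + 4) φ)).bdd
  have p0 : 0 ≤ K0 := (norm_nonneg _).trans (h0 0)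
  have p2 : 0 ≤ K2 := (norm_nonneg _).trans (h2 0)
  have p4 : 0 ≤ K4 := (norm_nonneg _).trans (h4 0)
  refine ⟨K0 + 2 * K2 + K4, by positivity, fun a b => ?_⟩
  rcases kk_cases a b with ⟨h, hab⟩ | h
  swap
  · rw [h]; simp; positivity
  rw [norm_mul, h, one_mul]
  have hc : |a| ≤ |a + b| := by
    apply sq_le_sq.1
    nlinarith [sq_nonneg b]
  have e0 := h0 (a + b)
  have e2 := h2 (a + b)
  have e4 := h4 (a + b)
  simp only [mx_apply, norm_mul, norm_pow, Complex.norm_real, Real.norm_eq_abs] at e0 e2 e4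
  have q2 : |a + b| ^ (m + 2) = |a + b| ^ m * (a + b) ^ 2 := by rw [pow_add, sq_abs]
  have q4 : |a + b| ^ (m + 4) = |a + b| ^ m * ((a + b) ^ 2) ^ 2 := by rw [pow_add, ← sq_abs (a + b)]; ring
  rw [q2] at e2
  rw [q4] at e4
  have hm : (1 + a ^ 2) * (1 + b ^ 2) ≤ (1 + (a + b) ^ 2) ^ 2 := by
    have h1 : a ^ 2 + b ^ 2 ≤ (a + b) ^ 2 := by nlinarith
    have h2 : (1 + a ^ 2) * (1 + b ^ 2) ≤ (1 + (a ^ 2 + b ^ 2)) ^ 2 := by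
      nlinarith [sq_nonneg a, sq_nonneg b, mul_nonneg (sq_nonneg a) (sq_nonneg b)]
    exact h2.trans (by gcongr)
  rw [← mul_inv, ← div_eq_mul_inv, le_div_iff₀ (by positivity)]
  have hx : |a| ^ m * ‖φ (a + b)‖ ≤ |a + b| ^ m * ‖φ (a + b)‖ := by gcongr
  calc _ ≤ (|a + b| ^ m * ‖φ (a + b)‖) * (1 + (a + b) ^ 2) ^ 2 := by gcongr
    _ = |a + b| ^ m * ‖φ (a + b)‖ + 2 * (|a + b| ^ m * (a + b) ^ 2 * ‖φ (a + b)‖) +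
        |a + b| ^ m * ((a + b) ^ 2) ^ 2 * ‖φ (a + b)‖ := by ring
    _ ≤ _ := by linarith

theorem kφ_meas (φ : 𝓢(ℝ, ℂ)) : Measurable (fun z : ℝ × ℝ => kk z.1 z.2 * φ (z.1 + z.2)) := by
  have := φ.continuous.measurable
  have := kk_meas
  exact this.mul (by fun_prop)

theorem kφ_int (φ : 𝓢(ℝ, ℂ)) :
    Integrable (fun z : ℝ × ℝ => kk z.1 z.2 * φ (z.1 + z.2)) (volume.prod volume) := by
  obtain ⟨K, hK, h⟩ := kk_bound 0 φ
  refine ((integrable_inv_one_add_sq.mul_prod integrable_inv_one_add_sq).const_mul K).mono'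
    (kφ_meas φ).aestronglyMeasurable (.of_forall fun z => ?_)
  simpa using h z.1 z.2

noncomputable def ex (x : ℝ) : ℂ := cexp (((-2 * Real.pi * x : ℝ) : ℂ) * I)

theorem ex_norm (x : ℝ) : ‖ex x‖ = 1 := by rw [ex, Complex.norm_exp_ofReal_mul_I]
theorem ex_add (x y : ℝ) : ex (x + y) = ex x * ex y := by
  rw [ex, ex, ex, ← Complex.exp_add]; congr 1; push_cast; ring
theorem ex_cont : Continuous ex := by unfold ex; fun_prop
theorem four_ex (f : ℝ → ℂ) (w : ℝ) : 𝓕 f w = ∫ v, ex (v * w) * f v := by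
  rw [Real.fourier_real_eq_integral_exp_smul]
  congr 1; ext v; rw [smul_eq_mul, ex]; congr 4; ring

theorem inner_kk (ξ α β : ℝ) (h : α ≠ β) :
    ∫ a, kk a (ξ - a) * ex (a * α + (ξ - a) * β) =
      (ex (ξ * α) - ex (ξ * β)) / ((-2 * Real.pi * I) * ((α - β : ℝ) : ℂ)) := by
  have hne : (-2 * Real.pi * I) * ((α - β : ℝ) : ℂ) ≠ 0 := by
    have : ((α - β : ℝ) : ℂ) ≠ 0 := by exact_mod_cast sub_ne_zero.2 h
    exact mul_ne_zero (by simp [Real.pi_ne_zero]) this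
  have e1 : ∫ a in (0:ℝ)..ξ, ex (a * α + (ξ - a) * β) =
      (ex (ξ * α) - ex (ξ * β)) / ((-2 * Real.pi * I) * ((α - β : ℝ) : ℂ)) := by
    have : ∀ a : ℝ, ex (a * α + (ξ - a) * β) = ex (ξ * β) * cexp (((-2 * Real.pi * I) * ((α - β : ℝ) : ℂ)) * a) := by
      intro a
      rw [ex, ex, ← Complex.exp_add]; congr 1; push_cast; ring
    simp only [this]
    rw [intervalIntegral.integral_const_mul, integral_exp_mul_complex hne, ← mul_div_assoc, mul_sub]
    congr 2
    · rw [ex, ex, ← Complex.exp_add]; congr 1; push_cast; ring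
    · simp
  rw [← e1]
  rcases le_total 0 ξ with hξ | hξ
  · rw [intervalIntegral.integral_of_le hξ, integral_Ioc_eq_integral_Ioo, ← integral_indicator measurableSet_Ioo]
    congr 1; ext a
    by_cases ha : a ∈ Set.Ioo 0 ξ
    · rw [Set.indicator_of_mem ha, kk_pos ha.1 (by linarith [ha.2]), one_mul]
    · rw [Set.indicator_of_notMem ha, kk_zero, zero_mul]
      · rintro ⟨h1, h2⟩; exact ha ⟨h1, by linarith⟩
      · rintro ⟨h1, h2⟩; linarith
  · rw [intervalIntegral.integral_of_ge hξ, integral_Ioc_eq_integral_Ioo, ← integral_indicator measurableSet_Ioo,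
      ← integral_neg]
    congr 1; ext a
    by_cases ha : a ∈ Set.Ioo ξ 0
    · rw [Set.indicator_of_mem ha, kk_neg ha.2 (by linarith [ha.1])]; ring
    · rw [Set.indicator_of_notMem ha, kk_zero, zero_mul, neg_zero]
      · rintro ⟨h1, h2⟩; linarith
      · rintro ⟨h1, h2⟩; exact ha ⟨by linarith, h1⟩

theorem slope_rep (φ : 𝓢(ℝ, ℂ)) (α β : ℝ) (h : α ≠ β) :
    (𝓕 (φ : ℝ → ℂ) α - 𝓕 (φ : ℝ → ℂ) β) / ((α - β : ℝ) : ℂ) =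
      (-2 * Real.pi * I) * ∫ z : ℝ × ℝ, (kk z.1 z.2 * φ (z.1 + z.2)) * ex (z.1 * α + z.2 * β) ∂(volume.prod volume) := by
  have hF : Integrable (fun z : ℝ × ℝ => (kk z.1 z.2 * φ (z.1 + z.2)) * ex (z.1 * α + z.2 * β)) (volume.prod volume) := by
    have := ex_cont
    exact (kφ_int φ).mul_bdd (c := 1) (by fun_prop) (.of_forall fun z => (ex_norm _).le)
  have hne : ((α - β : ℝ) : ℂ) ≠ 0 := by exact_mod_cast sub_ne_zero.2 h
  have hpi : (-2 * Real.pi * I : ℂ) ≠ 0 := by simp [Real.pi_ne_zero]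
  have mp := measurePreserving_prod_sub (volume : Measure ℝ) (volume : Measure ℝ)
  have hF' := mp.integrable_comp_of_integrable hF
  rw [integral_prod _ hF]
  have e1 : ∀ a : ℝ, ∫ b, (kk a b * φ (a + b)) * ex (a * α + b * β) =
      ∫ ξ, (kk a (ξ - a) * φ (a + (ξ - a))) * ex (a * α + (ξ - a) * β) := fun a =>
    (integral_sub_right_eq_self (fun b => (kk a b * φ (a + b)) * ex (a * α + b * β)) a).symm
  simp only [e1]
  rw [integral_integral_swap (f := fun a ξ : ℝ => (kk a (ξ - a) * φ (a + (ξ - a))) * ex (a * α + (ξ - a) * β)) hF']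
  have e2 : ∀ ξ : ℝ, ∫ a, (kk a (ξ - a) * φ (a + (ξ - a))) * ex (a * α + (ξ - a) * β) =
      ((-2 * Real.pi * I) * ((α - β : ℝ) : ℂ))⁻¹ * (ex (ξ * α) * φ ξ - ex (ξ * β) * φ ξ) := by
    intro ξ
    have : ∀ a : ℝ, (kk a (ξ - a) * φ (a + (ξ - a))) * ex (a * α + (ξ - a) * β) =
        φ ξ * (kk a (ξ - a) * ex (a * α + (ξ - a) * β)) := by
      intro a; rw [add_sub_cancel]; ring
    simp only [this]
    rw [integral_const_mul, inner_kk ξ α β h]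
    rw [div_eq_mul_inv]; ring
  simp only [e2]
  have ie : ∀ w : ℝ, Integrable (fun ξ => ex (ξ * w) * φ ξ) := fun w => by
    have := ex_cont
    exact φ.integrable.bdd_mul (c := 1) (by fun_prop) (.of_forall fun z => (ex_norm _).le)
  rw [integral_const_mul, integral_sub (ie α) (ie β), ← four_ex, ← four_ex]
  field_simp

noncomputable def τ (φ û : ℝ → ℂ) (a : ℝ) : ℂ := ∫ b, kk a b * φ (a + b) * û b

theorem T_rep (φ : 𝓢(ℝ, ℂ)) {u : ℝ → ℂ} (hu : Integrable u) (α : ℝ) :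
    ∫ β, (𝓕 (φ : ℝ → ℂ) α - 𝓕 (φ : ℝ → ℂ) β) / ((α - β : ℝ) : ℂ) * u β =
      (-2 * Real.pi * I) * 𝓕 (τ φ (𝓕 u)) α := by
  have hc := ex_cont
  have hI : Integrable (fun p : ℝ × (ℝ × ℝ) => u p.1 * (kk p.2.1 p.2.2 * φ (p.2.1 + p.2.2)) * ex (p.2.1 * α + p.2.2 * p.1))
      (volume.prod (volume.prod volume)) :=
    (hu.mul_prod (kφ_int φ)).mul_bdd (c := 1) (by fun_prop) (.of_forall fun z => (ex_norm _).le)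
  have ae : ∀ᵐ β : ℝ, β ≠ α := by
    rw [ae_iff]; simp
  have e1 : ∫ β, (𝓕 (φ : ℝ → ℂ) α - 𝓕 (φ : ℝ → ℂ) β) / ((α - β : ℝ) : ℂ) * u β =
      (-2 * Real.pi * I) * ∫ β, ∫ z : ℝ × ℝ, u β * (kk z.1 z.2 * φ (z.1 + z.2)) * ex (z.1 * α + z.2 * β) ∂(volume.prod volume) := by
    rw [← integral_const_mul]
    refine integral_congr_ae ?_
    filter_upwards [ae] with β hβ
    rw [slope_rep φ α β hβ.symm, mul_assoc, ← integral_mul_const]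
    congr 2; ext z; ring
  rw [e1, integral_integral_swap hI]
  congr 1
  have e2 : ∀ z : ℝ × ℝ, ∫ β, u β * (kk z.1 z.2 * φ (z.1 + z.2)) * ex (z.1 * α + z.2 * β) =
      ex (z.1 * α) * (kk z.1 z.2 * φ (z.1 + z.2) * 𝓕 u z.2) := by
    intro z
    rw [four_ex, ← integral_const_mul, ← integral_const_mul]
    congr 1; ext β
    rw [ex_add, mul_comm z.2 β]; ring
  simp only [e2]
  have hJ := hI.integral_prod_right
  simp only [e2] at hJ
  rw [integral_prod _ hJ, four_ex]
  congr 1; ext a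
  rw [τ, ← integral_const_mul]

theorem τ_adm (φ : 𝓢(ℝ, ℂ)) {û : ℝ → ℂ} (hû : Adm û) (m : ℕ) : Adm (fun a => (a : ℂ) ^ m * τ φ û a) := by
  obtain ⟨K, hK, h⟩ := kk_bound m φ
  have hm : Measurable (τ φ û) := by
    have : StronglyMeasurable (Function.uncurry fun a b : ℝ => kk a b * φ (a + b) * û b) :=
      Measurable.stronglyMeasurable ((kφ_meas φ).mul (hû.meas.comp measurable_snd))
    exact this.integral_prod_right.measurable
  have hmm : Measurable (fun a : ℝ => (a : ℂ) ^ m * τ φ û a) := by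
    have : Measurable (fun a : ℝ => (a : ℂ) ^ m) := by fun_prop
    exact this.mul hm
  have hb : ∀ a : ℝ, ‖(a : ℂ) ^ m * τ φ û a‖ ≤ (K * ∫ b, ‖û b‖) * (1 + a ^ 2)⁻¹ := by
    intro a
    rw [τ, ← integral_const_mul]
    have : (K * ∫ b, ‖û b‖) * (1 + a ^ 2)⁻¹ = ∫ b, (K * (1 + a ^ 2)⁻¹) * ‖û b‖ := by
      rw [integral_const_mul]; ring
    rw [this]
    refine norm_integral_le_of_norm_le (hû.int.norm.const_mul _) (.of_forall fun b => ?_)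
    rw [norm_mul, norm_mul _ (û b), ← mul_assoc, norm_pow, Complex.norm_real, Real.norm_eq_abs]
    refine mul_le_mul_of_nonneg_right ?_ (norm_nonneg _)
    refine (h a b).trans ?_
    have : (1 + b ^ 2)⁻¹ ≤ 1 := inv_le_one_of_one_le₀ (by nlinarith [sq_nonneg b])
    calc _ ≤ K * ((1 + a ^ 2)⁻¹ * 1) := by gcongr
      _ = _ := by ring
  refine ⟨hmm, (integrable_inv_one_add_sq.const_mul _).mono' hmm.aestronglyMeasurable (.of_forall hb),
    K * ∫ b, ‖û b‖, fun a => (hb a).trans ?_⟩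
  have : (1 + a ^ 2)⁻¹ ≤ 1 := inv_le_one_of_one_le₀ (by nlinarith [sq_nonneg a])
  have h0 : 0 ≤ K * ∫ b, ‖û b‖ := mul_nonneg hK (integral_nonneg fun _ => norm_nonneg _)
  exact mul_le_of_le_one_right h0 this

end Comm
end

section
open MeasureTheory Complex
open scoped ENNReal NNReal
open FourierTransform SchwartzMap

namespace Comm

noncomputable def rf (φ : 𝓢(ℝ, ℂ)) : 𝓢(ℝ, ℂ) :=
  compCLMOfContinuousLinearEquiv ℂ (ContinuousLinearEquiv.neg ℝ) φ

theorem rf_apply (φ : 𝓢(ℝ, ℂ)) (x : ℝ) : rf φ x = φ (-x) := rfl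

theorem fourier_rf (k : ℕ) (φ : 𝓢(ℝ, ℂ)) (x : ℝ) :
    ‖𝓕 (mx k (rf φ) : ℝ → ℂ) x‖ = ‖𝓕 (mx k φ : ℝ → ℂ) (-x)‖ := by
  have : 𝓕 (mx k (rf φ) : ℝ → ℂ) x = (-1) ^ k * 𝓕 (mx k φ : ℝ → ℂ) (-x) := by
    rw [four_ex, four_ex, ← integral_const_mul]
    rw [← integral_neg_eq_self]
    congr 1; ext v
    rw [mx_apply, mx_apply, rf_apply, neg_neg, neg_mul, mul_neg]
    push_cast
    rw [neg_pow]; ring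
  rw [this]; simp

theorem τ_split (m n : ℕ) (φ γ : 𝓢(ℝ, ℂ)) (c : ℂ) (a : ℝ) :
    (a : ℂ) ^ m * τ φ (fun b => c * mx n γ b) a =
      c * (G m n φ γ a - (-1) ^ (m + n) * G m n (rf φ) (rf γ) (-a)) := by
  unfold τ G
  rcases lt_trichotomy a 0 with ha | rfl | ha
  · rw [if_neg ha.not_gt, if_pos (by linarith)]
    have e : ∫ b, kk a b * φ (a + b) * (c * mx n γ b) =
        - c * (-1) ^ n * ∫ b in Set.Ioi (0:ℝ), rf φ (-a + b) * ((b : ℂ) ^ n * rf γ b) := by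
      rw [← integral_const_mul, ← integral_neg_eq_self, ← integral_indicator measurableSet_Ioi]
      congr 1; ext b
      by_cases hb : 0 < b
      · rw [Set.indicator_of_mem (show b ∈ Set.Ioi (0:ℝ) from hb), kk_neg ha (by linarith), mx_apply, rf_apply, rf_apply]
        rw [show -(-a + b) = a + -b by ring]
        push_cast
        rw [neg_pow (b : ℂ)]; ring
      · rw [Set.indicator_of_notMem (show b ∉ Set.Ioi (0:ℝ) from hb), kk_zero]
        · simp
        · rintro ⟨h, _⟩; linarith
        · rintro ⟨_, h⟩; linarith
    rw [e]
    push_cast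
    rw [neg_pow (a : ℂ), pow_add]
    have : ((-1 : ℂ) ^ m) * (-1) ^ m = 1 := by rw [← mul_pow]; simp
    linear_combination (-(c * (-1) ^ n * (a : ℂ) ^ m * ∫ b in Set.Ioi (0:ℝ), rf φ (-a + b) * ((b : ℂ) ^ n * rf γ b))) * (1 - this)
  · have : ∀ b, kk 0 b = 0 := fun b => kk_zero (by simp) (by simp)
    simp [this]
  · rw [if_pos ha, if_neg (by linarith)]
    have e : ∫ b, kk a b * φ (a + b) * (c * mx n γ b) =
        c * ∫ b in Set.Ioi (0:ℝ), φ (a + b) * ((b : ℂ) ^ n * γ b) := by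
      rw [← integral_const_mul, ← integral_indicator measurableSet_Ioi]
      congr 1; ext b
      by_cases hb : 0 < b
      · rw [Set.indicator_of_mem (show b ∈ Set.Ioi (0:ℝ) from hb), kk_pos ha hb, mx_apply]
        ring
      · rw [Set.indicator_of_notMem (show b ∉ Set.Ioi (0:ℝ) from hb), kk_zero]
        · simp
        · rintro ⟨_, h⟩; exact hb h
        · rintro ⟨h, _⟩; linarith
    rw [e]; ring

theorem iter_int (g : 𝓢(ℝ, ℂ)) (n : ℕ) : Integrable (iteratedDeriv n g) := by
  have h := g.integrable_pow_mul_iteratedFDeriv volume 0 n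
  have hc : Continuous (iteratedDeriv n g) := (g.smooth n).continuous_iteratedDeriv n le_rfl
  refine h.mono' hc.aestronglyMeasurable (.of_forall fun x => ?_)
  simp [norm_iteratedFDeriv_eq_norm_iteratedDeriv]

theorem sup_bound {F : ℝ → ℂ} (hc : Continuous F) {K : ℝ} (hK : ∀ x, ‖F x‖ ≤ K) :
    eLpNorm F ⊤ volume ≠ ⊤ ∧ ∀ x, ‖F x‖ ≤ (eLpNorm F ⊤ volume).toReal := by
  have h1 : eLpNorm F ⊤ volume < ⊤ := by
    rw [eLpNorm_exponent_top]
    exact eLpNormEssSup_lt_top_of_ae_bound (.of_forall hK)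
  refine ⟨h1.ne, fun x => ?_⟩
  have h2 : ∀ᵐ x, ‖F x‖ₑ ≤ eLpNorm F ⊤ volume := by
    rw [eLpNorm_exponent_top]; exact enorm_ae_le_eLpNormEssSup F volume
  have hd : Dense {x | ‖F x‖ₑ ≤ eLpNorm F ⊤ volume} := Measure.dense_of_ae h2
  have hcl : IsClosed {x | ‖F x‖ₑ ≤ eLpNorm F ⊤ volume} := isClosed_le hc.enorm continuous_const
  have : x ∈ {x | ‖F x‖ₑ ≤ eLpNorm F ⊤ volume} := by
    rw [← hcl.closure_eq]; exact hd x
  have := ENNReal.toReal_mono h1.ne this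
  simpa using this

theorem iter_fourier (φ : 𝓢(ℝ, ℂ)) (k : ℕ) (x : ℝ) :
    iteratedDeriv k (𝓕 (φ : ℝ → ℂ)) x = (-2 * Real.pi * I) ^ k * 𝓕 (mx k φ : ℝ → ℂ) x := by
  rw [Real.iteratedDeriv_fourier (N := ⊤) (n := k) (f := (φ : ℝ → ℂ)) ?_ le_top]
  · rw [four_ex, four_ex, ← integral_const_mul]
    congr 1; ext v
    rw [mx_apply, smul_eq_mul, mul_pow]; ring
  · intro n _
    refine (mx n φ).integrable.congr (.of_forall fun x => ?_)
    rw [mx_apply]; simp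

theorem slope_bound (φ : 𝓢(ℝ, ℂ)) : ∃ B, ∀ α β : ℝ,
    ‖(𝓕 (φ : ℝ → ℂ) α - 𝓕 (φ : ℝ → ℂ) β) / ((α - β : ℝ) : ℂ)‖ ≤ B := by
  refine ⟨2 * Real.pi * ∫ z : ℝ × ℝ, ‖kk z.1 z.2 * φ (z.1 + z.2)‖ ∂(volume.prod volume), fun α β => ?_⟩
  have p := Real.pi_pos
  by_cases h : α = β
  · rw [h]
    simp only [sub_self, zero_div, norm_zero]
    have : 0 ≤ ∫ z : ℝ × ℝ, ‖kk z.1 z.2 * φ (z.1 + z.2)‖ ∂(volume.prod volume) :=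
      integral_nonneg fun z => norm_nonneg _
    positivity
  rw [slope_rep φ α β h, norm_mul]
  have : ‖(-2 * Real.pi * I : ℂ)‖ = 2 * Real.pi := by simp [abs_of_pos p]
  rw [this]
  gcongr
  refine (norm_integral_le_integral_norm _).trans (le_of_eq ?_)
  congr 1; ext z
  rw [norm_mul _ (ex _), ex_norm, mul_one]

theorem final (m n : ℕ) : ∃ C : ℝ, 0 < C ∧ ∀ f g : SchwartzMap ℝ ℂ,
    (∀ α : ℝ, Integrable (fun β : ℝ => (f α - f β) / ((α - β : ℝ) : ℂ) * iteratedDeriv n (⇑g) β)) ∧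
    ContDiff ℝ (⊤ : ℕ∞) (fun α : ℝ => ((1 / Real.pi : ℝ) : ℂ) *
      ∫ β : ℝ, (f α - f β) / ((α - β : ℝ) : ℂ) * iteratedDeriv n (⇑g) β) ∧
    eLpNorm (iteratedDeriv m (fun α : ℝ => ((1 / Real.pi : ℝ) : ℂ) *
      ∫ β : ℝ, (f α - f β) / ((α - β : ℝ) : ℂ) * iteratedDeriv n (⇑g) β)) 2 volume ≤
      ENNReal.ofReal C * eLpNorm (iteratedDeriv (m + n) (⇑f)) ⊤ volume * eLpNorm (⇑g) 2 volume := by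
  obtain ⟨C0, hC0, hank⟩ := Hankel m n
  set cc : ℂ := (-2 * Real.pi * I) ^ m * (((1 / Real.pi : ℝ) : ℂ) * (-2 * Real.pi * I)) * (2 * Real.pi * I) ^ n with hcc
  refine ⟨‖cc‖ * (2 * C0) + 1, by positivity, fun f g => ?_⟩
  set φ : 𝓢(ℝ, ℂ) := 𝓕⁻ f with hφ
  set γ : 𝓢(ℝ, ℂ) := 𝓕 g with hγ
  have hf : ∀ x, f x = 𝓕 (φ : ℝ → ℂ) x := by
    intro x
    rw [← SchwartzMap.fourier_coe, hφ, FourierTransform.fourier_fourierInv_eq]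
  have hf' : (f : ℝ → ℂ) = 𝓕 (φ : ℝ → ℂ) := funext hf
  have gi := iter_int g n
  have hû : 𝓕 (iteratedDeriv n g) = fun b => (2 * Real.pi * I) ^ n * mx n γ b := by
    rw [Real.fourier_iteratedDeriv (N := ⊤) (g.smooth ⊤) (fun k _ => iter_int g k) le_top]
    ext b
    rw [mx_apply, hγ, SchwartzMap.fourier_coe, smul_eq_mul, mul_pow]; ring
  have aû : Adm (fun b => (2 * Real.pi * I) ^ n * mx n γ b) :=
    (adm_schwartz (mx n γ)).mul (q := fun _ => (2 * Real.pi * I) ^ n) measurable_const (fun _ => le_rfl)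
  set τ0 := τ φ (fun b => (2 * Real.pi * I) ^ n * mx n γ b) with hτ0
  set c1 : ℂ := ((1 / Real.pi : ℝ) : ℂ) * (-2 * Real.pi * I) with hc1
  have hT : (fun α : ℝ => ((1 / Real.pi : ℝ) : ℂ) *
      ∫ β : ℝ, (f α - f β) / ((α - β : ℝ) : ℂ) * iteratedDeriv n (⇑g) β) = 𝓕 (fun a => c1 * τ0 a) := by
    ext α
    simp only [hf]
    rw [T_rep φ gi α, hû, four_ex, four_ex, ← mul_assoc, ← integral_const_mul]
    congr 1; ext a; ring
  have mom : ∀ k : ℕ, Integrable (fun a : ℝ => (a : ℂ) ^ k * τ0 a) := fun k => (τ_adm φ aû k).int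
  rw [hT]
  refine ⟨fun α => ?_, ?_, ?_⟩
  · obtain ⟨B, hB⟩ := slope_bound φ
    simp only [hf]
    refine gi.bdd_mul (c := B) ?_ (.of_forall fun β => hB α β)
    have := (fourier_continuous φ.integrable).measurable
    refine Measurable.aestronglyMeasurable ?_
    fun_prop
  · refine Real.contDiff_fourier fun k _ => ?_
    refine ((mom k).const_mul c1).norm.congr (.of_forall fun a => ?_)
    simp only [norm_mul, norm_pow, Complex.norm_real]
    ring
  · rw [Real.iteratedDeriv_fourier (N := ⊤) (n := m) ?_ le_top]
    swap
    · intro k _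
      refine ((mom k).const_mul c1).congr (.of_forall fun a => ?_)
      simp only [Complex.real_smul, ofReal_pow]; ring
    set Gp := G m n φ γ with hGp
    set Gm : ℝ → ℂ := fun a => G m n (rf φ) (rf γ) (-a) with hGm
    have e : (fun a : ℝ => (-2 * Real.pi * I * a) ^ m • (c1 * τ0 a)) =
        fun a : ℝ => ((-2 * Real.pi * I) ^ m * c1) * ((a : ℂ) ^ m * τ0 a) := by
      ext a; rw [smul_eq_mul, mul_pow]; ring
    have ad : Adm (fun a : ℝ => ((-2 * Real.pi * I) ^ m * c1) * ((a : ℂ) ^ m * τ0 a)) :=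
      (τ_adm φ aû m).mul (q := fun _ => ((-2 * Real.pi * I) ^ m * c1)) measurable_const (fun _ => le_rfl)
    rw [e, plancherel_eLpNorm ad.int ad.memLp]
    have e2 : (fun a : ℝ => ((-2 * Real.pi * I) ^ m * c1) * ((a : ℂ) ^ m * τ0 a)) =
        cc • (Gp - (-1 : ℂ) ^ (m + n) • Gm) := by
      ext a
      rw [hτ0, τ_split]
      simp only [Pi.smul_apply, Pi.sub_apply, smul_eq_mul, hGp, hGm, hcc]
      ring
    rw [e2, eLpNorm_const_smul]
    obtain ⟨K, hK⟩ := (adm_schwartz (mx (m + n) φ)).bdd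
    have hFc : Continuous (iteratedDeriv (m + n) f) := (f.smooth (m + n : ℕ)).continuous_iteratedDeriv _ le_rfl
    obtain ⟨D, hD⟩ := f.decay 0 (m + n)
    obtain ⟨s1, s2⟩ := sup_bound hFc (K := D) (fun x => by
      have := hD.2 x
      simpa [norm_iteratedFDeriv_eq_norm_iteratedDeriv] using this)
    set S := eLpNorm (iteratedDeriv (m + n) f) ⊤ volume with hS
    have hM : ∀ x, ‖𝓕 (mx (m + n) φ : ℝ → ℂ) x‖ ≤ S.toReal := by
      intro x
      have h1 := s2 x
      rw [hf', iter_fourier, norm_mul, norm_pow] at h1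
      have : (1:ℝ) ≤ ‖(-2 * Real.pi * I : ℂ)‖ := by
        have := Real.pi_gt_three
        simp [abs_of_pos Real.pi_pos]; linarith
      exact (le_mul_of_one_le_left (norm_nonneg _) (one_le_pow₀ this)).trans h1
    have b1 := hank φ γ S.toReal hM
    have b2 := hank (rf φ) (rf γ) S.toReal (fun x => by rw [fourier_rf]; exact hM _)
    have negp : MeasurePreserving (fun x : ℝ => -x) volume volume := Measure.measurePreserving_neg _
    have emb : MeasurableEmbedding (fun x : ℝ => -x) := (Homeomorph.neg ℝ).measurableEmbedding
    have n1 : eLpNorm (rf γ) 2 volume = eLpNorm γ 2 volume := by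
      have e3 : (rf γ : ℝ → ℂ) = (γ : ℝ → ℂ) ∘ (fun x : ℝ => -x) := funext fun x => rf_apply γ x
      rw [e3]
      exact eLpNorm_comp_measurePreserving γ.continuous.aestronglyMeasurable negp
    have mG : ∀ ψ η : 𝓢(ℝ, ℂ), Measurable (G m n ψ η) := by
      intro ψ η
      unfold G
      refine Measurable.ite measurableSet_Ioi ?_ measurable_const
      have h1 : StronglyMeasurable (Function.uncurry fun a b : ℝ => ψ (a + b) * ((b : ℂ) ^ n * η b)) := by
        have := ψ.continuous
        have := η.continuous
        refine Continuous.stronglyMeasurable ?_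
        unfold Function.uncurry
        fun_prop
      have h2 := (h1.integral_prod_right (ν := volume.restrict (Set.Ioi 0))).measurable
      have h3 : Measurable (fun a : ℝ => (a : ℂ) ^ m) := by fun_prop
      exact h3.mul h2
    have n2 : eLpNorm Gm 2 volume = eLpNorm (G m n (rf φ) (rf γ)) 2 volume := by
      have e3 : Gm = (G m n (rf φ) (rf γ)) ∘ (fun x : ℝ => -x) := rfl
      rw [e3]
      exact eLpNorm_comp_measurePreserving (mG _ _).aestronglyMeasurable negp
    have n3 : eLpNorm γ 2 volume = eLpNorm g 2 volume := by
      rw [hγ, SchwartzMap.fourier_coe]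
      exact plancherel_eLpNorm g.integrable (adm_schwartz g).memLp
    rw [n1, n3, ← n2] at b2
    rw [n3] at b1
    have mGm : Measurable Gm := (mG _ _).comp measurable_neg
    have tri : eLpNorm (Gp - (-1 : ℂ) ^ (m + n) • Gm) 2 volume ≤
        ENNReal.ofReal (2 * C0) * S * eLpNorm g 2 volume := by
      refine (eLpNorm_sub_le (mG _ _).aestronglyMeasurable (mGm.const_smul _).aestronglyMeasurable (by norm_num)).trans ?_
      rw [eLpNorm_const_smul]
      have : ‖(-1 : ℂ) ^ (m + n)‖ₑ = 1 := by simp [enorm_pow]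
      rw [this, one_mul]
      refine (add_le_add b1 b2).trans (le_of_eq ?_)
      rw [ENNReal.ofReal_mul hC0, ENNReal.ofReal_toReal s1, ENNReal.ofReal_mul (by norm_num)]
      rw [ENNReal.ofReal_ofNat]; ring
    calc _ ≤ ‖cc‖ₑ * (ENNReal.ofReal (2 * C0) * S * eLpNorm g 2 volume) := by gcongr
      _ = ENNReal.ofReal (‖cc‖ * (2 * C0)) * S * eLpNorm g 2 volume := by
        rw [ENNReal.ofReal_mul (norm_nonneg _), ofReal_norm]; ring
      _ ≤ _ := by gcongr; linarith

end Comm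
end

/-- for all `m, n ≥ 0` there is `C(m, n) > 0` so that for all Schwartz
`f, g`, the function `T(α) = (1/π) ∫ ((f(α) − f(β))/(α − β)) g^{(n)}(β) dβ` (absolutely
convergent) is smooth and `‖T^{(m)}‖_{L²} ≤ C(m, n)‖f^{(m+n)}‖_{L^∞}‖g‖_{L²}`. -/
theorem statement19 : ∀ m n : ℕ, ∃ C : ℝ, 0 < C ∧ ∀ f g : SchwartzMap ℝ ℂ,
    (∀ α : ℝ, Integrable (fun β : ℝ =>
        (f α - f β) / ((α - β : ℝ) : ℂ) * iteratedDeriv n (⇑g) β)) ∧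
    ContDiff ℝ (⊤ : ℕ∞) (fun α : ℝ => ((1 / Real.pi : ℝ) : ℂ) *
        ∫ β : ℝ, (f α - f β) / ((α - β : ℝ) : ℂ) * iteratedDeriv n (⇑g) β) ∧
    eLpNorm (iteratedDeriv m (fun α : ℝ => ((1 / Real.pi : ℝ) : ℂ) *
        ∫ β : ℝ, (f α - f β) / ((α - β : ℝ) : ℂ) * iteratedDeriv n (⇑g) β)) 2 volume
      ≤ ENNReal.ofReal C * eLpNorm (iteratedDeriv (m + n) (⇑f)) ⊤ volume *
          eLpNorm (⇑g) 2 volume := by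
  intro m n
  exact Comm.final m n
end
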